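/- There exists N ∈ ℕ such that for every n ≥ N and every σ ∈ S_n with c₁(σ) ≥ 2 and |supp(σ)| ≥ N - 2, the standard representation rules for σ: for every irreducible complex character χ of S_n other than the trivial and sign characters, χ̃(σ) ≤ (c₁(σ)-1)/(n-1). -/

import Mathlib

open CategoryTheory

/-- `c₁(σ)`: the number of fixed points of a permutation. -/
def fixCount {n : ℕ} (σ : Equiv.Perm (Fin n)) : ℕ :=
  (Finset.univ.filter fun x => σ x = x).card

/-- `c_ℓ(σ)`: the number of `ℓ`-cycles of a permutation (for `ℓ ≥ 2`). -/
def cyc {n : ℕ} (ℓ : ℕ) (σ : Equiv.Perm (Fin n)) : ℕ :=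
  Multiset.count ℓ σ.cycleType

/-- The (real-valued) normalized character `χ̃(σ) = χ(σ)/χ(1)` of `V` at `σ`. -/
noncomputable def normChar {n : ℕ} (V : FDRep ℂ (Equiv.Perm (Fin n)))
    (σ : Equiv.Perm (Fin n)) : ℝ :=
  (V.character σ / V.character 1).re

/-- `V` is an irreducible representation whose character is neither the trivial
character nor the sign character. -/
def IsNontrivIrr {n : ℕ} (V : FDRep ℂ (Equiv.Perm (Fin n))) : Prop :=
  Simple V ∧ V.character ≠ (fun _ => 1) ∧
    V.character ≠ (fun σ => ((Equiv.Perm.sign σ : ℤ) : ℂ))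

/-- The maximum of the normalized characters `F₁(σ), …, F₈(σ)` at `σ` of the eight
irreps `EIGHT_n = {(n-1,1), (n-2,2), (n-3,3), (n-3,2,1), (n-4,4),
(n-1,1)ᵗ, (n-2,2)ᵗ, (n-2,1,1)ᵗ}`. -/
noncomputable def maxF (n : ℕ) (σ : Equiv.Perm (Fin n)) : ℝ :=
  let c1 : ℝ := fixCount σ
  let c2 : ℝ := cyc 2 σ
  let c3 : ℝ := cyc 3 σ
  let c4 : ℝ := cyc 4 σ
  let e : ℝ := ((Equiv.Perm.sign σ : ℤ) : ℝ)
  let N : ℝ := n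
  let F1 := (c1 - 1) / (N - 1)
  let F2 := (c1 * (c1 - 3) / 2 + c2) / (N * (N - 3) / 2)
  let F3 := (c1 * (c1 - 1) * (c1 - 5) / 6 + (c1 - 1) * c2 + c3) / (N * (N - 1) * (N - 5) / 6)
  let F4 := (c1 * (c1 - 2) * (c1 - 4) / 3 - c3) / (N * (N - 2) * (N - 4) / 3)
  let F5 := (c1 * (c1 - 1) * (c1 - 2) * (c1 - 7) / 24 + (c1 ^ 2 - 3 * c1 - 1) * c2 / 2
      + c2 ^ 2 / 2 + (c1 - 1) * c3 + c4) / (N * (N - 1) * (N - 2) * (N - 7) / 24)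
  let F6 := e * F1
  let F7 := e * F2
  let F8 := e * ((c1 - 1) * (c1 - 2) / 2 - c2) / ((N - 1) * (N - 2) / 2)
  max (max (max F1 F2) (max F3 F4)) (max (max F5 F6) (max F7 F8))

set_option linter.unusedSectionVars false

/-- All eigenvalues of `X` have modulus at most `a`. -/
def EigenBound {V : Type} [AddCommGroup V] [Module ℂ V] (X : Module.End ℂ V) (a : ℝ) : Prop :=
  ∀ (μ : ℂ) (v : V), v ≠ 0 → X v = μ • v → ‖μ‖ ≤ a

section Spectral

variable {V : Type} [AddCommGroup V] [Module ℂ V]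

lemma EigenBound.norm_trace_le [FiniteDimensional ℂ V] {X : Module.End ℂ V} {a : ℝ}
    (h : EigenBound X a) :
    ‖LinearMap.trace ℂ V X‖ ≤ a * Module.finrank ℂ V := by
  have hs : X.charpoly.Splits := IsAlgClosed.splits _
  rw [Module.End.trace_eq_sum_roots_charpoly_of_splits hs]
  have hcard : X.charpoly.roots.card = Module.finrank ℂ V := by
    rw [← hs.natDegree_eq_card_roots, LinearMap.charpoly_natDegree]
  have key : ∀ μ ∈ X.charpoly.roots, ‖μ‖ ≤ a := by
    intro μ hμ
    have h1 : X.charpoly.IsRoot μ := (Polynomial.mem_roots'.1 hμ).2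
    rw [← Module.End.hasEigenvalue_iff_isRoot_charpoly] at h1
    obtain ⟨v, hv⟩ := h1.exists_hasEigenvector
    exact h μ v hv.2 hv.apply_eq_smul
  have h2 : ‖X.charpoly.roots.sum‖ ≤ (X.charpoly.roots.map (fun μ => ‖μ‖)).sum :=
    norm_multiset_sum_le _
  refine h2.trans ?_
  have h3 : (X.charpoly.roots.map (fun μ => ‖μ‖)).sum
      ≤ (X.charpoly.roots.map (fun μ => ‖μ‖)).card • a := by
    apply Multiset.sum_le_card_nsmul
    intro x hx
    obtain ⟨μ, hμ, rfl⟩ := Multiset.mem_map.1 hx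
    exact key μ hμ
  rw [Multiset.card_map, hcard, nsmul_eq_mul, mul_comm] at h3
  exact h3

/-- A nonzero subspace stable under an operator of a finite dimensional complex vector space
contains an eigenvector. -/
lemma exists_eigenvector_of_stable [FiniteDimensional ℂ V] (X : Module.End ℂ V)
    (W : Submodule ℂ V) (hW : W ≠ ⊥) (hX : ∀ v ∈ W, X v ∈ W) :
    ∃ (μ : ℂ) (v : V), v ∈ W ∧ v ≠ 0 ∧ X v = μ • v := by
  have : Nontrivial W := Submodule.nontrivial_iff_ne_bot.2 hW
  obtain ⟨μ, hμ⟩ := Module.End.exists_eigenvalue (X.restrict hX)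
  obtain ⟨v, hv⟩ := hμ.exists_hasEigenvector
  refine ⟨μ, v, v.2, fun h => hv.2 (Subtype.ext h), ?_⟩
  have := congrArg Subtype.val hv.apply_eq_smul
  simpa using this

lemma EigenBound.mul [FiniteDimensional ℂ V] {X T : Module.End ℂ V} {a c : ℝ}
    (hX : EigenBound X a) (hT : EigenBound T c) (hc : 0 ≤ c) (hXT : X * T = T * X) :
    EigenBound (T * X) (c * a) := by
  intro μ v hv hv1
  set W := LinearMap.ker (T * X - μ • (1 : Module.End ℂ V)) with hWdef
  have memW : ∀ w, w ∈ W ↔ T (X w) = μ • w := by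
    intro w
    simp [hWdef, sub_eq_zero]
  have hcomm : ∀ w, X (T w) = T (X w) := fun w => LinearMap.congr_fun hXT w
  have hW : W ≠ ⊥ := by
    intro h
    have : v ∈ W := (memW v).2 hv1
    rw [h] at this
    exact hv (by simpa using this)
  obtain ⟨z, w, hw, hw0, hTw⟩ := exists_eigenvector_of_stable T W hW (by
    intro w hw
    rw [memW] at hw ⊢
    rw [hcomm, hw, map_smul])
  rw [memW] at hw
  have hzc : ‖z‖ ≤ c := hT z w hw0 hTw
  by_cases hz : z = 0
  · have : μ • w = 0 := by rw [← hw, ← hcomm, hTw, hz]; simp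
    have hμ : μ = 0 := (smul_eq_zero.1 this).resolve_right hw0
    have ha : 0 ≤ a := by
      have : Nontrivial V := ⟨w, 0, hw0⟩
      obtain ⟨ν, hν⟩ := Module.End.exists_eigenvalue X
      obtain ⟨u, hu⟩ := hν.exists_hasEigenvector
      exact (norm_nonneg ν).trans (hX ν u hu.2 hu.apply_eq_smul)
    rw [hμ, norm_zero]
    positivity
  · have h1 : X w = (μ / z) • w := by
      have : z • X w = μ • w := by rw [← hw, ← hcomm, hTw, map_smul]
      rw [div_eq_inv_mul, mul_smul, ← this, smul_smul, inv_mul_cancel₀ hz, one_smul]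
    have h2 := hX _ _ hw0 h1
    have h3 : μ = z * (μ / z) := by field_simp
    rw [h3, norm_mul]
    exact mul_le_mul hzc h2 (norm_nonneg _) hc

lemma EigenBound.one : EigenBound (1 : Module.End ℂ V) 1 := by
  intro μ v hv h
  have h' : v = μ • v := h
  have : (μ - 1) • v = 0 := by rw [sub_smul, ← h', one_smul, sub_self]
  have := (smul_eq_zero.1 this).resolve_right hv
  rw [sub_eq_zero.1 this]; simp

end Spectral

section ClassAverage

variable {H : Type} [Group H] {V : Type} [AddCommGroup V] [Module ℂ V]

/-- Every invariant subspace is trivial, and the space is nonzero. -/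
def IsIrr (τ : Representation ℂ H V) : Prop :=
  Nontrivial V ∧ ∀ W : Submodule ℂ V, (∀ h, ∀ v ∈ W, τ h v ∈ W) → W = ⊥ ∨ W = ⊤

/-- The restriction of a representation to an invariant subspace. -/
abbrev subRep (τ : Representation ℂ H V) (W : Submodule ℂ V) (hW : ∀ h, ∀ v ∈ W, τ h v ∈ W) :
    Representation ℂ H W :=
  Subrepresentation.toRepresentation ⟨W, fun h _ hv => hW h _ hv⟩

@[simp] lemma subRep_apply_coe (τ : Representation ℂ H V) (W : Submodule ℂ V)
    (hW : ∀ h, ∀ v ∈ W, τ h v ∈ W) (h : H) (w : W) : (subRep τ W hW h w : V) = τ h w := rfl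

lemma exists_irr_subRep [FiniteDimensional ℂ V] (τ : Representation ℂ H V) (U : Submodule ℂ V)
    (hU : U ≠ ⊥) (hUs : ∀ h, ∀ v ∈ U, τ h v ∈ U) :
    ∃ (W : Submodule ℂ V) (hW : ∀ h, ∀ v ∈ W, τ h v ∈ W), W ≤ U ∧ IsIrr (subRep τ W hW) := by
  classical
  have hwf : ∃ W : Submodule ℂ V, (W ≠ ⊥ ∧ W ≤ U ∧ ∀ h, ∀ v ∈ W, τ h v ∈ W) ∧
      ∀ W' : Submodule ℂ V, (W' ≠ ⊥ ∧ W' ≤ U ∧ ∀ h, ∀ v ∈ W', τ h v ∈ W') → ¬ W' < W := by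
    obtain ⟨W, hW, hmin⟩ := WellFounded.has_min (wellFounded_lt (α := Submodule ℂ V))
      {W | W ≠ ⊥ ∧ W ≤ U ∧ ∀ h, ∀ v ∈ W, τ h v ∈ W} ⟨U, hU, le_rfl, hUs⟩
    exact ⟨W, hW, fun W' hW' => hmin W' hW'⟩
  obtain ⟨W, ⟨hW0, hWU, hWs⟩, hmin⟩ := hwf
  refine ⟨W, hWs, hWU, Submodule.nontrivial_iff_ne_bot.2 hW0, ?_⟩
  intro W' hW'
  by_cases hbot : W' = ⊥
  · exact Or.inl hbot
  · right
    have hle : W'.map W.subtype ≤ W := Submodule.map_subtype_le _ _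
    have h1 := hmin (W'.map W.subtype) ⟨by
      intro h
      exact hbot (Submodule.map_injective_of_injective W.injective_subtype (by rw [h]; simp)),
      hle.trans hWU, by
      rintro h _ ⟨w, hw, rfl⟩
      exact ⟨_, hW' h w hw, rfl⟩⟩
    have h2 : W'.map W.subtype = W := by
      by_contra hne
      exact h1 (lt_of_le_of_ne hle hne)
    rw [eq_top_iff]
    rintro ⟨x, hx⟩ -
    have hx' : x ∈ W'.map W.subtype := by rw [h2]; exact hx
    obtain ⟨y, hy, hyx⟩ := hx'
    have : y = ⟨x, hx⟩ := Subtype.ext hyx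
    rwa [← this]

variable [Fintype H]

/-- The average of the operators of a representation over a conjugacy class. -/
noncomputable def classAvg (τ : Representation ℂ H V) (x : H) : Module.End ℂ V :=
  (Fintype.card H : ℂ)⁻¹ • ∑ h, τ (h * x * h⁻¹)

lemma classAvg_apply (τ : Representation ℂ H V) (x : H) (v : V) :
    classAvg τ x v = (Fintype.card H : ℂ)⁻¹ • ∑ h, τ (h * x * h⁻¹) v := by
  simp [classAvg, LinearMap.sum_apply]

lemma card_ne_zero_complex : (Fintype.card H : ℂ) ≠ 0 := by
  exact_mod_cast Fintype.card_ne_zero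

lemma commute_classAvg (τ : Representation ℂ H V) (x k : H) :
    τ k * classAvg τ x = classAvg τ x * τ k := by
  simp only [classAvg, mul_smul_comm, smul_mul_assoc, Finset.mul_sum, Finset.sum_mul]
  congr 1
  apply Fintype.sum_equiv (Equiv.mulLeft k)
  intro h
  rw [← map_mul, ← map_mul]
  congr 1
  simp [mul_assoc]

lemma classAvg_commute_of_commute (τ : Representation ℂ H V) (x : H) (Y : Module.End ℂ V)
    (hY : ∀ h, τ h * Y = Y * τ h) : Y * classAvg τ x = classAvg τ x * Y := by
  simp only [classAvg, mul_smul_comm, smul_mul_assoc, Finset.mul_sum, Finset.sum_mul, hY]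

lemma trace_mul_eq_trace_classAvg_mul (τ : Representation ℂ H V) (x : H) (Y : Module.End ℂ V)
    (hY : ∀ h, τ h * Y = Y * τ h) :
    LinearMap.trace ℂ V (τ x * Y) = LinearMap.trace ℂ V (classAvg τ x * Y) := by
  have h1 : ∀ h, LinearMap.trace ℂ V (τ (h * x * h⁻¹) * Y) = LinearMap.trace ℂ V (τ x * Y) := by
    intro h
    have : τ (h * x * h⁻¹) * Y = τ h * (τ x * Y * τ h⁻¹) := by
      rw [mul_assoc (τ x), ← hY, map_mul, map_mul]; simp only [mul_assoc]
    rw [this, LinearMap.trace_mul_comm, mul_assoc, ← map_mul]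
    simp
  simp only [classAvg, smul_mul_assoc, Finset.sum_mul, map_smul, map_sum, h1]
  simp only [Finset.sum_const, Finset.card_univ, nsmul_eq_mul, smul_eq_mul]
  rw [← mul_assoc, inv_mul_cancel₀ card_ne_zero_complex, one_mul]

/-- Eigenvalues of a class average are normalized characters of irreducible constituents. -/
lemma exists_irr_of_eigenvector_classAvg [FiniteDimensional ℂ V] (τ : Representation ℂ H V) (x : H)
    (z : ℂ) (v : V) (hv : v ≠ 0) (hz : classAvg τ x v = z • v) :
    ∃ (W : Submodule ℂ V) (hW : ∀ h, ∀ v ∈ W, τ h v ∈ W), IsIrr (subRep τ W hW) ∧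
      LinearMap.trace ℂ W (subRep τ W hW x) = z * Module.finrank ℂ W := by
  set U := LinearMap.ker (classAvg τ x - z • (1 : Module.End ℂ V)) with hUdef
  have memU : ∀ w, w ∈ U ↔ classAvg τ x w = z • w := by
    intro w
    simp [hUdef, sub_eq_zero]
  obtain ⟨W, hW, hWU, hirr⟩ := exists_irr_subRep τ U (by
    intro h
    have : v ∈ U := (memU v).2 hz
    rw [h] at this
    exact hv (by simpa using this)) (by
    intro h w hw
    rw [memU] at hw ⊢
    have := LinearMap.congr_fun (commute_classAvg τ x h) w
    simp only [Module.End.mul_apply] at this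
    rw [← this, hw, map_smul])
  refine ⟨W, hW, hirr, ?_⟩
  have h1 := trace_mul_eq_trace_classAvg_mul (subRep τ W hW) x 1 (by simp)
  rw [mul_one, mul_one] at h1
  have h2 : classAvg (subRep τ W hW) x = z • (1 : Module.End ℂ W) := by
    ext w
    have := (memU w).1 (hWU w.2)
    rw [classAvg_apply] at this
    rw [classAvg_apply]
    simpa using this
  rw [h1, h2, map_smul, LinearMap.trace_one, smul_eq_mul]

lemma eigenBound_classAvg [FiniteDimensional ℂ V] (τ : Representation ℂ H V) (x : H) (a : ℝ)
    (h : ∀ (W : Submodule ℂ V) (hW : ∀ h, ∀ v ∈ W, τ h v ∈ W), IsIrr (subRep τ W hW) →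
      ‖LinearMap.trace ℂ W (subRep τ W hW x)‖ ≤ a * Module.finrank ℂ W) :
    EigenBound (classAvg τ x) a := by
  intro z v hv hz
  obtain ⟨W, hW, hirr, htr⟩ := exists_irr_of_eigenvector_classAvg τ x z v hv hz
  have h1 := h W hW hirr
  have := hirr.1
  have hpos : (0 : ℝ) < Module.finrank ℂ W := by exact_mod_cast Module.finrank_pos
  rw [htr, norm_mul, Complex.norm_natCast] at h1
  exact le_of_mul_le_mul_right h1 hpos

/-- On an irreducible representation, a class average is a scalar. -/
lemma IsIrr.classAvg_eq [FiniteDimensional ℂ V] {τ : Representation ℂ H V} (hτ : IsIrr τ)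
    (x : H) : ∃ z : ℂ, classAvg τ x = z • (1 : Module.End ℂ V) ∧
      LinearMap.trace ℂ V (τ x) = z * Module.finrank ℂ V := by
  have := hτ.1
  obtain ⟨z, hz⟩ := Module.End.exists_eigenvalue (classAvg τ x)
  obtain ⟨v, hv⟩ := hz.exists_hasEigenvector
  have memU : ∀ w, w ∈ LinearMap.ker (classAvg τ x - z • (1 : Module.End ℂ V)) ↔
      classAvg τ x w = z • w := by
    intro w
    simp [sub_eq_zero]
  have htop := (hτ.2 (LinearMap.ker (classAvg τ x - z • (1 : Module.End ℂ V))) (by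
    intro h w hw
    rw [memU] at hw ⊢
    have := LinearMap.congr_fun (commute_classAvg τ x h) w
    simp only [Module.End.mul_apply] at this
    rw [← this, hw, map_smul])).resolve_left (by
    intro h
    have h1 := (memU v).2 hv.apply_eq_smul
    rw [h] at h1
    exact hv.2 (by simpa using h1))
  have hT : classAvg τ x = z • (1 : Module.End ℂ V) := by
    ext w
    have : w ∈ (⊤ : Submodule ℂ V) := trivial
    rw [← htop, memU] at this
    simpa using this
  refine ⟨z, hT, ?_⟩
  have h1 := trace_mul_eq_trace_classAvg_mul τ x 1 (by simp)
  rw [mul_one, mul_one] at h1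
  rw [h1, hT, map_smul, LinearMap.trace_one, smul_eq_mul]

lemma eigenBound_rep (τ : Representation ℂ H V) (x : H) : EigenBound (τ x) 1 := by
  intro μ v hv h
  have h1 : ∀ k : ℕ, (τ (x ^ k)) v = μ ^ k • v := by
    intro k
    induction k with
    | zero => simp
    | succ k ih =>
      rw [pow_succ, map_mul, Module.End.mul_apply, h, map_smul, ih, smul_smul, pow_succ, mul_comm]
  have h2 := h1 (Fintype.card H)
  rw [pow_card_eq_one, map_one] at h2
  have h3 : (μ ^ Fintype.card H - 1) • v = 0 := by
    rw [sub_smul, ← h2]; simp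
  have h4 := (smul_eq_zero.1 h3).resolve_right hv
  have h5 : μ ^ Fintype.card H = 1 := sub_eq_zero.1 h4
  have h6 : ‖μ‖ ^ Fintype.card H = 1 := by rw [← norm_pow, h5, norm_one]
  exact ((pow_eq_one_iff_of_nonneg (norm_nonneg _) Fintype.card_ne_zero).1 h6).le

end ClassAverage

section InvariantNorm

variable {H : Type} [Group H] [Fintype H] {V : Type} [AddCommGroup V] [Module ℂ V]
  [FiniteDimensional ℂ V]

/-- A finite dimensional representation of a finite group embeds in a Hilbert space with an
invariant norm. -/
lemma exists_invariant_embedding (τ : Representation ℂ H V) :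
    ∃ (d : Type) (_ : Fintype d) (F : V →ₗ[ℂ] EuclideanSpace ℂ d), Function.Injective F ∧
      ∀ h v, ‖F (τ h v)‖ = ‖F v‖ := by
  classical
  let e := (Module.finBasis ℂ V).equivFun
  let F : V →ₗ[ℂ] EuclideanSpace ℂ (H × Fin (Module.finrank ℂ V)) :=
    (WithLp.linearEquiv 2 ℂ (H × Fin (Module.finrank ℂ V) → ℂ)).symm.toLinearMap ∘ₗ
      LinearMap.pi (fun p => LinearMap.proj p.2 ∘ₗ e.toLinearMap ∘ₗ τ p.1)
  have hF : ∀ v p, F v p = e (τ p.1 v) p.2 := fun v p => rfl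
  refine ⟨_, inferInstance, F, ?_, ?_⟩
  · rw [← LinearMap.ker_eq_bot, LinearMap.ker_eq_bot']
    intro v hv
    have : e v = 0 := by
      funext i
      have := hF v (1, i)
      rw [hv] at this
      simpa using this.symm
    simpa using this
  · intro h v
    rw [EuclideanSpace.norm_eq, EuclideanSpace.norm_eq]
    congr 1
    refine Fintype.sum_equiv ((Equiv.mulRight h).prodCongr (Equiv.refl _)) _ _ ?_
    rintro ⟨g, i⟩
    simp only [hF, Equiv.prodCongr_apply, Prod.map, Equiv.coe_mulRight, Equiv.refl_apply, map_mul,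
      Module.End.mul_apply]

end InvariantNorm

section SymmetricGroup

open Equiv

variable {α : Type} [Fintype α] [DecidableEq α] {V : Type} [AddCommGroup V] [Module ℂ V]

/-- The permutations fixing every point outside `B`. -/
def symOn (B : Finset α) : Subgroup (Perm α) where
  carrier := {h | ∀ x, x ∉ B → h x = x}
  one_mem' := fun _ _ => rfl
  mul_mem' := by
    intro a b ha hb x hx
    rw [Perm.mul_apply, hb x hx, ha x hx]
  inv_mem' := by
    intro a ha x hx
    rw [Perm.inv_eq_iff_eq, ha x hx]

lemma mem_symOn {B : Finset α} {h : Perm α} : h ∈ symOn B ↔ ∀ x, x ∉ B → h x = x := Iff.rfl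

instance (B : Finset α) : DecidablePred (· ∈ symOn B) := fun h =>
  inferInstanceAs (Decidable (∀ x, x ∉ B → h x = x))

lemma symOn_mono {B C : Finset α} (h : B ⊆ C) : symOn B ≤ symOn C :=
  fun _ hg x hx => hg x (fun hb => hx (h hb))

lemma apply_mem_of_mem_symOn {B : Finset α} {h : Perm α} (hh : h ∈ symOn B) {x : α} :
    h x ∈ B ↔ x ∈ B := by
  constructor
  · intro hx
    by_contra hxB
    rw [hh x hxB] at hx
    exact hxB hx
  · intro hx
    by_contra hxB
    have := hh _ hxB
    rw [h.injective this] at hxB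
    exact hxB hx

lemma swap_mem_symOn {B : Finset α} {a b : α} (ha : a ∈ B) (hb : b ∈ B) : swap a b ∈ symOn B := by
  intro x hx
  exact swap_apply_of_ne_of_ne (fun h => hx (h ▸ ha)) (fun h => hx (h ▸ hb))

/-- `v` is fixed by all permutations supported in `B`. -/
def IsInvOn (ρ : Representation ℂ (Perm α) V) (B : Finset α) (v : V) : Prop :=
  ∀ h ∈ symOn B, ρ h v = v

/-- Some nonzero vector is fixed by the permutations supported in some set of size `m`. -/
def HasInv (ρ : Representation ℂ (Perm α) V) (m : ℕ) : Prop :=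
  ∃ B : Finset α, B.card = m ∧ ∃ v, v ≠ 0 ∧ IsInvOn ρ B v

/-- Tensoring with the sign character. -/
noncomputable def signTwist (ρ : Representation ℂ (Perm α) V) : Representation ℂ (Perm α) V where
  toFun g := ((Perm.sign g : ℤ) : ℂ) • ρ g
  map_one' := by simp
  map_mul' g h := by
    simp [smul_smul, mul_comm]

lemma signTwist_apply (ρ : Representation ℂ (Perm α) V) (g : Perm α) (v : V) :
    signTwist ρ g v = ((Perm.sign g : ℤ) : ℂ) • ρ g v := rfl

lemma sign_mul_sign_self (g : Perm α) :
    ((Perm.sign g : ℤ) : ℂ) * ((Perm.sign g : ℤ) : ℂ) = 1 := by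
  rcases Int.units_eq_one_or (Perm.sign g) with h | h <;> simp [h]

lemma norm_sign (g : Perm α) : ‖((Perm.sign g : ℤ) : ℂ)‖ = 1 := by
  rcases Int.units_eq_one_or (Perm.sign g) with h | h <;> simp [h]

lemma norm_trace_signTwist (ρ : Representation ℂ (Perm α) V) (g : Perm α) :
    ‖LinearMap.trace ℂ V (signTwist ρ g)‖ = ‖LinearMap.trace ℂ V (ρ g)‖ := by
  have : signTwist ρ g = ((Perm.sign g : ℤ) : ℂ) • ρ g := rfl
  rw [this, map_smul, norm_smul, norm_sign, one_mul]

lemma IsIrr.signTwist {ρ : Representation ℂ (Perm α) V} (h : IsIrr ρ) : IsIrr (signTwist ρ) := by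
  refine ⟨h.1, fun W hW => h.2 W fun g v hv => ?_⟩
  have := W.smul_mem ((Perm.sign g : ℤ) : ℂ) (hW g v hv)
  rwa [signTwist_apply, smul_smul, sign_mul_sign_self, one_smul] at this

lemma IsInvOn.mono {ρ : Representation ℂ (Perm α) V} {B C : Finset α} {v : V}
    (h : IsInvOn ρ C v) (hBC : B ⊆ C) : IsInvOn ρ B v :=
  fun g hg => h g (symOn_mono hBC hg)

lemma HasInv.mono {ρ : Representation ℂ (Perm α) V} {m m' : ℕ} (h : HasInv ρ m) (hm : m' ≤ m) :
    HasInv ρ m' := by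
  obtain ⟨B, hB, v, hv, hinv⟩ := h
  obtain ⟨C, hC, hCm⟩ := Finset.exists_subset_card_eq (hB ▸ hm)
  exact ⟨C, hCm, v, hv, hinv.mono hC⟩

/-- The sum of a vector and its images under the transpositions with a new point is invariant
under the larger symmetric group. -/
lemma IsInvOn.add_swaps {ρ : Representation ℂ (Perm α) V} {B : Finset α} {v : V} (h : IsInvOn ρ B v)
    {a : α} (ha : a ∉ B) : IsInvOn ρ (insert a B) (v + ∑ b ∈ B, ρ (swap a b) v) := by
  have heq : v + ∑ b ∈ B, ρ (swap a b) v = ∑ b ∈ insert a B, ρ (swap a b) v := by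
    rw [Finset.sum_insert ha, swap_self]
    congr 1
    exact (LinearMap.congr_fun (map_one ρ) v).symm
  rw [heq]
  intro g hg
  rw [map_sum]
  have h1 : ∀ b ∈ insert a B, ρ g (ρ (swap a b) v) = ρ (swap a (g b)) v := by
    intro b hb
    have hk : swap a (g b) * g * swap a b ∈ symOn B := by
      intro x hx
      by_cases hxa : x = a
      · subst hxa; simp
      · have hx' : x ∉ insert a B := by simp [hxa, hx]
        have hxb : x ≠ b := fun h => hx' (h ▸ hb)
        rw [Perm.mul_apply, Perm.mul_apply, swap_apply_of_ne_of_ne hxa hxb, hg x hx',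
          swap_apply_of_ne_of_ne hxa]
        intro hxg
        exact hx' (hxg ▸ (apply_mem_of_mem_symOn hg).2 hb)
    have h2 : g * swap a b = swap a (g b) * (swap a (g b) * g * swap a b) := by
      simp [← mul_assoc]
    rw [← Module.End.mul_apply, ← map_mul, h2, map_mul, Module.End.mul_apply, h _ hk]
  rw [Finset.sum_congr rfl h1]
  refine Finset.sum_bij (fun b _ => g b) (fun b hb => (apply_mem_of_mem_symOn hg).2 hb)
    (fun _ _ _ _ h => g.injective h) (fun b hb => ⟨g⁻¹ b, ?_, by simp⟩) (fun _ _ => rfl)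
  exact (apply_mem_of_mem_symOn ((symOn _).inv_mem hg)).2 hb

lemma IsInvOn.relation {ρ : Representation ℂ (Perm α) V} {B : Finset α} {v : V}
    (h : IsInvOn ρ B v) (hmax : ¬ HasInv ρ (B.card + 1)) {a : α} (ha : a ∉ B) :
    v + ∑ b ∈ B, ρ (swap a b) v = 0 := by
  by_contra hne
  exact hmax ⟨insert a B, Finset.card_insert_of_notMem ha, _, hne, h.add_swaps ha⟩

/-- Number of elements of `A` leaving `A` under `g`. -/
def exits (g : Perm α) (A : Finset α) : ℕ := (A.filter fun x => g x ∉ A).card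

/-- The symmetrization operator over permutations supported in `B`. -/
noncomputable def symSum (ρ : Representation ℂ (Perm α) V) (B : Finset α) : Module.End ℂ V :=
  ∑ h ∈ Finset.univ.filter (· ∈ symOn B), ρ h

/-- The order of the group of permutations supported in `B`. -/
def symCard (B : Finset α) : ℕ := (Finset.univ.filter (· ∈ symOn B)).card

lemma symCard_pos (B : Finset α) : 0 < symCard B :=
  Finset.card_pos.2 ⟨1, by simp [one_mem]⟩

lemma symSum_apply (ρ : Representation ℂ (Perm α) V) (B : Finset α) (v : V) :
    symSum ρ B v = ∑ h ∈ Finset.univ.filter (· ∈ symOn B), ρ h v := by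
  simp [symSum, LinearMap.sum_apply]

lemma symSum_rep (ρ : Representation ℂ (Perm α) V) {B : Finset α} {k : Perm α} (hk : k ∈ symOn B)
    (v : V) : symSum ρ B (ρ k v) = symSum ρ B v := by
  rw [symSum_apply, symSum_apply]
  refine Finset.sum_bij (fun h _ => h * k) ?_ ?_ ?_ ?_
  · intro h hh
    simp only [Finset.mem_filter, Finset.mem_univ, true_and] at hh ⊢
    exact mul_mem hh hk
  · intro _ _ _ _ h; exact mul_right_cancel h
  · intro h hh
    simp only [Finset.mem_filter, Finset.mem_univ, true_and] at hh
    exact ⟨h * k⁻¹, by simpa using mul_mem hh (inv_mem hk), by simp⟩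
  · intro h hh
    rw [map_mul, Module.End.mul_apply]

lemma IsInvOn.symSum_eq {ρ : Representation ℂ (Perm α) V} {B : Finset α} {v : V}
    (h : IsInvOn ρ B v) : symSum ρ B v = (symCard B : ℂ) • v := by
  rw [symSum_apply, Finset.sum_congr rfl (g := fun _ => v)]
  · rw [Finset.sum_const, symCard, Nat.cast_smul_eq_nsmul]
  · intro g hg
    exact h g (Finset.mem_filter.1 hg).2

lemma card_stay_add_exits_compl (g : Perm α) (B : Finset α) :
    (B.filter fun b => g b ∈ B).card + exits g Bᶜ = B.card := by
  have h1 : (Finset.univ.filter fun x => g x ∈ B).card = B.card := by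
    rw [← Finset.card_map g.toEmbedding]
    congr 1
    ext x
    simp only [Finset.mem_map, Finset.mem_filter, Finset.mem_univ, true_and]
    constructor
    · rintro ⟨y, hy, rfl⟩; exact hy
    · intro hx; exact ⟨g⁻¹ x, by simpa using hx, by simp⟩
  rw [← h1, exits, ← Finset.card_union_of_disjoint]
  · congr 1
    ext x
    simp only [Finset.mem_union, Finset.mem_filter, Finset.mem_compl, Finset.mem_univ, true_and,
      not_not]
    tauto
  · rw [Finset.disjoint_left]
    intro x hx hx'
    simp only [Finset.mem_filter, Finset.mem_compl] at hx hx'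
    exact hx'.1 hx.1

lemma exits_mul_swap {g : Perm α} {B : Finset α} {a b : α} (ha : a ∉ B) (hga : g a ∈ B)
    (hb : b ∈ B) (hgb : g b ∉ B) : exits (g * swap a b) Bᶜ + 1 = exits g Bᶜ := by
  have : (Bᶜ.filter fun x => g x ∉ Bᶜ) =
      insert a (Bᶜ.filter fun x => (g * swap a b) x ∉ Bᶜ) := by
    ext x
    simp only [Finset.mem_insert, Finset.mem_filter, Finset.mem_compl, Perm.mul_apply, not_not]
    by_cases hxa : x = a
    · subst hxa; simp [ha, hga]
    · by_cases hxB : x ∈ B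
      · simp [hxa, hxB]
      · have hxb : x ≠ b := fun h => hxB (h ▸ hb)
        simp [hxa, swap_apply_of_ne_of_ne hxa hxb]
  rw [exits, exits, this, Finset.card_insert_of_notMem]
  simp [hgb]

/-- The straightening identity for `symSum`. -/
lemma symSum_straighten {ρ : Representation ℂ (Perm α) V} {B : Finset α} {v : V}
    (hrel : ∀ a, a ∉ B → v + ∑ b ∈ B, ρ (swap a b) v = 0) (g : Perm α) {a : α}
    (ha : a ∉ B) (hga : g a ∈ B) :
    ((B.filter fun b => g b ∈ B).card + 1 : ℂ) • symSum ρ B (ρ g v) =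
      - ∑ b ∈ B.filter (fun b => g b ∉ B), symSum ρ B (ρ (g * swap a b) v) := by
  have h1 := congrArg (fun w => symSum ρ B (ρ g w)) (hrel a ha)
  simp only [map_add, map_sum, map_zero] at h1
  simp only [← Module.End.mul_apply (ρ g), ← map_mul] at h1
  rw [← Finset.sum_filter_add_sum_filter_not B (fun b => g b ∈ B)] at h1
  have h2 : ∀ b ∈ B.filter (fun b => g b ∈ B),
      symSum ρ B (ρ (g * swap a b) v) = symSum ρ B (ρ g v) := by
    intro b hb
    rw [Finset.mem_filter] at hb
    rw [Equiv.mul_swap_eq_swap_mul, map_mul, Module.End.mul_apply,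
      symSum_rep ρ (swap_mem_symOn hga hb.2)]
  rw [Finset.sum_congr rfl h2, Finset.sum_const, ← Nat.cast_smul_eq_nsmul ℂ] at h1
  rw [add_smul, one_smul, eq_neg_iff_add_eq_zero, ← h1]
  abel

lemma norm_symSum_mul_choose_le {d : Type} [Fintype d] {ρ : Representation ℂ (Perm α) V}
    {F : V →ₗ[ℂ] EuclideanSpace ℂ d} (hF : ∀ g v, ‖F (ρ g v)‖ = ‖F v‖) {B : Finset α} {v : V}
    (hrel : ∀ a, a ∉ B → v + ∑ b ∈ B, ρ (swap a b) v = 0) (j : ℕ) :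
    ∀ g : Perm α, exits g Bᶜ = j →
      ‖F (symSum ρ B (ρ g v))‖ * (B.card.choose j) ≤ symCard B * ‖F v‖ := by
  induction j with
  | zero =>
    intro g _
    rw [symSum_apply, map_sum]
    rw [Nat.choose_zero_right, Nat.cast_one, mul_one]
    refine (norm_sum_le _ (fun h => F (ρ h (ρ g v)))).trans ?_
    simp [hF, symCard]
  | succ j ih =>
    intro g hg
    have hpos : 0 < exits g Bᶜ := by omega
    obtain ⟨a, ha⟩ := Finset.card_pos.1 hpos
    simp only [Finset.mem_filter, Finset.mem_compl, not_not] at ha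
    have hst := symSum_straighten hrel g ha.1 ha.2
    have hcard := card_stay_add_exits_compl g B
    have hcard2 : (B.filter fun b => g b ∉ B).card = j + 1 := by
      have := Finset.card_filter_add_card_filter_not (s := B) (fun b => g b ∈ B)
      omega
    have hterm : ∀ b ∈ B.filter (fun b => g b ∉ B),
        ‖F (symSum ρ B (ρ (g * swap a b) v))‖ * (B.card.choose j) ≤ symCard B * ‖F v‖ := by
      intro b hb
      rw [Finset.mem_filter] at hb
      apply ih
      have := exits_mul_swap ha.1 ha.2 hb.1 hb.2
      omega
    have h1 := congrArg (fun w => ‖F w‖) hst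
    simp only [map_smul, norm_smul, map_neg, norm_neg, map_sum] at h1
    set s := (B.filter fun b => g b ∈ B).card with hs
    have h2 : ‖((s : ℂ) + 1)‖ = (s : ℝ) + 1 := by
      have : ((s : ℂ) + 1) = ((s + 1 : ℕ) : ℂ) := by push_cast; rfl
      rw [this, Complex.norm_natCast]; push_cast; rfl
    rw [h2] at h1
    have h3 : ((s : ℝ) + 1) * ‖F (symSum ρ B (ρ g v))‖ * (B.card.choose j) ≤
        (j + 1) * (symCard B * ‖F v‖) := by
      rw [h1]
      calc _ ≤ (∑ b ∈ B.filter (fun b => g b ∉ B), ‖F (symSum ρ B (ρ (g * swap a b) v))‖) *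
            (B.card.choose j) := by
            gcongr
            exact norm_sum_le _ _
        _ ≤ _ := by
            rw [Finset.sum_mul]
            refine (Finset.sum_le_card_nsmul _ _ _ hterm).trans ?_
            rw [hcard2, nsmul_eq_mul]; push_cast; rfl
    have h4 : (B.card.choose (j + 1) : ℝ) * (j + 1) = B.card.choose j * ((s : ℝ) + 1) := by
      have := Nat.choose_succ_right_eq B.card j
      have h5 : B.card - j = s + 1 := by omega
      rw [h5] at this
      exact_mod_cast this
    have h6 : (0 : ℝ) < j + 1 := by positivity
    refine le_of_mul_le_mul_left ?_ h6
    calc _ = ‖F (symSum ρ B (ρ g v))‖ * ((B.card.choose (j + 1) : ℝ) * (j + 1)) := by ring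
      _ = ((s : ℝ) + 1) * ‖F (symSum ρ B (ρ g v))‖ * (B.card.choose j) := by rw [h4]; ring
      _ ≤ _ := h3

/-- Averages over translates of a set are averages over all sets of the same size. -/
lemma sum_perm_map_eq (A : Finset α) (f : Finset α → ℝ) :
    ((Fintype.card α).choose A.card : ℝ) * ∑ g : Perm α, f (A.map g.toEmbedding) =
      (Fintype.card (Perm α)) * ∑ A' ∈ Finset.powersetCard A.card Finset.univ, f A' := by
  have hmem : ∀ g ∈ (Finset.univ : Finset (Perm α)), A.map g.toEmbedding ∈
      Finset.powersetCard A.card (Finset.univ : Finset α) := by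
    intro g _; simp [Finset.mem_powersetCard]
  have hfib : ∀ A' ∈ Finset.powersetCard A.card (Finset.univ : Finset α),
      (Finset.univ.filter fun g : Perm α => A.map g.toEmbedding = A').card =
      (Finset.univ.filter fun g : Perm α => A.map g.toEmbedding = A).card := by
    intro A' hA'
    obtain ⟨-, hA'⟩ := Finset.mem_powersetCard.1 hA'
    obtain ⟨e, he⟩ : ∃ e : Perm α, A.map e.toEmbedding = A' := by
      let e0 : {x // x ∈ A} ≃ {x // x ∈ A'} := Finset.equivOfCardEq hA'.symm
      refine ⟨e0.extendSubtype, ?_⟩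
      apply Finset.eq_of_subset_of_card_le
      · intro y hy
        obtain ⟨x, hx, rfl⟩ := Finset.mem_map.1 hy
        exact Equiv.extendSubtype_mem e0 x hx
      · simp [hA']
    refine Finset.card_bij (fun g _ => e⁻¹ * g) ?_ ?_ ?_
    · intro g hg
      simp only [Finset.mem_filter, Finset.mem_univ, true_and] at hg ⊢
      have : A.map (e⁻¹ * g).toEmbedding = (A.map g.toEmbedding).map (e⁻¹).toEmbedding := by
        rw [Finset.map_map]; rfl
      rw [this, hg, ← he, Finset.map_map]
      ext x; simp
    · intro _ _ _ _ h; exact mul_left_cancel h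
    · intro g hg
      simp only [Finset.mem_filter, Finset.mem_univ, true_and] at hg
      refine ⟨e * g, ?_, by simp⟩
      simp only [Finset.mem_filter, Finset.mem_univ, true_and]
      have : A.map (e * g).toEmbedding = (A.map g.toEmbedding).map e.toEmbedding := by
        rw [Finset.map_map]; rfl
      rw [this, hg, he]
  set c := (Finset.univ.filter fun g : Perm α => A.map g.toEmbedding = A).card with hc
  have h1 : ∀ f : Finset α → ℝ, ∑ g : Perm α, f (A.map g.toEmbedding) =
      c * ∑ A' ∈ Finset.powersetCard A.card Finset.univ, f A' := by
    intro f
    rw [← Finset.sum_fiberwise_of_maps_to hmem, Finset.mul_sum]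
    refine Finset.sum_congr rfl fun A' hA' => ?_
    rw [Finset.sum_congr rfl (g := fun _ => f A'), Finset.sum_const, hfib A' hA', nsmul_eq_mul]
    intro g hg
    rw [(Finset.mem_filter.1 hg).2]
  have h2 := h1 (fun _ => 1)
  simp only [Finset.sum_const, Finset.card_univ, Finset.card_powersetCard, nsmul_eq_mul,
    mul_one] at h2
  rw [h1, h2]
  ring

lemma exits_conj (g σ : Perm α) (A : Finset α) :
    exits (g * σ * g⁻¹) A = exits σ (A.map (g⁻¹ : Perm α).toEmbedding) := by
  have hmem : ∀ x, x ∈ A.map (g⁻¹ : Perm α).toEmbedding ↔ g x ∈ A := by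
    intro x
    simp only [Finset.mem_map, Equiv.coe_toEmbedding]
    constructor
    · rintro ⟨y, hy, rfl⟩; simpa using hy
    · intro h; exact ⟨g x, h, by simp⟩
  rw [exits, exits]
  refine Finset.card_bij (fun x _ => g⁻¹ x) ?_ ?_ ?_
  · intro x hx
    simp only [Finset.mem_filter, hmem] at hx ⊢
    simpa using hx
  · intro _ _ _ _ h; exact (g⁻¹ : Perm α).injective h
  · intro y hy
    simp only [Finset.mem_filter, hmem] at hy
    refine ⟨g y, ?_, by simp⟩
    rw [Finset.mem_filter]
    simpa using hy

/-- The average over `k`-subsets of reciprocal binomials governing characters. -/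
noncomputable def exitAverage (σ : Perm α) (k : ℕ) : ℝ :=
  (∑ A ∈ Finset.powersetCard k (Finset.univ : Finset α),
    ((Fintype.card α - k).choose (exits σ A) : ℝ)⁻¹) / (Fintype.card α).choose k

lemma IsIrr.norm_trace_le_exitAverage [FiniteDimensional ℂ V] {ρ : Representation ℂ (Perm α) V}
    (hρ : IsIrr ρ) {m : ℕ} (hm : HasInv ρ m) (hmax : ¬ HasInv ρ (m + 1)) (σ : Perm α) :
    ‖LinearMap.trace ℂ V (ρ σ)‖ ≤
      exitAverage σ (Fintype.card α - m) * Module.finrank ℂ V := by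
  obtain ⟨B, rfl, v, hv, hinv⟩ := hm
  obtain ⟨d, _, F, hFi, hF⟩ := exists_invariant_embedding ρ
  obtain ⟨z, hz, htr⟩ := hρ.classAvg_eq σ
  have hrel := fun a (ha : a ∉ B) => hinv.relation hmax ha
  have hFv : 0 < ‖F v‖ := by
    rw [norm_pos_iff]
    intro h
    exact hv (hFi (by rw [h, map_zero]))
  have hS : (0 : ℝ) < symCard B := by exact_mod_cast symCard_pos B
  have hle : B.card ≤ Fintype.card α := Finset.card_le_univ B
  have hN : (0 : ℝ) < Fintype.card (Perm α) := by exact_mod_cast Fintype.card_pos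
  have hbound : ∀ g : Perm α, ‖F (symSum ρ B (ρ (g * σ * g⁻¹) v))‖ ≤
      symCard B * ‖F v‖ * (B.card.choose (exits (g * σ * g⁻¹) Bᶜ) : ℝ)⁻¹ := by
    intro g
    have h1 := norm_symSum_mul_choose_le hF hrel _ (g * σ * g⁻¹) rfl
    have h2 : 0 < B.card.choose (exits (g * σ * g⁻¹) Bᶜ) := by
      apply Nat.choose_pos
      have := card_stay_add_exits_compl (g * σ * g⁻¹) B
      omega
    have h3 : (0 : ℝ) < B.card.choose (exits (g * σ * g⁻¹) Bᶜ) := by exact_mod_cast h2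
    exact (le_mul_inv_iff₀ h3).2 h1
  have hzv : z • v = (Fintype.card (Perm α) : ℂ)⁻¹ • ∑ g, ρ (g * σ * g⁻¹) v := by
    rw [← classAvg_apply, hz]; simp
  have h1 : ‖z‖ * (symCard B * ‖F v‖) ≤ (Fintype.card (Perm α) : ℝ)⁻¹ *
      ∑ g : Perm α, symCard B * ‖F v‖ * (B.card.choose (exits (g * σ * g⁻¹) Bᶜ) : ℝ)⁻¹ := by
    have h2 := congrArg (fun w => ‖F (symSum ρ B w)‖) hzv
    simp only [map_smul, hinv.symSum_eq, norm_smul, Complex.norm_natCast, map_sum, norm_inv] at h2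
    rw [h2]
    gcongr
    refine (norm_sum_le _ _).trans (Finset.sum_le_sum fun g _ => hbound g)
  rw [← Finset.mul_sum] at h1
  have h3 : ‖z‖ ≤ (Fintype.card (Perm α) : ℝ)⁻¹ *
      ∑ g : Perm α, (B.card.choose (exits (g * σ * g⁻¹) Bᶜ) : ℝ)⁻¹ := by
    refine le_of_mul_le_mul_right ?_ (mul_pos hS hFv)
    refine h1.trans (le_of_eq ?_)
    ring
  have h4 : ∑ g : Perm α, (B.card.choose (exits (g * σ * g⁻¹) Bᶜ) : ℝ)⁻¹ =
      ∑ g : Perm α, (B.card.choose (exits σ (Bᶜ.map g.toEmbedding)) : ℝ)⁻¹ := by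
    refine Fintype.sum_equiv (Equiv.inv (Perm α)) _ _ fun g => ?_
    rw [exits_conj]; rfl
  have h5 := sum_perm_map_eq Bᶜ (fun A => (B.card.choose (exits σ A) : ℝ)⁻¹)
  rw [Finset.card_compl] at h5
  have h6 : (0 : ℝ) < (Fintype.card α).choose (Fintype.card α - B.card) := by
    exact_mod_cast Nat.choose_pos (Nat.sub_le _ _)
  rw [htr, norm_mul, Complex.norm_natCast]
  gcongr
  refine h3.trans (le_of_eq ?_)
  rw [h4, exitAverage, Nat.sub_sub_self hle, eq_div_iff h6.ne', inv_mul_eq_div,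
    div_mul_eq_mul_div, div_eq_iff hN.ne', mul_comm, h5, mul_comm]

end SymmetricGroup

section LowLevels

open Equiv

variable {α : Type} [Fintype α] [DecidableEq α] {V : Type} [AddCommGroup V] [Module ℂ V]

lemma scalar_eq_of_symSum {ρ : Representation ℂ (Perm α) V} {B : Finset α} {v : V} (hv : v ≠ 0)
    (hinv : IsInvOn ρ B v) (φ : Perm α → ℂ)
    (hφ : ∀ x, symSum ρ B (ρ x v) = (symCard B : ℂ) • φ x • v) {σ : Perm α} {z : ℂ}
    (hz : classAvg ρ σ = z • (1 : Module.End ℂ V)) :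
    (Fintype.card (Perm α) : ℂ) * z = ∑ g : Perm α, φ (g * σ * g⁻¹) := by
  have hzv : z • v = (Fintype.card (Perm α) : ℂ)⁻¹ • ∑ g, ρ (g * σ * g⁻¹) v := by
    rw [← classAvg_apply, hz]; simp
  have h1 := congrArg (symSum ρ B) hzv
  rw [map_smul, hinv.symSum_eq, map_smul, map_sum] at h1
  simp only [hφ] at h1
  rw [← Finset.smul_sum, ← Finset.sum_smul, smul_smul, smul_smul, smul_smul] at h1
  have h2 := smul_left_injective ℂ hv h1
  have hS : (symCard B : ℂ) ≠ 0 := by exact_mod_cast (symCard_pos B).ne'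
  have hN : (Fintype.card (Perm α) : ℂ) ≠ 0 := card_ne_zero_complex
  field_simp at h2
  linear_combination h2

lemma card_mul_sum_perm_apply (ψ : α → ℂ) (a : α) :
    (Fintype.card α : ℂ) * ∑ g : Perm α, ψ (g⁻¹ a) =
      Fintype.card (Perm α) * ∑ p, ψ p := by
  have h1 : ∀ p, ∑ g : Perm α, ψ (g⁻¹ p) = ∑ g : Perm α, ψ (g⁻¹ a) := by
    intro p
    refine Fintype.sum_equiv (Equiv.mulLeft (swap a p)) _ _ fun g => ?_
    simp
  have h2 : ∑ p, ∑ g : Perm α, ψ (g⁻¹ p) = Fintype.card (Perm α) * ∑ p, ψ p := by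
    rw [Finset.sum_comm]
    rw [Finset.sum_congr rfl (g := fun _ => ∑ p, ψ p)]
    · simp
    · intro g _
      exact Equiv.sum_comp (g⁻¹ : Perm α) ψ
  rw [← h2, Finset.sum_congr rfl (fun p _ => h1 p)]
  simp

lemma exists_perm_pair {a b p q : α} (hab : a ≠ b) (hpq : p ≠ q) :
    ∃ h : Perm α, h a = p ∧ h b = q := by
  refine ⟨swap (swap a p b) q * swap a p, ?_, ?_⟩
  · rw [Perm.mul_apply, swap_apply_left, swap_apply_of_ne_of_ne _ hpq]
    intro h
    have : swap a p a = swap a p b := by rw [swap_apply_left, ← h]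
    exact hab ((swap a p).injective this)
  · rw [Perm.mul_apply, swap_apply_left]

lemma card_mul_sum_perm_apply_pair (ψ : α → α → ℂ) {a b : α} (hab : a ≠ b) :
    ((Fintype.card α : ℂ) * (Fintype.card α - 1)) * ∑ g : Perm α, ψ (g⁻¹ a) (g⁻¹ b) =
      Fintype.card (Perm α) * ∑ x ∈ (Finset.univ : Finset α).offDiag, ψ x.1 x.2 := by
  have h1 : ∀ x ∈ (Finset.univ : Finset α).offDiag,
      ∑ g : Perm α, ψ (g⁻¹ x.1) (g⁻¹ x.2) = ∑ g : Perm α, ψ (g⁻¹ a) (g⁻¹ b) := by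
    intro x hx
    obtain ⟨h, rfl⟩ : ∃ h : Perm α, x = (h a, h b) := by
      obtain ⟨h, h1, h2⟩ := exists_perm_pair hab (Finset.mem_offDiag.1 hx).2.2
      exact ⟨h, by rw [h1, h2]⟩
    refine Fintype.sum_equiv (Equiv.mulLeft h⁻¹) _ _ fun g => ?_
    simp
  have h2 : ∑ x ∈ (Finset.univ : Finset α).offDiag, ∑ g : Perm α, ψ (g⁻¹ x.1) (g⁻¹ x.2) =
      Fintype.card (Perm α) * ∑ x ∈ (Finset.univ : Finset α).offDiag, ψ x.1 x.2 := by
    rw [Finset.sum_comm]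
    rw [Finset.sum_congr rfl (g := fun _ => ∑ x ∈ (Finset.univ : Finset α).offDiag, ψ x.1 x.2)]
    · simp
    · intro g _
      refine Finset.sum_bij (fun x _ => (g⁻¹ x.1, g⁻¹ x.2)) ?_ ?_ ?_ ?_
      · intro x hx
        simpa using hx
      · intro x _ y _ h
        simpa [Prod.ext_iff] using h
      · intro y hy
        exact ⟨(g y.1, g y.2), by simpa using hy, by simp⟩
      · intro x _; rfl
  rw [← h2, Finset.sum_congr rfl h1, Finset.sum_const, Finset.offDiag_card, nsmul_eq_mul]
  congr 1
  have : Fintype.card α ≤ Fintype.card α * Fintype.card α := Nat.le_mul_self _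
  rw [Finset.card_univ, Nat.cast_sub this]
  push_cast; ring

/-- Characters of the standard representation. -/
lemma IsIrr.trace_of_hasInv_pred [FiniteDimensional ℂ V] {ρ : Representation ℂ (Perm α) V}
    (hρ : IsIrr ρ) (hn : 2 ≤ Fintype.card α) (hm : HasInv ρ (Fintype.card α - 1))
    (hmax : ¬ HasInv ρ (Fintype.card α)) (σ : Perm α) :
    LinearMap.trace ℂ V (ρ σ) = (((Finset.univ.filter fun x => σ x = x).card : ℂ) - 1) /
      ((Fintype.card α : ℂ) - 1) * Module.finrank ℂ V := by
  obtain ⟨B, hB, v, hv, hinv⟩ := hm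
  have hcompl : Bᶜ.card = 1 := by rw [Finset.card_compl]; omega
  obtain ⟨a, ha⟩ := Finset.card_eq_one.1 hcompl
  have hmem : ∀ x, x ∉ B ↔ x = a := by
    intro x
    rw [← Finset.mem_compl, ha, Finset.mem_singleton]
  have hrel := fun a (ha : a ∉ B) => hinv.relation (by
    rwa [hB, Nat.sub_add_cancel (by omega)]) ha
  obtain ⟨z, hz, htr⟩ := hρ.classAvg_eq σ
  have hm0 : ((Fintype.card α : ℂ) - 1) ≠ 0 := by
    rw [sub_ne_zero]
    exact_mod_cast (by omega : Fintype.card α ≠ 1)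
  have hn0 : (Fintype.card α : ℂ) ≠ 0 := by
    exact_mod_cast (by omega : Fintype.card α ≠ 0)
  set c : ℂ := -((Fintype.card α : ℂ) - 1)⁻¹ with hc
  have hφ : ∀ x : Perm α, symSum ρ B (ρ x v) =
      (symCard B : ℂ) • (if x a = a then (1 : ℂ) else c) • v := by
    intro x
    by_cases hx : x a = a
    · have : x ∈ symOn B := by
        intro y hy
        rw [(hmem y).1 hy, hx]
      rw [symSum_rep ρ this, hinv.symSum_eq, if_pos hx, one_smul]
    · have hxa : x a ∈ B := by
        by_contra h
        exact hx ((hmem _).1 h)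
      have hst := symSum_straighten hrel x ((hmem a).2 rfl) hxa
      have hex : exits x Bᶜ = 1 := by
        rw [exits, ha, Finset.filter_singleton, if_pos (by simpa using hx), Finset.card_singleton]
      have hcard := card_stay_add_exits_compl x B
      have h1 : ((B.filter fun b => x b ∈ B).card + 1 : ℂ) = (Fintype.card α : ℂ) - 1 := by
        have : (B.filter fun b => x b ∈ B).card + 1 + 1 = Fintype.card α := by omega
        rw [← this]; push_cast; ring
      have h2 : B.filter (fun b => x b ∉ B) = {x⁻¹ a} := by
        ext b
        simp only [Finset.mem_filter, hmem, Finset.mem_singleton]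
        constructor
        · rintro ⟨-, h⟩; rw [← h]; simp
        · rintro rfl
          refine ⟨?_, by simp⟩
          by_contra h
          rw [hmem] at h
          exact hx (by rw [Perm.inv_eq_iff_eq] at h; exact h.symm)
      rw [h1, h2, Finset.sum_singleton] at hst
      have h3 : x * swap a (x⁻¹ a) ∈ symOn B := by
        intro y hy
        rw [(hmem y).1 hy]; simp
      rw [symSum_rep ρ h3, hinv.symSum_eq] at hst
      rw [if_neg hx, hc, smul_comm, neg_smul, ← smul_neg, ← hst, smul_smul, inv_mul_cancel₀ hm0,
        one_smul]
  have h1 := scalar_eq_of_symSum hv hinv _ hφ hz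
  have h2 : ∀ g : Perm α, ((g * σ * g⁻¹) a = a) = (σ (g⁻¹ a) = g⁻¹ a) := by
    intro g
    rw [Perm.mul_apply, Perm.mul_apply, eq_iff_iff, Perm.eq_inv_iff_eq]
  simp only [h2] at h1
  have h3 := card_mul_sum_perm_apply (fun p => if σ p = p then (1 : ℂ) else c) a
  rw [← h1] at h3
  have h4 : (Fintype.card α : ℂ) * z = ∑ p, if σ p = p then (1 : ℂ) else c := by
    have hN : (Fintype.card (Perm α) : ℂ) ≠ 0 := card_ne_zero_complex
    apply mul_left_cancel₀ hN
    rw [← h3]; ring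
  have h5 : ∀ p, (if σ p = p then (1 : ℂ) else c) = c + (if σ p = p then (1 - c) else 0) := by
    intro p; split_ifs <;> ring
  rw [Finset.sum_congr rfl (fun p _ => h5 p), Finset.sum_add_distrib, ← Finset.sum_filter,
    Finset.sum_const, Finset.sum_const, nsmul_eq_mul, nsmul_eq_mul, Finset.card_univ] at h4
  rw [htr]
  congr 1
  rw [hc] at h4
  rw [eq_div_iff hm0]
  field_simp at h4
  apply mul_left_cancel₀ hn0
  linear_combination h4

/-- Sum over ordered pairs of the values governing the second level. -/
lemma sum_offDiag_pair_values (σ : Perm α) (c0 c1 c2 c3 c4 : ℂ) {n f d : ℂ}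
    (hcn : (Fintype.card α : ℂ) = n)
    (hcf : ((Finset.univ.filter fun x => σ x = x).card : ℂ) = f)
    (hcd : ((Finset.univ.filter fun x => σ x ≠ x ∧ σ (σ x) = x).card : ℂ) = d) :
    ∑ x ∈ (Finset.univ : Finset α).offDiag,
      (c0 + ((if σ x.1 = x.1 then 1 else 0) + (if σ x.2 = x.2 then 1 else 0)) * c1 +
        ((if σ x.1 = x.2 then 1 else 0) + (if σ x.2 = x.1 then 1 else 0)) * c2 +
        (if σ x.1 = x.1 then 1 else 0) * (if σ x.2 = x.2 then 1 else 0) * c3 +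
        (if σ x.1 = x.2 then 1 else 0) * (if σ x.2 = x.1 then 1 else 0) * c4 : ℂ) =
    n * (n - 1) * c0 + 2 * f * (n - 1) * c1 + 2 * (n - f) * c2 + f * (f - 1) * c3 + d * c4 := by
  have hs : ∀ F : α → α → ℂ, ∑ x ∈ (Finset.univ : Finset α).offDiag, F x.1 x.2 =
      ∑ p, ∑ q, F p q - ∑ p, F p p := by
    intro F
    rw [← Finset.sum_product', ← Finset.diag_union_offDiag,
      Finset.sum_union (Finset.disjoint_diag_offDiag _), Finset.sum_diag]
    ring
  have hf : ∑ p, (if σ p = p then (1 : ℂ) else 0) = f := by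
    rw [← Finset.sum_filter, Finset.sum_const, nsmul_one, hcf]
  have hn : ∑ _p : α, (1 : ℂ) = n := by simp [hcn]
  have e0 : ∑ x ∈ (Finset.univ : Finset α).offDiag, (1 : ℂ) = n * (n - 1) := by
    rw [hs (fun _ _ => 1), hn]
    simp [hcn]; ring
  have e1 : ∑ x ∈ (Finset.univ : Finset α).offDiag, (if σ x.1 = x.1 then (1 : ℂ) else 0) =
      f * (n - 1) := by
    rw [hs (fun p _ => if σ p = p then 1 else 0), hf]
    simp only [Finset.sum_const, nsmul_eq_mul, Finset.card_univ, ← Finset.mul_sum, hf, hcn]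
    ring
  have e1' : ∑ x ∈ (Finset.univ : Finset α).offDiag, (if σ x.2 = x.2 then (1 : ℂ) else 0) =
      f * (n - 1) := by
    rw [hs (fun _ q => if σ q = q then 1 else 0), hf]
    simp only [Finset.sum_const, nsmul_eq_mul, Finset.card_univ, hcn]
    ring
  have e2 : ∑ x ∈ (Finset.univ : Finset α).offDiag, (if σ x.1 = x.2 then (1 : ℂ) else 0) =
      n - f := by
    rw [hs (fun p q => if σ p = q then 1 else 0), hf]
    simp only [Finset.sum_ite_eq, Finset.mem_univ, if_true, hn]
  have e2' : ∑ x ∈ (Finset.univ : Finset α).offDiag, (if σ x.2 = x.1 then (1 : ℂ) else 0) =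
      n - f := by
    rw [hs (fun p q => if σ q = p then 1 else 0), hf, Finset.sum_comm]
    simp only [Finset.sum_ite_eq, Finset.mem_univ, if_true, hn]
  have e3 : ∑ x ∈ (Finset.univ : Finset α).offDiag, ((if σ x.1 = x.1 then (1 : ℂ) else 0) *
      (if σ x.2 = x.2 then (1 : ℂ) else 0)) = f * (f - 1) := by
    rw [hs (fun p q => (if σ p = p then (1 : ℂ) else 0) * (if σ q = q then (1 : ℂ) else 0))]
    simp only [← Finset.mul_sum, hf, ← Finset.sum_mul]
    have : ∀ p, (if σ p = p then (1 : ℂ) else 0) * (if σ p = p then (1 : ℂ) else 0) =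
      if σ p = p then (1 : ℂ) else 0 := by intro p; split_ifs <;> simp
    simp only [this, hf]
    ring
  have e4 : ∑ x ∈ (Finset.univ : Finset α).offDiag, ((if σ x.1 = x.2 then (1 : ℂ) else 0) *
      (if σ x.2 = x.1 then (1 : ℂ) else 0)) = d := by
    rw [hs (fun p q => (if σ p = q then (1 : ℂ) else 0) * (if σ q = p then (1 : ℂ) else 0))]
    simp only [ite_mul, one_mul, zero_mul, Finset.sum_ite_eq, Finset.mem_univ, if_true]
    rw [← Finset.sum_sub_distrib]
    have : d = ∑ p, (if σ p ≠ p ∧ σ (σ p) = p then (1 : ℂ) else 0) := by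
      rw [← Finset.sum_filter, Finset.sum_const, nsmul_one, hcd]
    rw [this]
    refine Finset.sum_congr rfl fun p _ => ?_
    by_cases h : σ p = p
    · simp [h]
    · simp [h]
  simp only [Finset.sum_add_distrib, ← Finset.sum_mul, e1, e1', e2, e2', e3, e4]
  rw [show ∑ x ∈ (Finset.univ : Finset α).offDiag, c0 =
    (∑ x ∈ (Finset.univ : Finset α).offDiag, (1 : ℂ)) * c0 by rw [Finset.sum_mul]; simp, e0]
  ring

section SecondLevel

variable {ρ : Representation ℂ (Perm α) V} {B : Finset α} {v : V} {ε : ℂ}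

lemma symSum_two_of_preserve (hinv : IsInvOn ρ B v) {a b : α} (hab : a ≠ b)
    (hB : ∀ x, x ∉ B ↔ x = a ∨ x = b) (hε : ρ (swap a b) v = ε • v) {x : Perm α}
    (hxa : x a ∉ B) (hxb : x b ∉ B) :
    symSum ρ B (ρ x v) = (symCard B : ℂ) • (if x a = a then (1 : ℂ) else ε) • v := by
  rw [hB] at hxa hxb
  have hne : x a ≠ x b := fun h => hab (x.injective h)
  by_cases h : x a = a
  · have hx : x ∈ symOn B := by
      intro y hy
      rcases (hB y).1 hy with rfl | rfl
      · exact h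
      · rcases hxb with h' | h'
        · exact absurd (h.trans h'.symm) hne
        · exact h'
    rw [symSum_rep ρ hx, hinv.symSum_eq, if_pos h, one_smul]
  · have h2 := hxa.resolve_left h
    have h3 : x b = a := hxb.resolve_right (fun h' => hne (h2.trans h'.symm))
    have hx : x * swap a b ∈ symOn B := by
      intro y hy
      rcases (hB y).1 hy with rfl | rfl
      · simp [h3]
      · simp [h2]
    have h4 : x = (x * swap a b) * swap a b := by simp [mul_assoc]
    rw [h4, map_mul, Module.End.mul_apply, hε, map_smul, map_smul, symSum_rep ρ hx,
      hinv.symSum_eq, ← h4, if_neg h, smul_comm]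

lemma symSum_two_of_exit (hrel : ∀ a, a ∉ B → v + ∑ b ∈ B, ρ (swap a b) v = 0)
    (hinv : IsInvOn ρ B v) {a b : α} (hab : a ≠ b)
    (hB : ∀ x, x ∉ B ↔ x = a ∨ x = b) (hε : ρ (swap a b) v = ε • v) (hm : 1 ≤ B.card)
    {x : Perm α} (hxa : x a ∈ B) (hxb : x b ∉ B) :
    symSum ρ B (ρ x v) = (symCard B : ℂ) •
      (-(if x b = b then (1 : ℂ) else ε) * (B.card : ℂ)⁻¹) • v := by
  have ha : a ∉ B := (hB a).2 (Or.inl rfl)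
  have hb : b ∉ B := (hB b).2 (Or.inr rfl)
  have hst := symSum_straighten hrel x ha hxa
  have hex : exits x Bᶜ = 1 := by
    rw [exits, Finset.card_eq_one]
    refine ⟨a, ?_⟩
    ext y
    simp only [Finset.mem_filter, Finset.mem_compl, not_not, Finset.mem_singleton]
    constructor
    · rintro ⟨h1, h2⟩
      rcases (hB y).1 h1 with rfl | rfl
      · rfl
      · exact absurd h2 hxb
    · rintro rfl; exact ⟨ha, hxa⟩
  have hcard := card_stay_add_exits_compl x B
  have h1 : ((B.filter fun b => x b ∈ B).card + 1 : ℂ) = (B.card : ℂ) := by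
    rw [← hcard, hex]; push_cast; ring
  obtain ⟨y, hy⟩ : ∃ y, B.filter (fun b => x b ∉ B) = {y} := by
    rw [← Finset.card_eq_one]
    have := Finset.card_filter_add_card_filter_not (s := B) (fun b => x b ∈ B)
    omega
  have hyB : y ∈ B ∧ x y ∉ B := by
    have := Finset.mem_singleton_self y
    rw [← hy] at this
    exact Finset.mem_filter.1 this
  have hyb : b ≠ y := fun h => hb (h ▸ hyB.1)
  have hb' : (x * swap a y) b = x b := by
    rw [Perm.mul_apply, swap_apply_of_ne_of_ne hab.symm hyb]
  rw [h1, hy, Finset.sum_singleton,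
    symSum_two_of_preserve (x := x * swap a y) hinv hab hB hε (by simpa using hyB.2)
    (by rwa [hb'])] at hst
  have hiff : (x * swap a y) a = a ↔ x b = b := by
    have hne : x y ≠ x b := fun h => hyb (x.injective h).symm
    rw [Perm.mul_apply, swap_apply_left]
    rcases (hB _).1 hyB.2 with h | h <;> rcases (hB _).1 hxb with h' | h'
    · exact absurd (h.trans h'.symm) hne
    · simp [h, h']
    · simp only [h, h', hab, hab.symm]
    · exact absurd (h.trans h'.symm) hne
  simp only [hiff] at hst
  have hm0 : (B.card : ℂ) ≠ 0 := by exact_mod_cast (by omega : B.card ≠ 0)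
  have h5 : symSum ρ B (ρ x v) = (B.card : ℂ)⁻¹ • ((B.card : ℂ) • symSum ρ B (ρ x v)) := by
    rw [smul_smul, inv_mul_cancel₀ hm0, one_smul]
  rw [h5, hst, ← smul_neg, ← neg_smul, smul_comm, smul_smul, smul_smul, smul_smul]
  congr 1
  ring

lemma symSum_two_of_exits (hrel : ∀ a, a ∉ B → v + ∑ b ∈ B, ρ (swap a b) v = 0)
    (hinv : IsInvOn ρ B v) {a b : α} (hab : a ≠ b)
    (hB : ∀ x, x ∉ B ↔ x = a ∨ x = b) (hε : ρ (swap a b) v = ε • v) (hm : 2 ≤ B.card)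
    {x : Perm α} (hxa : x a ∈ B) (hxb : x b ∈ B) :
    symSum ρ B (ρ x v) = (symCard B : ℂ) •
      ((1 + ε) * ((B.card : ℂ) * (B.card - 1))⁻¹) • v := by
  have ha : a ∉ B := (hB a).2 (Or.inl rfl)
  have hb : b ∉ B := (hB b).2 (Or.inr rfl)
  have hst := symSum_straighten hrel x ha hxa
  have hin : ∀ y, x y ∉ B → y ∈ B := by
    intro y hy
    by_contra h
    rcases (hB y).1 h with rfl | rfl
    · exact hy hxa
    · exact hy hxb
  have hfil : B.filter (fun b => x b ∉ B) = {x⁻¹ a, x⁻¹ b} := by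
    ext y
    simp only [Finset.mem_filter, Finset.mem_insert, Finset.mem_singleton, hB,
      Perm.eq_inv_iff_eq]
    exact ⟨fun h => h.2, fun h => ⟨hin y ((hB _).2 h), h⟩⟩
  have hne : x⁻¹ a ≠ x⁻¹ b := fun h => hab ((x⁻¹ : Perm α).injective h)
  have hcard2 : (B.filter fun b => x b ∈ B).card + 2 = B.card := by
    have := Finset.card_filter_add_card_filter_not (s := B) (fun b => x b ∈ B)
    rw [hfil, Finset.card_pair hne] at this
    exact this
  have h1 : ((B.filter fun b => x b ∈ B).card + 1 : ℂ) = (B.card : ℂ) - 1 := by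
    rw [← hcard2]; push_cast; ring
  have hBa : x⁻¹ a ∈ B := hin _ (by simpa using ha)
  have hBb : x⁻¹ b ∈ B := hin _ (by simpa using hb)
  have e1 : (x * swap a (x⁻¹ a)) b = x b := by
    rw [Perm.mul_apply, swap_apply_of_ne_of_ne hab.symm (fun h => hb (h ▸ hBa))]
  have e2 : (x * swap a (x⁻¹ b)) b = x b := by
    rw [Perm.mul_apply, swap_apply_of_ne_of_ne hab.symm (fun h => hb (h ▸ hBb))]
  have hB' : ∀ x, x ∉ B ↔ x = b ∨ x = a := fun x => by rw [hB, or_comm]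
  have hε' : ρ (swap b a) v = ε • v := by rw [swap_comm, hε]
  rw [h1, hfil, Finset.sum_pair hne,
    symSum_two_of_exit (x := x * swap a (x⁻¹ a)) hrel hinv hab.symm hB' hε' (by omega)
      (by rwa [e1]) (by simpa using ha),
    symSum_two_of_exit (x := x * swap a (x⁻¹ b)) hrel hinv hab.symm hB' hε' (by omega)
      (by rwa [e2]) (by simpa using hb)]
    at hst
  have e3 : (x * swap a (x⁻¹ a)) a = a := by simp
  have e4 : (x * swap a (x⁻¹ b)) a = b := by simp
  rw [e3, e4, if_pos rfl, if_neg hab.symm] at hst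
  have hm0 : (B.card : ℂ) ≠ 0 := by exact_mod_cast (by omega : B.card ≠ 0)
  have hm1 : (B.card : ℂ) - 1 ≠ 0 := by
    rw [sub_ne_zero]; exact_mod_cast (by omega : B.card ≠ 1)
  have h5 : symSum ρ B (ρ x v) =
      ((B.card : ℂ) - 1)⁻¹ • (((B.card : ℂ) - 1) • symSum ρ B (ρ x v)) := by
    rw [smul_smul, inv_mul_cancel₀ hm1, one_smul]
  rw [h5, hst, ← smul_add, ← add_smul, ← smul_neg, ← neg_smul, smul_comm, smul_smul (_)⁻¹]
  congr 2
  field_simp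
  ring

end SecondLevel

lemma IsIrr.norm_trace_of_hasInv_sub_two [FiniteDimensional ℂ V]
    {ρ : Representation ℂ (Perm α) V}
    (hρ : IsIrr ρ) (hn : 6 ≤ Fintype.card α) (hm : HasInv ρ (Fintype.card α - 2))
    (hmax : ¬ HasInv ρ (Fintype.card α - 1)) (σ : Perm α)
    (hf : (Finset.univ.filter fun x => σ x = x).card = 2) :
    ‖LinearMap.trace ℂ V (ρ σ)‖ ≤ 1 / ((Fintype.card α : ℝ) - 1) * Module.finrank ℂ V := by
  obtain ⟨B, hBc, v₀, hv₀, hinv₀⟩ := hm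
  have hcompl : Bᶜ.card = 2 := by rw [Finset.card_compl]; omega
  obtain ⟨a, b, hab, hABc⟩ := Finset.card_eq_two.1 hcompl
  have hB : ∀ x, x ∉ B ↔ x = a ∨ x = b := by
    intro x
    rw [← Finset.mem_compl, hABc, Finset.mem_insert, Finset.mem_singleton]
  have hcomm : ∀ h ∈ symOn B, h * swap a b = swap a b * h := by
    intro h hh
    rw [Equiv.mul_swap_eq_swap_mul, hh a ((hB a).2 (Or.inl rfl)), hh b ((hB b).2 (Or.inr rfl))]
  obtain ⟨v, ε, hv, hinv, hε, hε1⟩ : ∃ (v : V) (ε : ℝ), v ≠ 0 ∧ IsInvOn ρ B v ∧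
      ρ (swap a b) v = (ε : ℂ) • v ∧ (ε = 1 ∨ ε = -1) := by
    by_cases h : v₀ + ρ (swap a b) v₀ = 0
    · refine ⟨v₀, -1, hv₀, hinv₀, ?_, Or.inr rfl⟩
      rw [add_eq_zero_iff_eq_neg'] at h
      rw [h]; simp
    · refine ⟨_, 1, h, ?_, ?_, Or.inl rfl⟩
      · intro k hk
        rw [map_add, hinv₀ k hk, ← Module.End.mul_apply, ← map_mul, hcomm k hk, map_mul,
          Module.End.mul_apply, hinv₀ k hk]
      · rw [map_add, ← Module.End.mul_apply, ← map_mul, swap_mul_self, map_one]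
        simp [add_comm]
  have hrel := fun a (ha : a ∉ B) => hinv.relation (by
    rwa [hBc, show Fintype.card α - 2 + 1 = Fintype.card α - 1 by omega]) ha
  obtain ⟨z, hz, htr⟩ := hρ.classAvg_eq σ
  set m : ℂ := (B.card : ℂ) with hm
  set κ : ℂ := (1 + ε) * (m * (m - 1))⁻¹ with hκ
  let P : Perm α → α → α → ℂ := fun x p q => κ +
    ((if x p = p then 1 else 0) + (if x q = q then 1 else 0)) * (-m⁻¹ - κ) +
    ((if x p = q then 1 else 0) + (if x q = p then 1 else 0)) * (-ε * m⁻¹ - κ) +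
    (if x p = p then 1 else 0) * (if x q = q then 1 else 0) * (1 + 2 * m⁻¹ + κ) +
    (if x p = q then 1 else 0) * (if x q = p then 1 else 0) * (ε + 2 * ε * m⁻¹ + κ)
  have hφ : ∀ x : Perm α, symSum ρ B (ρ x v) = (symCard B : ℂ) • P x a b • v := by
    intro x
    have hne : x a ≠ x b := fun h => hab (x.injective h)
    by_cases h1 : x a ∈ B <;> by_cases h2 : x b ∈ B
    · rw [symSum_two_of_exits hrel hinv hab hB hε (by omega) h1 h2]
      have n1 : ¬ (x a = a ∨ x a = b) := fun h => (hB (x a)).2 h h1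
      have n2 : ¬ (x b = a ∨ x b = b) := fun h => (hB (x b)).2 h h2
      rw [not_or] at n1 n2
      simp [P, n1, n2, hκ, ← hm]
    · rw [symSum_two_of_exit hrel hinv hab hB hε (by omega) h1 h2]
      have n1 : ¬ (x a = a ∨ x a = b) := fun h => (hB (x a)).2 h h1
      rw [not_or] at n1
      rcases (hB (x b)).1 h2 with h | h
      · simp [P, n1, h, hab, ← hm]
      · simp [P, n1, h, hab.symm, ← hm]
    · have hB' : ∀ x, x ∉ B ↔ x = b ∨ x = a := fun x => by rw [hB, or_comm]
      have hε' : ρ (swap b a) v = (ε : ℂ) • v := by rw [swap_comm, hε]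
      rw [symSum_two_of_exit hrel hinv hab.symm hB' hε' (by omega) h2 h1]
      have n1 : ¬ (x b = a ∨ x b = b) := fun h => (hB (x b)).2 h h2
      rw [not_or] at n1
      rcases (hB (x a)).1 h1 with h | h
      · simp [P, n1, h, hab, ← hm]
      · simp [P, n1, h, hab.symm, ← hm]
    · rw [symSum_two_of_preserve hinv hab hB hε h1 h2]
      rcases (hB (x a)).1 h1 with h | h <;> rcases (hB (x b)).1 h2 with h' | h'
      · exact absurd (h.trans h'.symm) hne
      · simp only [P, h, h', hab, hab.symm, if_true, if_false]
        congr 2; ring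
      · simp only [P, h, h', hab, hab.symm, if_true, if_false]
        congr 2; ring
      · exact absurd (h.trans h'.symm) hne
  have h1 := scalar_eq_of_symSum hv hinv _ hφ hz
  have h2 : ∀ g : Perm α, P (g * σ * g⁻¹) a b = P σ (g⁻¹ a) (g⁻¹ b) := by
    intro g
    have : ∀ y w, ((g * σ * g⁻¹) y = w) = (σ (g⁻¹ y) = g⁻¹ w) := by
      intro y w
      rw [Perm.mul_apply, Perm.mul_apply, eq_iff_iff, Perm.eq_inv_iff_eq]
    simp only [P, this]
  simp only [h2] at h1
  have h3 := card_mul_sum_perm_apply_pair (P σ) hab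
  rw [← h1, sum_offDiag_pair_values σ _ _ _ _ _ rfl rfl rfl, hf] at h3
  set d := (Finset.univ.filter fun x => σ x ≠ x ∧ σ (σ x) = x).card with hd
  have hdle : d + 2 ≤ Fintype.card α := by
    rw [← hf, hd, ← Finset.card_union_of_disjoint]
    · exact Finset.card_le_univ _
    · rw [Finset.disjoint_left]
      intro y hy hy'
      exact (Finset.mem_filter.1 hy).2.1 (Finset.mem_filter.1 hy').2
  obtain ⟨n, hnn⟩ : ∃ n : ℝ, n = ((Fintype.card α : ℕ) : ℝ) := ⟨_, rfl⟩
  rw [← hnn]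
  have hmn : m = ((n - 2 : ℝ) : ℂ) := by
    rw [hm, hBc, Nat.cast_sub (by omega)]; simp [hnn]
  have hn6 : (6 : ℝ) ≤ n := by rw [hnn]; exact_mod_cast hn
  have hd0 : (0 : ℝ) ≤ d := Nat.cast_nonneg d
  have hdn : (d : ℝ) ≤ n - 2 := by
    have : ((d + 2 : ℕ) : ℝ) ≤ n := by rw [hnn]; exact_mod_cast hdle
    push_cast at this; linarith
  have hN : (Fintype.card (Perm α) : ℂ) ≠ 0 := card_ne_zero_complex
  have hncast : (Fintype.card α : ℂ) = ((n : ℝ) : ℂ) := by simp [hnn]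
  set k : ℝ := (1 + ε) * ((n - 2) * (n - 2 - 1))⁻¹ with hk
  set t : ℝ := n * (n - 1) * k + 2 * 2 * (n - 1) * (-(n - 2)⁻¹ - k) +
    2 * (n - 2) * (-ε * (n - 2)⁻¹ - k) + 2 * (2 - 1) * (1 + 2 * (n - 2)⁻¹ + k) +
    d * (ε + 2 * ε * (n - 2)⁻¹ + k) with ht
  have h4 : ((n * (n - 1) : ℝ) : ℂ) * z = (t : ℂ) := by
    apply mul_left_cancel₀ hN
    rw [hncast] at h3
    have : ((n * (n - 1) : ℝ) : ℂ) = (n : ℂ) * ((n : ℂ) - 1) := by push_cast; rfl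
    rw [this, mul_left_comm, h3]
    congr 1
    rw [ht, hκ, hmn, hk]
    push_cast
    ring
  have htn : |t| ≤ n := by
    have p2 : n - 2 ≠ 0 := by linarith
    have p3 : n - 2 - 1 ≠ 0 := by linarith
    rw [abs_le]
    rcases hε1 with rfl | rfl
    · have : t = -4 + 2 * (n - 5) / (n - 2 - 1) +
          d * (n / (n - 2) + 2 / ((n - 2) * (n - 2 - 1))) := by
        rw [ht, hk]; field_simp; ring
      rw [this]
      have q1 : 0 ≤ 2 * (n - 5) / (n - 2 - 1) := by
        apply div_nonneg <;> linarith
      have q2 : 0 ≤ n / (n - 2) + 2 / ((n - 2) * (n - 2 - 1)) := by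
        have : 0 < n - 2 := by linarith
        have : 0 < n - 2 - 1 := by linarith
        positivity
      have q3 : d * (n / (n - 2) + 2 / ((n - 2) * (n - 2 - 1))) ≤
          (n - 2) * (n / (n - 2) + 2 / ((n - 2) * (n - 2 - 1))) :=
        mul_le_mul_of_nonneg_right hdn q2
      have q4 : -4 + 2 * (n - 5) / (n - 2 - 1) +
          (n - 2) * (n / (n - 2) + 2 / ((n - 2) * (n - 2 - 1))) =
          n - 2 - 2 / (n - 2 - 1) := by
        field_simp; ring
      have q5 : 0 ≤ 2 / (n - 2 - 1) := by
        apply div_nonneg <;> linarith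
      constructor
      · nlinarith [mul_nonneg hd0 q2]
      · linarith
    · have : t = - (d * (n / (n - 2))) := by
        rw [ht, hk]; field_simp; ring
      rw [this]
      have q2 : 0 ≤ n / (n - 2) := by
        apply div_nonneg <;> linarith
      have q3 : d * (n / (n - 2)) ≤ (n - 2) * (n / (n - 2)) := mul_le_mul_of_nonneg_right hdn q2
      have q4 : (n - 2) * (n / (n - 2)) = n := by field_simp
      constructor
      · linarith
      · have := mul_nonneg hd0 q2
        linarith
  have hzle : ‖z‖ ≤ 1 / (n - 1) := by
    have h5 := congrArg norm h4
    rw [norm_mul, Complex.norm_real, Complex.norm_real, Real.norm_eq_abs, Real.norm_eq_abs,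
      abs_of_nonneg (by nlinarith)] at h5
    rw [le_div_iff₀ (by linarith)]
    have : n * (‖z‖ * (n - 1)) ≤ n * 1 := by
      rw [mul_one]
      calc _ = n * (n - 1) * ‖z‖ := by ring
        _ ≤ n := h5 ▸ htn
    exact le_of_mul_le_mul_left this (by linarith)
  rw [htr, norm_mul, Complex.norm_natCast]
  gcongr

end LowLevels

section BinomialBounds

lemma le_choose_of_pos_of_lt : ∀ {m j : ℕ}, 1 ≤ j → j < m → m ≤ m.choose j
  | 0, _, _, h => by omega
  | m + 1, j + 1, _, h => by
    rw [Nat.choose_succ_succ']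
    have h0 : 1 ≤ m.choose j := Nat.choose_pos (by omega)
    rcases Nat.lt_or_ge (j + 1) m with h1 | h1
    · have := le_choose_of_pos_of_lt (m := m) (j := j + 1) (by omega) h1
      omega
    · obtain rfl : j + 1 = m := by omega
      simp

lemma choose_two_le_choose : ∀ {m j : ℕ}, 2 ≤ j → j + 2 ≤ m → m.choose 2 ≤ m.choose j
  | 0, _, _, h => by omega
  | m + 1, j + 1, hj, h => by
    rw [Nat.choose_succ_succ' m j, Nat.choose_succ_succ' m 1, Nat.choose_one_right]
    change m + m.choose 2 ≤ m.choose j + m.choose (j + 1)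
    rcases Nat.lt_or_ge m (j + 3) with h1 | h1
    · obtain rfl : m = j + 2 := by omega
      have e1 : (j + 2).choose j = (j + 2).choose 2 := Nat.choose_symm_add
      have e2 : (j + 2).choose (j + 1) = j + 2 := Nat.choose_succ_self_right _
      omega
    · have h2 : m.choose 2 ≤ m.choose (j + 1) := choose_two_le_choose hj (by omega)
      have h3 : m ≤ m.choose j := le_choose_of_pos_of_lt (by omega) (by omega)
      omega

lemma inv_choose_le {m j : ℕ} (hm : 2 ≤ m) :
    ((m.choose j : ℕ) : ℝ)⁻¹ ≤ (if j = 0 then 1 else 0) + (if j ≤ 1 then (m : ℝ)⁻¹ else 0) +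
      (if m ≤ j + 1 then 1 else 0) + 2 / (m * (m - 1)) := by
  have hm' : (2 : ℝ) ≤ m := by exact_mod_cast hm
  have hq : 0 ≤ 2 / ((m : ℝ) * (m - 1)) := by
    apply div_nonneg (by norm_num)
    apply mul_nonneg <;> linarith
  have hmi : 0 ≤ (m : ℝ)⁻¹ := by positivity
  have hle1 : ((m.choose j : ℕ) : ℝ)⁻¹ ≤ 1 := Nat.cast_inv_le_one _
  by_cases h1 : m ≤ j + 1
  · rw [if_pos h1]
    have : 0 ≤ (if j = 0 then (1 : ℝ) else 0) := by positivity
    have : 0 ≤ (if j ≤ 1 then (m : ℝ)⁻¹ else 0) := by positivity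
    linarith
  rw [if_neg h1]
  by_cases h0 : j = 0
  · subst h0; simp; linarith
  by_cases h2 : j ≤ 1
  · obtain rfl : j = 1 := by omega
    simp; exact hq
  rw [if_neg h0, if_neg h2]
  have h3 : m.choose 2 ≤ m.choose j := choose_two_le_choose (by omega) (by omega)
  have h4 : ((m.choose 2 : ℕ) : ℝ) = m * (m - 1) / 2 := Nat.cast_choose_two ℝ m
  have h5 : (0 : ℝ) < m * (m - 1) / 2 := by
    have : (0 : ℝ) < m - 1 := by linarith
    positivity
  calc ((m.choose j : ℕ) : ℝ)⁻¹ ≤ ((m.choose 2 : ℕ) : ℝ)⁻¹ := by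
        apply inv_anti₀
        · rw [h4]; exact h5
        · exact_mod_cast h3
    _ = 0 + 0 + 0 + 2 / (m * (m - 1)) := by rw [h4, inv_div]; ring

/-- The largest term of a binomial expansion. -/
lemma add_pow_le_mul_choose {k m : ℕ} :
    (k + m) ^ (k + m) ≤ (k + m + 1) * ((k + m).choose k * (k ^ k * m ^ m)) := by
  set t : ℕ → ℕ := fun j => (k + m).choose j * (k ^ j * m ^ (k + m - j)) with ht
  have hstep : ∀ j, j < k + m → t (j + 1) * ((j + 1) * m) = t j * ((k + m - j) * k) := by
    intro j hj
    have h1 := Nat.choose_succ_right_eq (k + m) j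
    have h2 : m ^ (k + m - j) = m ^ (k + m - (j + 1)) * m := by
      rw [← pow_succ]; congr 1; omega
    simp only [ht, h2, pow_succ]
    calc _ = ((k + m).choose (j + 1) * (j + 1)) * (k ^ j * k * (m ^ (k + m - (j + 1)) * m)) := by
          ring
      _ = _ := by rw [h1]; ring
  have htk : t k = (k + m).choose k * (k ^ k * m ^ m) := by simp [ht]
  have hup : ∀ j, k + j ≤ k + m → t (k + j) ≤ t k := by
    intro j
    induction j with
    | zero => intro _; rfl
    | succ j ih =>
      intro hj
      refine le_trans ?_ (ih (by omega))
      have h := hstep (k + j) (by omega)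
      rcases Nat.eq_zero_or_pos m with hm | hm
      · omega
      have h3 : (k + m - (k + j)) * k ≤ (k + j + 1) * m := by
        rw [show k + m - (k + j) = m - j by omega]
        calc (m - j) * k ≤ m * (k + j + 1) := Nat.mul_le_mul (by omega) (by omega)
          _ = _ := by ring
      have h4 : 0 < (k + j + 1) * m := by positivity
      apply Nat.le_of_mul_le_mul_right _ h4
      calc _ = t (k + j) * ((k + m - (k + j)) * k) := h
        _ ≤ _ := Nat.mul_le_mul_left _ h3
  have hdown : ∀ j, j ≤ k → t (k - j) ≤ t k := by
    intro j
    induction j with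
    | zero => intro _; rfl
    | succ j ih =>
      intro hj
      refine le_trans ?_ (ih (by omega))
      have h := hstep (k - (j + 1)) (by omega)
      rw [show k - (j + 1) + 1 = k - j by omega] at h
      have h3 : (k - j) * m ≤ (k + m - (k - (j + 1))) * k := by
        rw [show k + m - (k - (j + 1)) = m + (j + 1) by omega]
        calc (k - j) * m ≤ k * (m + (j + 1)) := Nat.mul_le_mul (by omega) (by omega)
          _ = _ := by ring
      have h4 : 0 < (k + m - (k - (j + 1))) * k := by
        apply Nat.mul_pos <;> omega
      apply Nat.le_of_mul_le_mul_right _ h4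
      rw [← h]
      exact Nat.mul_le_mul_left _ h3
  rw [add_pow, ← htk]
  calc _ ≤ ∑ j ∈ Finset.range (k + m + 1), t k := by
        apply Finset.sum_le_sum
        intro j hj
        rw [Finset.mem_range] at hj
        have : k ^ j * m ^ (k + m - j) * (k + m).choose j = t j := by simp only [ht]; ring
        rw [Nat.cast_id, this]
        rcases Nat.le_total k j with h | h
        · have := hup (j - k) (by omega)
          rwa [show k + (j - k) = j by omega] at this
        · have := hdown (k - j) (by omega)
          rwa [show k - (k - j) = j by omega] at this
    _ = _ := by simp

/-- Sampling without replacement is dominated by independent sampling. -/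
lemma pow_mul_choose_sub_le {n k : ℕ} (hk : k ≤ n) :
    ∀ {t : ℕ}, t ≤ k → n ^ t * (n - t).choose (k - t) ≤ k ^ t * n.choose k
  | 0, _ => by simp
  | t + 1, ht => by
    have ih := pow_mul_choose_sub_le hk (t := t) (by omega)
    have h1 : (n - t) * (n - (t + 1)).choose (k - (t + 1)) = (k - t) * (n - t).choose (k - t) := by
      obtain ⟨a, ha⟩ : ∃ a, n - t = a + 1 := ⟨n - t - 1, by omega⟩
      obtain ⟨b, hb⟩ : ∃ b, k - t = b + 1 := ⟨k - t - 1, by omega⟩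
      rw [show n - (t + 1) = a by omega, show k - (t + 1) = b by omega, ha, hb,
        Nat.add_one_mul_choose_eq]
      ring
    have h2 : n * (k - t) ≤ k * (n - t) := by
      rw [Nat.mul_sub, Nat.mul_sub, mul_comm n k]
      exact Nat.sub_le_sub_left (Nat.mul_le_mul_right t hk) _
    have h3 : n * (n - (t + 1)).choose (k - (t + 1)) ≤ k * (n - t).choose (k - t) := by
      apply Nat.le_of_mul_le_mul_left _ (show 0 < n - t by omega)
      calc (n - t) * (n * (n - (t + 1)).choose (k - (t + 1)))
          = n * ((n - t) * (n - (t + 1)).choose (k - (t + 1))) := by ring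
        _ = n * (k - t) * (n - t).choose (k - t) := by rw [h1]; ring
        _ ≤ k * (n - t) * (n - t).choose (k - t) := Nat.mul_le_mul_right _ h2
        _ = _ := by ring
    calc n ^ (t + 1) * (n - (t + 1)).choose (k - (t + 1))
        = n ^ t * (n * (n - (t + 1)).choose (k - (t + 1))) := by ring
      _ ≤ n ^ t * (k * (n - t).choose (k - t)) := Nat.mul_le_mul_left _ h3
      _ = k * (n ^ t * (n - t).choose (k - t)) := by ring
      _ ≤ k * (k ^ t * n.choose k) := Nat.mul_le_mul_left _ ih
      _ = _ := by ring

end BinomialBounds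

section GeneratingFunctions

open Equiv

variable {α : Type} [Fintype α] [DecidableEq α]

lemma exists_free_set (σ : Perm α) : ∃ T : Finset α, (∀ x ∈ T, σ x ∉ T) ∧
    Fintype.card α ≤ 3 * T.card + (Finset.univ.filter fun x => σ x = x).card := by
  obtain ⟨T, hT, hmax⟩ := Finset.exists_max_image
    (Finset.univ.filter fun T : Finset α => ∀ x ∈ T, σ x ∉ T) Finset.card ⟨∅, by simp⟩
  simp only [Finset.mem_filter, Finset.mem_univ, true_and] at hT hmax
  refine ⟨T, hT, ?_⟩
  have hcov : (Finset.univ : Finset α) ⊆ (T ∪ T.image σ ∪ T.image (σ⁻¹ : Perm α)) ∪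
      (Finset.univ.filter fun x => σ x = x) := by
    intro x _
    by_contra hx
    simp only [Finset.mem_union, Finset.mem_image, Finset.mem_filter, Finset.mem_univ, true_and,
      not_or, not_exists, not_and] at hx
    obtain ⟨⟨⟨h1, h2⟩, h3⟩, h4⟩ := hx
    have := hmax (insert x T) ?_
    · rw [Finset.card_insert_of_notMem h1] at this
      omega
    · intro y hy hy'
      rcases Finset.mem_insert.1 hy with rfl | hy <;> rcases Finset.mem_insert.1 hy' with h | h
      · exact h4 h
      · exact h3 _ h (by simp)
      · exact h2 y hy h
      · exact hT y hy h
  have h1 := Finset.card_le_card hcov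
  have h2 := Finset.card_union_le (T ∪ T.image σ ∪ T.image (σ⁻¹ : Perm α))
    (Finset.univ.filter fun x => σ x = x)
  have h3 := Finset.card_union_le (T ∪ T.image σ) (T.image (σ⁻¹ : Perm α))
  have h4 := Finset.card_union_le T (T.image σ)
  have h5 := Finset.card_image_le (s := T) (f := σ)
  have h6 := Finset.card_image_le (s := T) (f := (σ⁻¹ : Perm α))
  rw [Finset.card_univ] at h1
  omega

lemma sum_pow_card_mul_prod (σ : Perm α) (φ : Bool → Bool → ℝ) (z : ℝ) (T : Finset α) :
    ∀ U : Finset α, (∀ x ∈ T, σ x ∉ T) → T ⊆ U → (∀ x ∈ T, σ x ∈ U) →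
    2 * T.card ≤ U.card ∧
    ∑ A ∈ U.powerset, z ^ A.card * ∏ x ∈ T, φ (decide (x ∈ A)) (decide (σ x ∈ A)) =
      (φ false false + z * φ true false + z * φ false true + z ^ 2 * φ true true) ^ T.card *
        (1 + z) ^ (U.card - 2 * T.card) := by
  induction T using Finset.induction_on with
  | empty =>
    intro U _ _ _
    simpa [add_comm] using Finset.sum_pow_mul_eq_add_pow z 1 U
  | insert x T hx ih =>
    intro U hT hTU hσU
    set U' := (U.erase x).erase (σ x) with hU'
    have hxx : σ x ≠ x := fun h => hT x (Finset.mem_insert_self _ _) (by rw [h]; simp)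
    have hσx : σ x ∉ T := fun h => hT x (by simp) (by simp [h])
    have hx' : ∀ y ∈ T, σ y ≠ x := fun y hy h => hT y (by simp [hy]) (by simp [h])
    have hx'' : ∀ y ∈ T, σ y ≠ σ x := fun y hy h => hx (σ.injective h ▸ hy)
    have hxU : x ∈ U := hTU (by simp)
    have hσxU : σ x ∈ U.erase x := Finset.mem_erase.2 ⟨hxx, hσU x (by simp)⟩
    have h1 : x ∉ insert (σ x) U' := by simp [hU', hxx.symm]
    have h2 : σ x ∉ U' := by simp [hU']
    have hU : U = insert x (insert (σ x) U') := by
      rw [hU', Finset.insert_erase hσxU, Finset.insert_erase hxU]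
    have hxU' : x ∉ U' := fun h => h1 (Finset.mem_insert_of_mem h)
    obtain ⟨hc, hs⟩ := ih U' (fun y hy h => hT y (by simp [hy]) (by simp [h]))
      (fun y hy => Finset.mem_erase.2 ⟨fun h => hσx (h ▸ hy), Finset.mem_erase.2
        ⟨fun h => hx (h ▸ hy), hTU (by simp [hy])⟩⟩)
      (fun y hy => Finset.mem_erase.2 ⟨hx'' y hy, Finset.mem_erase.2
        ⟨hx' y hy, hσU y (by simp [hy])⟩⟩)
    have hcU : U.card = U'.card + 2 := by
      rw [hU, Finset.card_insert_of_notMem h1, Finset.card_insert_of_notMem h2]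
    refine ⟨by rw [Finset.card_insert_of_notMem hx]; omega, ?_⟩
    rw [Finset.card_insert_of_notMem hx, hcU,
      show U'.card + 2 - 2 * (T.card + 1) = U'.card - 2 * T.card by omega, hU,
      Finset.sum_powerset_insert h1, Finset.sum_powerset_insert h2, Finset.sum_powerset_insert h2,
      pow_succ, mul_right_comm, ← hs, Finset.sum_mul, ← Finset.sum_add_distrib,
      ← Finset.sum_add_distrib, ← Finset.sum_add_distrib]
    refine Finset.sum_congr rfl fun A hA => ?_
    have hA' := Finset.mem_powerset.1 hA
    have hxA : x ∉ A := fun h => hxU' (hA' h)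
    have hσA : σ x ∉ A := fun h => h2 (hA' h)
    have hxA' : x ∉ insert (σ x) A := by simp [hxA, hxx.symm]
    have e1 : ∏ y ∈ T, φ (decide (y ∈ insert (σ x) A)) (decide (σ y ∈ insert (σ x) A)) =
        ∏ y ∈ T, φ (decide (y ∈ A)) (decide (σ y ∈ A)) := by
      refine Finset.prod_congr rfl fun y hy => ?_
      have : y ≠ σ x := fun h => hσx (h ▸ hy)
      simp only [Finset.mem_insert, this, hx'' y hy, false_or]
    have e2 : ∀ A : Finset α,
        ∏ y ∈ T, φ (decide (y ∈ insert x A)) (decide (σ y ∈ insert x A)) =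
        ∏ y ∈ T, φ (decide (y ∈ A)) (decide (σ y ∈ A)) := by
      intro A
      refine Finset.prod_congr rfl fun y hy => ?_
      have : y ≠ x := fun h => hx (h ▸ hy)
      simp only [Finset.mem_insert, this, hx' y hy, false_or]
    rw [Finset.prod_insert hx, Finset.prod_insert hx, Finset.prod_insert hx,
      Finset.prod_insert hx, e2, e2, e1, Finset.card_insert_of_notMem hxA',
      Finset.card_insert_of_notMem hxA, Finset.card_insert_of_notMem hσA]
    simp only [hxA, hσA, Finset.mem_insert, hxx, hxx.symm, or_false,
      or_true, decide_true, decide_false]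
    ring

lemma sum_powersetCard_prod_le (σ : Perm α) {φ : Bool → Bool → ℝ} (hφ : ∀ a b, 0 ≤ φ a b)
    {T : Finset α} (hT : ∀ x ∈ T, σ x ∉ T) {k m : ℕ} (hk : 0 < k) (hm : 0 < m)
    (hkm : k + m = Fintype.card α) {q : ℝ}
    (hq : φ false false * m ^ 2 + k * m * φ true false + k * m * φ false true +
      k ^ 2 * φ true true = (k + m) ^ 2 * q) :
    ∑ A ∈ Finset.powersetCard k (Finset.univ : Finset α),
        ∏ x ∈ T, φ (decide (x ∈ A)) (decide (σ x ∈ A)) ≤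
      (k + m + 1) * (k + m).choose k * q ^ T.card := by
  have hk' : (0 : ℝ) < k := by exact_mod_cast hk
  have hm' : (0 : ℝ) < m := by exact_mod_cast hm
  set z : ℝ := k / m with hz
  have hz0 : 0 < z := by positivity
  obtain ⟨hc, hs⟩ := sum_pow_card_mul_prod σ φ z T Finset.univ hT (Finset.subset_univ _)
    (fun _ _ => Finset.mem_univ _)
  have h1 : φ false false + z * φ true false + z * φ false true + z ^ 2 * φ true true =
      (1 + z) ^ 2 * q := by
    rw [hz]; field_simp; linear_combination hq
  rw [h1, mul_pow, ← pow_mul, mul_right_comm, ← pow_add, Nat.add_sub_cancel' hc,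
    Finset.card_univ, ← hkm] at hs
  have hq0 : 0 ≤ q := by
    have h2 : 0 ≤ ((k : ℝ) + m) ^ 2 * q := by
      rw [← hq]
      have := hφ false false; have := hφ true false; have := hφ false true; have := hφ true true
      positivity
    exact nonneg_of_mul_nonneg_right h2 (by positivity)
  have h2 : z ^ k * ∑ A ∈ Finset.powersetCard k (Finset.univ : Finset α),
        ∏ x ∈ T, φ (decide (x ∈ A)) (decide (σ x ∈ A)) ≤ (1 + z) ^ (k + m) * q ^ T.card := by
    rw [← hs, Finset.mul_sum]
    calc _ = ∑ A ∈ Finset.powersetCard k (Finset.univ : Finset α),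
        z ^ A.card * ∏ x ∈ T, φ (decide (x ∈ A)) (decide (σ x ∈ A)) := by
          refine Finset.sum_congr rfl fun A hA => ?_
          rw [(Finset.mem_powersetCard.1 hA).2]
      _ ≤ _ := by
          apply Finset.sum_le_sum_of_subset_of_nonneg
          · intro A hA; simp
          · intro A _ _
            apply mul_nonneg (by positivity)
            exact Finset.prod_nonneg fun x _ => hφ _ _
  have h3 : (1 + z) ^ (k + m) ≤ z ^ k * ((k + m + 1) * (k + m).choose k) := by
    have h4 : ((k : ℝ) + m) ^ (k + m) ≤ (k + m + 1) * ((k + m).choose k * (k ^ k * m ^ m)) := by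
      exact_mod_cast add_pow_le_mul_choose (k := k) (m := m)
    have e1 : (1 + z) = (k + m) / m := by rw [hz]; field_simp; ring
    rw [e1, hz, div_pow, div_pow, div_le_iff₀ (by positivity)]
    calc _ ≤ _ := h4
      _ = _ := by rw [pow_add]; field_simp
  have h5 : 0 < z ^ k := by positivity
  apply le_of_mul_le_mul_left _ h5
  calc _ ≤ _ := h2
    _ ≤ z ^ k * ((k + m + 1) * (k + m).choose k) * q ^ T.card :=
      mul_le_mul_of_nonneg_right h3 (by positivity)
    _ = _ := by ring

end GeneratingFunctions

section ExitAverage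

open Equiv

variable {α : Type} [Fintype α] [DecidableEq α]

lemma half_pow_card_filter_le_prod {T S : Finset α} (P : α → Prop) [DecidablePred P]
    (h : ∀ x ∈ T, P x → x ∈ S) :
    (1 / 2 : ℝ) ^ S.card ≤ ∏ x ∈ T, if P x then (1 / 2 : ℝ) else 1 := by
  rw [Finset.prod_ite, Finset.prod_const, Finset.prod_const_one, mul_one]
  apply pow_le_pow_of_le_one (by norm_num) (by norm_num)
  apply Finset.card_le_card
  intro x hx
  exact h x (Finset.mem_filter.1 hx).1 (Finset.mem_filter.1 hx).2

lemma exitAverage_le_of_free_set (σ : Perm α) {T : Finset α} (hT : ∀ x ∈ T, σ x ∉ T) {k m : ℕ}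
    (hk : 0 < k) (hm : 2 ≤ m) (hkm : k + m = Fintype.card α) :
    exitAverage σ k ≤ 4 * (k + m + 1) * (1 - k * m / (2 * (k + m) ^ 2)) ^ T.card +
      2 * (k + m + 1) * (1 - m ^ 2 / (2 * (k + m) ^ 2)) ^ T.card + 2 / (m * (m - 1)) := by
  have hk' : (0 : ℝ) < k := by exact_mod_cast hk
  have hm' : (2 : ℝ) ≤ m := by exact_mod_cast hm
  have hC : (0 : ℝ) < (k + m).choose k := by exact_mod_cast Nat.choose_pos (by omega)
  rw [exitAverage, ← hkm, div_le_iff₀ hC, Nat.add_sub_cancel_left]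
  have hs1 := sum_powersetCard_prod_le σ
    (φ := fun a b => if a = true ∧ b = false then 1 / 2 else 1)
    (fun a b => by positivity) hT hk (by omega) hkm (q := 1 - k * m / (2 * (k + m) ^ 2))
    (by simp; field_simp; ring)
  have hs2 := sum_powersetCard_prod_le σ
    (φ := fun a b => if a = false ∧ b = false then 1 / 2 else 1)
    (fun a b => by positivity) hT hk (by omega) hkm (q := 1 - m ^ 2 / (2 * (k + m) ^ 2))
    (by simp; field_simp; ring)
  have hpt : ∀ A ∈ Finset.powersetCard k (Finset.univ : Finset α),
      ((m.choose (exits σ A) : ℕ) : ℝ)⁻¹ ≤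
        4 * (∏ x ∈ T, if decide (x ∈ A) = true ∧ decide (σ x ∈ A) = false then (1 / 2 : ℝ) else 1) +
        2 * (∏ x ∈ T,
          if decide (x ∈ A) = false ∧ decide (σ x ∈ A) = false then (1 / 2 : ℝ) else 1) +
        2 / (m * (m - 1)) := by
    intro A hA
    have hAc := (Finset.mem_powersetCard.1 hA).2
    have h1 : (1 / 2 : ℝ) ^ exits σ A ≤
        ∏ x ∈ T, if decide (x ∈ A) = true ∧ decide (σ x ∈ A) = false then (1 / 2 : ℝ) else 1 := by
      apply half_pow_card_filter_le_prod
      intro x _ hx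
      simpa using hx
    have h2 : (1 / 2 : ℝ) ^ (m - exits σ A) ≤
        ∏ x ∈ T, if decide (x ∈ A) = false ∧ decide (σ x ∈ A) = false then (1 / 2 : ℝ) else 1 := by
      have hst := card_stay_add_exits_compl σ Aᶜ
      rw [compl_compl, Finset.card_compl, hAc, ← hkm, Nat.add_sub_cancel_left] at hst
      rw [show m - exits σ A = (Aᶜ.filter fun b => σ b ∈ Aᶜ).card by omega]
      apply half_pow_card_filter_le_prod
      intro x _ hx
      simpa using hx
    have h3 := inv_choose_le (j := exits σ A) hm
    have hmi : (m : ℝ)⁻¹ ≤ 1 / 2 := by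
      rw [one_div]; exact inv_anti₀ (by norm_num) hm'
    have h4 : (if exits σ A = 0 then (1 : ℝ) else 0) +
        (if exits σ A ≤ 1 then (m : ℝ)⁻¹ else 0) ≤ 4 * (1 / 2) ^ exits σ A := by
      rcases Nat.lt_or_ge 1 (exits σ A) with h | h
      · rw [if_neg (by omega), if_neg (by omega), add_zero]; positivity
      · interval_cases exits σ A
        · norm_num; linarith
        · norm_num; linarith
    have h5 : (if m ≤ exits σ A + 1 then (1 : ℝ) else 0) ≤ 2 * (1 / 2) ^ (m - exits σ A) := by
      split_ifs with h
      · have : (1 / 2 : ℝ) ^ 1 ≤ (1 / 2) ^ (m - exits σ A) :=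
          pow_le_pow_of_le_one (by norm_num) (by norm_num) (by omega)
        linarith
      · positivity
    linarith
  refine (Finset.sum_le_sum hpt).trans ?_
  rw [Finset.sum_add_distrib, Finset.sum_add_distrib, ← Finset.mul_sum, ← Finset.mul_sum,
    Finset.sum_const, Finset.card_powersetCard, Finset.card_univ, ← hkm, nsmul_eq_mul]
  linarith

lemma card_filter_subset_le {k : ℕ} (hk : k ≤ Fintype.card α) (h0 : 0 < Fintype.card α)
    (S : Finset α) :
    (((Finset.powersetCard k (Finset.univ : Finset α)).filter (S ⊆ ·)).card : ℝ) ≤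
      ((k : ℝ) / Fintype.card α) ^ S.card * (Fintype.card α).choose k := by
  rcases Nat.lt_or_ge k S.card with h | h
  · rw [Finset.filter_false_of_mem]
    · simp; positivity
    · intro A hA hSA
      have := Finset.card_le_card hSA
      rw [(Finset.mem_powersetCard.1 hA).2] at this
      omega
  have h1 : ((Finset.powersetCard k (Finset.univ : Finset α)).filter (S ⊆ ·)).card ≤
      (Fintype.card α - S.card).choose (k - S.card) := by
    rw [← Finset.card_compl, ← Finset.card_powersetCard]
    refine Finset.card_le_card_of_injOn (fun A => A \ S) ?_ ?_
    · intro A hA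
      obtain ⟨hA, hSA⟩ := Finset.mem_filter.1 hA
      simp only [Finset.mem_coe, Finset.mem_powersetCard]
      refine ⟨fun x hx => by simp [(Finset.mem_sdiff.1 hx).2], ?_⟩
      rw [Finset.card_sdiff_of_subset hSA, (Finset.mem_powersetCard.1 hA).2]
    · intro A hA A' hA' hAA
      have e1 := (Finset.mem_filter.1 hA).2
      have e2 := (Finset.mem_filter.1 hA').2
      rw [← Finset.sdiff_union_of_subset e1, ← Finset.sdiff_union_of_subset e2]
      exact congrArg (· ∪ S) hAA
  have h2 := pow_mul_choose_sub_le hk h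
  have hn : (0 : ℝ) < Fintype.card α := by exact_mod_cast h0
  rw [div_pow, div_mul_eq_mul_div, le_div_iff₀ (by positivity), mul_comm]
  have h3 : Fintype.card α ^ S.card *
      ((Finset.powersetCard k (Finset.univ : Finset α)).filter (S ⊆ ·)).card ≤
      k ^ S.card * (Fintype.card α).choose k := (Nat.mul_le_mul_left _ h1).trans h2
  exact_mod_cast h3

lemma card_filter_exists_subset_le {k : ℕ} (hk : k ≤ Fintype.card α) (h0 : 0 < Fintype.card α)
    (I : Finset (Finset α)) {t : ℕ} (hI : ∀ S ∈ I, S.card = t) {N : ℕ} (hN : I.card ≤ N) :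
    (((Finset.powersetCard k (Finset.univ : Finset α)).filter fun A => ∃ S ∈ I, S ⊆ A).card : ℝ) ≤
      N * ((k : ℝ) / Fintype.card α) ^ t * (Fintype.card α).choose k := by
  have h1 : ((Finset.powersetCard k (Finset.univ : Finset α)).filter fun A => ∃ S ∈ I, S ⊆ A) ⊆
      I.biUnion fun S => (Finset.powersetCard k (Finset.univ : Finset α)).filter (S ⊆ ·) := by
    intro A hA
    obtain ⟨hA, S, hS, hSA⟩ := Finset.mem_filter.1 hA
    exact Finset.mem_biUnion.2 ⟨S, hS, Finset.mem_filter.2 ⟨hA, hSA⟩⟩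
  calc _ ≤ ((∑ S ∈ I,
        ((Finset.powersetCard k (Finset.univ : Finset α)).filter (S ⊆ ·)).card : ℕ) : ℝ) := by
        exact_mod_cast (Finset.card_le_card h1).trans Finset.card_biUnion_le
    _ ≤ ∑ S ∈ I, ((k : ℝ) / Fintype.card α) ^ t * (Fintype.card α).choose k := by
        push_cast
        refine Finset.sum_le_sum fun S hS => ?_
        rw [← hI S hS]
        exact card_filter_subset_le hk h0 S
    _ = I.card * (((k : ℝ) / Fintype.card α) ^ t * (Fintype.card α).choose k) := by
        rw [Finset.sum_const, nsmul_eq_mul]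
    _ ≤ N * (((k : ℝ) / Fintype.card α) ^ t * (Fintype.card α).choose k) := by
        gcongr
    _ = _ := by ring

lemma apply_mem_of_exits_eq_zero {σ : Perm α} {A : Finset α} (h : exits σ A = 0) {x : α}
    (hx : x ∈ A) : σ x ∈ A := by
  by_contra hc
  rw [exits, Finset.card_eq_zero] at h
  exact Finset.notMem_empty x (h ▸ Finset.mem_filter.2 ⟨hx, hc⟩)

lemma card_filter_pair_subset_le (σ : Perm α) {k : ℕ} (hk : k ≤ Fintype.card α)
    (h0 : 0 < Fintype.card α) :
    (((Finset.powersetCard k (Finset.univ : Finset α)).filter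
      fun A => ∃ x ∈ A, σ x ∈ A ∧ σ x ≠ x).card : ℝ) ≤
      Fintype.card α * ((k : ℝ) / Fintype.card α) ^ 2 * (Fintype.card α).choose k := by
  refine le_trans ?_ (card_filter_exists_subset_le hk h0
    ((Finset.univ.image fun x => ({x, σ x} : Finset α)).filter fun S => S.card = 2) (t := 2)
    (fun S hS => (Finset.mem_filter.1 hS).2)
    ((Finset.card_filter_le _ _).trans Finset.card_image_le))
  norm_cast
  refine Finset.card_le_card (Finset.monotone_filter_right _ ?_)
  rintro A - ⟨x, hx, hx1, hx2⟩
  refine ⟨{x, σ x}, Finset.mem_filter.2 ⟨Finset.mem_image.2 ⟨x, Finset.mem_univ _, rfl⟩,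
    Finset.card_pair (Ne.symm hx2)⟩, ?_⟩
  simp [Finset.insert_subset_iff, hx, hx1]

lemma card_filter_exits_eq_zero_le (σ : Perm α)
    (hf : (Finset.univ.filter fun x => σ x = x).card ≤ 2)
    {k : ℕ} (hk : k ≤ Fintype.card α) (hk3 : 3 ≤ k) :
    (((Finset.powersetCard k (Finset.univ : Finset α)).filter fun A => exits σ A = 0).card : ℝ) ≤
      ((Fintype.card α : ℝ) ^ 2 * ((k : ℝ) / Fintype.card α) ^ 4 +
        3 * Fintype.card α * ((k : ℝ) / Fintype.card α) ^ 3) * (Fintype.card α).choose k := by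
  have h0 : 0 < Fintype.card α := by omega
  set Fx := Finset.univ.filter fun x => σ x = x with hFx
  set P := Finset.powersetCard k (Finset.univ : Finset α) with hP
  set I4 := ((Finset.univ ×ˢ Finset.univ).image fun p : α × α =>
    ({p.1, σ p.1, p.2, σ p.2} : Finset α)).filter fun S => S.card = 4 with hI4
  set I3 := (Finset.univ.image fun x => ({x, σ x, σ (σ x)} : Finset α)).filter
    fun S => S.card = 3 with hI3
  set J3 := ((Finset.univ ×ˢ Fx).image fun p : α × α =>
    ({p.1, σ p.1, p.2} : Finset α)).filter fun S => S.card = 3 with hJ3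
  have c4 := card_filter_exists_subset_le hk h0 I4 (t := 4) (N := Fintype.card α ^ 2)
    (fun S hS => (Finset.mem_filter.1 hS).2)
    ((Finset.card_filter_le _ _).trans (Finset.card_image_le.trans (by
      rw [Finset.card_product, Finset.card_univ, sq])))
  have c3 := card_filter_exists_subset_le hk h0 I3 (t := 3) (N := Fintype.card α)
    (fun S hS => (Finset.mem_filter.1 hS).2)
    ((Finset.card_filter_le _ _).trans Finset.card_image_le)
  have d3 := card_filter_exists_subset_le hk h0 J3 (t := 3) (N := Fintype.card α * 2)
    (fun S hS => (Finset.mem_filter.1 hS).2)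
    ((Finset.card_filter_le _ _).trans (Finset.card_image_le.trans (by
      rw [Finset.card_product, Finset.card_univ]; exact Nat.mul_le_mul_left _ hf)))
  have hcov : P.filter (fun A => exits σ A = 0) ⊆ P.filter (fun A => ∃ S ∈ I4, S ⊆ A) ∪
      P.filter (fun A => ∃ S ∈ I3, S ⊆ A) ∪ P.filter (fun A => ∃ S ∈ J3, S ⊆ A) := by
    intro A hA
    obtain ⟨hA, hex⟩ := Finset.mem_filter.1 hA
    have hAc := (Finset.mem_powersetCard.1 hA).2
    have hst : ∀ x ∈ A, σ x ∈ A := fun x hx => apply_mem_of_exits_eq_zero hex hx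
    obtain ⟨a, haA, ha⟩ : ∃ a ∈ A, σ a ≠ a := by
      by_contra! h
      have : A ⊆ Fx := fun x hx => Finset.mem_filter.2 ⟨Finset.mem_univ _, h x hx⟩
      have := Finset.card_le_card this
      omega
    obtain ⟨b, hbA, hb⟩ : ∃ b ∈ A, b ∉ ({a, σ a} : Finset α) := by
      by_contra! h
      have h1 : A ⊆ {a, σ a} := h
      have h2 := Finset.card_le_card h1
      have h3 : ({a, σ a} : Finset α).card ≤ 2 := Finset.card_le_two
      omega
    simp only [Finset.mem_insert, Finset.mem_singleton, not_or] at hb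
    obtain ⟨hba, hbσ⟩ := hb
    have hne : σ b ≠ σ a := fun h => hba (σ.injective h)
    simp only [Finset.mem_union, Finset.mem_filter, hA, true_and]
    by_cases hbb : σ b = b
    · right
      refine ⟨{a, σ a, b}, Finset.mem_filter.2 ⟨Finset.mem_image.2 ⟨(a, b), ?_, rfl⟩, ?_⟩, ?_⟩
      · simp [hFx, hbb]
      · rw [Finset.card_eq_three]
        exact ⟨a, σ a, b, ha.symm, Ne.symm hba, Ne.symm hbσ, rfl⟩
      · simp [Finset.insert_subset_iff, haA, hbA, hst a haA]
    left
    by_cases hbe : σ b = a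
    · right
      refine ⟨{b, σ b, σ (σ b)}, Finset.mem_filter.2 ⟨Finset.mem_image.2 ⟨b, by simp, rfl⟩, ?_⟩, ?_⟩
      · rw [Finset.card_eq_three]
        exact ⟨b, σ b, σ (σ b), Ne.symm hbb, by rw [hbe]; exact hbσ,
          by rw [hbe]; exact ha.symm, rfl⟩
      · simp [Finset.insert_subset_iff, hbA, hst b hbA, hst _ (hst b hbA)]
    · left
      refine ⟨{a, σ a, b, σ b}, Finset.mem_filter.2 ⟨Finset.mem_image.2 ⟨(a, b), by simp, rfl⟩, ?_⟩,
        ?_⟩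
      · rw [Finset.card_insert_of_notMem, Finset.card_insert_of_notMem, Finset.card_pair]
        · exact Ne.symm hbb
        · simp [Ne.symm hbσ, hne.symm]
        · simp [ha.symm, Ne.symm hba, Ne.symm hbe]
      · simp [Finset.insert_subset_iff, haA, hbA, hst b hbA, hst a haA]
  have hcard := (Finset.card_le_card hcov).trans ((Finset.card_union_le _ _).trans
    (Nat.add_le_add_right (Finset.card_union_le _ _) _))
  have hcard' : ((P.filter (fun A => exits σ A = 0)).card : ℝ) ≤
      (P.filter (fun A => ∃ S ∈ I4, S ⊆ A)).card + (P.filter (fun A => ∃ S ∈ I3, S ⊆ A)).card +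
      (P.filter (fun A => ∃ S ∈ J3, S ⊆ A)).card := by exact_mod_cast hcard
  push_cast at c4 d3
  linarith

lemma card_filter_exits_le_one_le (σ : Perm α)
    (hf : (Finset.univ.filter fun x => σ x = x).card ≤ 2)
    {k : ℕ} (hk : k ≤ Fintype.card α) (hk3 : 3 ≤ k) :
    (((Finset.powersetCard k (Finset.univ : Finset α)).filter fun A => exits σ A ≤ 1).card : ℝ) ≤
      ((Fintype.card α + 1) * ((k : ℝ) / Fintype.card α) ^ 2) * (Fintype.card α).choose k := by
  have h0 : 0 < Fintype.card α := by omega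
  set Fx := Finset.univ.filter fun x => σ x = x with hFx
  set P := Finset.powersetCard k (Finset.univ : Finset α) with hP
  have c1 := card_filter_pair_subset_le σ hk h0
  have c2 := card_filter_exists_subset_le hk h0 (Finset.powersetCard 2 Fx) (t := 2) (N := 1)
    (fun S hS => (Finset.mem_powersetCard.1 hS).2) (by
      rw [Finset.card_powersetCard]
      calc Fx.card.choose 2 ≤ Nat.choose 2 2 := Nat.choose_le_choose 2 hf
        _ = 1 := rfl)
  have hcov : P.filter (fun A => exits σ A ≤ 1) ⊆ P.filter (fun A => ∃ x ∈ A, σ x ∈ A ∧ σ x ≠ x) ∪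
      P.filter (fun A => ∃ S ∈ Finset.powersetCard 2 Fx, S ⊆ A) := by
    intro A hA
    obtain ⟨hA, hex⟩ := Finset.mem_filter.1 hA
    have hAc := (Finset.mem_powersetCard.1 hA).2
    simp only [Finset.mem_union, Finset.mem_filter, hA, true_and]
    by_cases h : ∃ x ∈ A, σ x ∈ A ∧ σ x ≠ x
    · exact Or.inl h
    right
    have h1 := Finset.card_filter_add_card_filter_not (s := A) (fun x => σ x ∈ A)
    have h2 : 2 ≤ (A.filter fun x => σ x ∈ A).card := by
      have : (A.filter fun x => ¬ σ x ∈ A).card ≤ 1 := hex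
      omega
    obtain ⟨S, hS, hSc⟩ := Finset.exists_subset_card_eq h2
    refine ⟨S, Finset.mem_powersetCard.2 ⟨?_, hSc⟩, hS.trans (Finset.filter_subset _ _)⟩
    intro x hx
    obtain ⟨hxA, hx1⟩ := Finset.mem_filter.1 (hS hx)
    refine Finset.mem_filter.2 ⟨Finset.mem_univ _, ?_⟩
    by_contra hc
    exact h ⟨x, hxA, hx1, hc⟩
  have hcard := (Finset.card_le_card hcov).trans (Finset.card_union_le _ _)
  have hcard' : ((P.filter (fun A => exits σ A ≤ 1)).card : ℝ) ≤
      (P.filter (fun A => ∃ x ∈ A, σ x ∈ A ∧ σ x ≠ x)).card +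
      (P.filter (fun A => ∃ S ∈ Finset.powersetCard 2 Fx, S ⊆ A)).card := by exact_mod_cast hcard
  push_cast at c2
  linarith

lemma exits_le_card (σ : Perm α) (A : Finset α) : exits σ A ≤ A.card := Finset.card_filter_le _ _

lemma exitAverage_le_of_small (σ : Perm α)
    (hf : (Finset.univ.filter fun x => σ x = x).card ≤ 2) {k m : ℕ}
    (hk3 : 3 ≤ k) (hkm2 : k + 2 ≤ m) (hkm : k + m = Fintype.card α) :
    exitAverage σ k ≤ (k + m : ℝ) ^ 2 * ((k : ℝ) / (k + m)) ^ 4 +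
        3 * (k + m) * ((k : ℝ) / (k + m)) ^ 3 +
        (m : ℝ)⁻¹ * ((k + m + 1) * ((k : ℝ) / (k + m)) ^ 2) + 2 / (m * (m - 1)) := by
  have hC : (0 : ℝ) < (k + m).choose k := by exact_mod_cast Nat.choose_pos (by omega)
  have hcast : (Fintype.card α : ℝ) = k + m := by rw [← hkm]; push_cast; rfl
  have c0 := card_filter_exits_eq_zero_le σ hf (by omega) hk3
  have c1 := card_filter_exits_le_one_le σ hf (by omega) hk3
  rw [hcast, ← hkm] at c0 c1
  rw [exitAverage, ← hkm, div_le_iff₀ hC, Nat.add_sub_cancel_left]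
  set P := Finset.powersetCard k (Finset.univ : Finset α) with hP
  have hmi : (0 : ℝ) ≤ (m : ℝ)⁻¹ := by positivity
  calc _ ≤ ∑ A ∈ P, ((if exits σ A = 0 then (1 : ℝ) else 0) +
        (if exits σ A ≤ 1 then (m : ℝ)⁻¹ else 0) + 2 / (m * (m - 1))) := by
        refine Finset.sum_le_sum fun A hA => ?_
        have h := inv_choose_le (m := m) (j := exits σ A) (by omega)
        have h1 := exits_le_card σ A
        rw [(Finset.mem_powersetCard.1 hA).2] at h1
        rw [if_neg (show ¬ m ≤ exits σ A + 1 by omega)] at h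
        linarith
    _ = (P.filter fun A => exits σ A = 0).card + (P.filter fun A => exits σ A ≤ 1).card *
        (m : ℝ)⁻¹ + (k + m).choose k * (2 / (m * (m - 1))) := by
        rw [Finset.sum_add_distrib, Finset.sum_add_distrib, ← Finset.sum_filter,
          ← Finset.sum_filter, Finset.sum_const, Finset.sum_const, Finset.sum_const, hP,
          Finset.card_powersetCard, Finset.card_univ, ← hkm]
        simp
    _ ≤ _ := by
        have := mul_le_mul_of_nonneg_right c1 hmi
        linarith

lemma exitAverage_le_of_derangement (σ : Perm α) (hσ : ∀ x, σ x ≠ x) {k m : ℕ} (hk : 0 < k)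
    (hkm2 : k + 2 ≤ m) (hkm : k + m = Fintype.card α) :
    exitAverage σ k ≤ (k + m : ℝ) * ((k : ℝ) / (k + m)) ^ 2 + (m : ℝ)⁻¹ := by
  have hC : (0 : ℝ) < (k + m).choose k := by exact_mod_cast Nat.choose_pos (by omega)
  have hcast : (Fintype.card α : ℝ) = k + m := by rw [← hkm]; push_cast; rfl
  have c0 := card_filter_pair_subset_le σ (show k ≤ Fintype.card α by omega) (by omega)
  rw [hcast, ← hkm] at c0
  rw [exitAverage, ← hkm, div_le_iff₀ hC, Nat.add_sub_cancel_left]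
  set P := Finset.powersetCard k (Finset.univ : Finset α) with hP
  have hm0 : (0 : ℝ) < m := by exact_mod_cast (by omega : 0 < m)
  calc _ ≤ ∑ A ∈ P, ((if ∃ x ∈ A, σ x ∈ A ∧ σ x ≠ x then (1 : ℝ) else 0) + (m : ℝ)⁻¹) := by
        refine Finset.sum_le_sum fun A hA => ?_
        have hAc := (Finset.mem_powersetCard.1 hA).2
        have h1 := exits_le_card σ A
        have hmi : (0 : ℝ) ≤ (m : ℝ)⁻¹ := by positivity
        by_cases h0 : exits σ A = 0
        · obtain ⟨x, hx⟩ : A.Nonempty := by rw [← Finset.card_pos]; omega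
          rw [if_pos ⟨x, hx, apply_mem_of_exits_eq_zero h0 hx, hσ x⟩, h0]
          simp
        · have h2 : m ≤ m.choose (exits σ A) := le_choose_of_pos_of_lt (by omega) (by omega)
          have h3 : ((m.choose (exits σ A) : ℕ) : ℝ)⁻¹ ≤ (m : ℝ)⁻¹ :=
            inv_anti₀ hm0 (by exact_mod_cast h2)
          have h4 : 0 ≤ (if ∃ x ∈ A, σ x ∈ A ∧ σ x ≠ x then (1 : ℝ) else 0) := by positivity
          linarith
    _ = (P.filter fun A => ∃ x ∈ A, σ x ∈ A ∧ σ x ≠ x).card + (k + m).choose k * (m : ℝ)⁻¹ := by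
        rw [Finset.sum_add_distrib, ← Finset.sum_filter, Finset.sum_const, Finset.sum_const, hP,
          Finset.card_powersetCard, Finset.card_univ, ← hkm]
        simp
    _ ≤ _ := by linarith

end ExitAverage

section Asymptotics

open Equiv Filter

lemma eventually_pow_mul_exp_le (C : ℝ) (d : ℕ) {c : ℝ} (hc : 0 < c) :
    ∀ᶠ s : ℕ in atTop, C * (s : ℝ) ^ d * Real.exp (-(c * s)) ≤ 1 := by
  have h1 := (Real.tendsto_pow_mul_exp_neg_atTop_nhds_zero d).comp
    ((tendsto_natCast_atTop_atTop (R := ℝ)).const_mul_atTop hc)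
  have h2 := h1.const_mul (C * (c ^ d)⁻¹)
  rw [mul_zero] at h2
  filter_upwards [h2.eventually (gt_mem_nhds (zero_lt_one' ℝ))] with s hs
  refine le_of_eq_of_le ?_ hs.le
  simp only [Function.comp_apply]
  rw [mul_pow]
  field_simp

lemma exitAverage_le_inv_of_le {α : Type} [Fintype α] [DecidableEq α] {s : ℕ} (hs : 100 ≤ s)
    (hn : s ^ 10 ≤ Fintype.card α) (σ : Perm α)
    (hf : (Finset.univ.filter fun x => σ x = x).card ≤ 2) {k m : ℕ}
    (hkm : k + m = Fintype.card α) (hk : 3 ≤ k) (hks : k ≤ s) :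
    exitAverage σ k ≤ ((k : ℝ) + m)⁻¹ := by
  have hs10 : s * s ^ 9 ≤ k + m := by rw [hkm, ← pow_succ']; exact hn
  have hs9 : 100 ≤ s ^ 9 := hs.trans (Nat.le_self_pow (by norm_num) s)
  have h100 : s * 100 ≤ s * s ^ 9 := Nat.mul_le_mul_left s hs9
  refine (exitAverage_le_of_small σ hf hk (by omega) hkm).trans ?_
  have hn' : (s : ℝ) ^ 10 ≤ k + m := by
    have : s ^ 10 ≤ k + m := by rw [hkm]; exact hn
    exact_mod_cast this
  have hsR : (100 : ℝ) ≤ s := by exact_mod_cast hs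
  have hkR : (k : ℝ) ≤ s := by exact_mod_cast hks
  have hk0 : (0 : ℝ) ≤ k := Nat.cast_nonneg k
  obtain ⟨n, hnn⟩ : ∃ n : ℝ, n = k + m := ⟨_, rfl⟩
  have hm : n / 2 ≤ m := by
    have : (k + m) ≤ 2 * m := by omega
    have : (k + m : ℝ) ≤ 2 * m := by exact_mod_cast this
    rw [hnn]; linarith
  rw [← hnn] at hn' ⊢
  have hn0 : (100 : ℝ) ≤ n := by
    have : (100 : ℝ) ≤ s ^ 10 := hsR.trans (le_self_pow₀ (by linarith) (by norm_num))
    linarith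
  have hnpos : 0 < n := by linarith
  have hmpos : (0 : ℝ) < m := by linarith
  have e1 : n ^ 2 * ((k : ℝ) / n) ^ 4 = k ^ 4 / n ^ 2 := by field_simp
  have e2 : 3 * n * ((k : ℝ) / n) ^ 3 = 3 * k ^ 3 / n ^ 2 := by field_simp
  have e3 : (m : ℝ)⁻¹ * ((n + 1) * ((k : ℝ) / n) ^ 2) ≤ 4 * k ^ 2 / n ^ 2 := by
    have : (m : ℝ)⁻¹ * (n + 1) ≤ 4 := by
      rw [inv_mul_le_iff₀ hmpos]; linarith
    calc _ = ((m : ℝ)⁻¹ * (n + 1)) * (k ^ 2 / n ^ 2) := by rw [div_pow]; ring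
      _ ≤ 4 * (k ^ 2 / n ^ 2) := mul_le_mul_of_nonneg_right this (by positivity)
      _ = _ := by ring
  have e4 : 2 / ((m : ℝ) * (m - 1)) ≤ 16 / n ^ 2 := by
    have h1 : n / 2 * (n / 4) ≤ (m : ℝ) * (m - 1) :=
      mul_le_mul hm (by linarith) (by linarith) hmpos.le
    calc 2 / ((m : ℝ) * (m - 1)) ≤ 2 / (n / 2 * (n / 4)) :=
          div_le_div_of_nonneg_left (by norm_num) (by positivity) h1
      _ = _ := by field_simp; norm_num
  have h4 : (k : ℝ) ^ 4 + 3 * k ^ 3 + 4 * k ^ 2 + 16 ≤ n := by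
    have a4 : (k : ℝ) ^ 4 ≤ s ^ 4 := by gcongr
    have a3 : (k : ℝ) ^ 3 ≤ s ^ 4 :=
      (pow_le_pow_left₀ hk0 hkR 3).trans (pow_le_pow_right₀ (by linarith) (by norm_num))
    have a2 : (k : ℝ) ^ 2 ≤ s ^ 4 :=
      (pow_le_pow_left₀ hk0 hkR 2).trans (pow_le_pow_right₀ (by linarith) (by norm_num))
    have a0 : (1 : ℝ) ≤ s ^ 4 := one_le_pow₀ (by linarith)
    have b : (100 : ℝ) * s ^ 4 ≤ s ^ 10 := by
      calc (100 : ℝ) * (s : ℝ) ^ 4 ≤ (s : ℝ) ^ 6 * (s : ℝ) ^ 4 := by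
            gcongr
            exact hsR.trans (le_self_pow₀ (by linarith) (by norm_num))
        _ = (s : ℝ) ^ 10 := by ring
    linarith
  have h5 : ((k : ℝ) ^ 4 + 3 * k ^ 3 + 4 * k ^ 2 + 16) / n ^ 2 ≤ n⁻¹ := by
    rw [div_le_iff₀ (by positivity)]
    calc _ ≤ n := h4
      _ = _ := by field_simp
  rw [e1, e2]
  have h6 : ((k : ℝ) ^ 4 + 3 * k ^ 3 + 4 * k ^ 2 + 16) / n ^ 2 =
    k ^ 4 / n ^ 2 + 3 * k ^ 3 / n ^ 2 + 4 * k ^ 2 / n ^ 2 + 16 / n ^ 2 := by ring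
  linarith

lemma one_sub_pow_le_exp {x c : ℝ} {t : ℕ} (hx : x ≤ 1) (h : c ≤ x * t) :
    (1 - x) ^ t ≤ Real.exp (-c) := by
  calc (1 - x) ^ t ≤ (Real.exp (-x)) ^ t := by
        apply pow_le_pow_left₀ (by linarith)
        linarith [Real.add_one_le_exp (-x)]
    _ = Real.exp (-(x * t)) := by rw [← Real.exp_nat_mul]; ring_nf
    _ ≤ _ := Real.exp_le_exp.2 (by linarith)

lemma exitAverage_le_inv_of_lt {α : Type} [Fintype α] [DecidableEq α] {s : ℕ} (hs : 100 ≤ s)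
    (hexp : 72 * (s : ℝ) ^ 20 * Real.exp (-(1 / 16 * s)) ≤ 1)
    (hn : s ^ 10 ≤ Fintype.card α) (hn2 : Fintype.card α ≤ 2 * s ^ 10) (σ : Perm α)
    (hf : (Finset.univ.filter fun x => σ x = x).card ≤ 2) {k m : ℕ}
    (hkm : k + m = Fintype.card α) (hks : s < k) (hm : s ^ 8 ≤ m) :
    exitAverage σ k ≤ ((k : ℝ) + m)⁻¹ := by
  obtain ⟨T, hT, hTc⟩ := exists_free_set σ
  have hsm : s ≤ m := (Nat.le_self_pow (by norm_num) s).trans hm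
  refine (exitAverage_le_of_free_set σ hT (by omega) (by omega) hkm).trans ?_
  have hn' : (s : ℝ) ^ 10 ≤ k + m := by
    have : s ^ 10 ≤ k + m := by rw [hkm]; exact hn
    exact_mod_cast this
  have hn2' : (k + m : ℝ) ≤ 2 * s ^ 10 := by
    have : k + m ≤ 2 * s ^ 10 := by rw [hkm]; exact hn2
    exact_mod_cast this
  have hsR : (100 : ℝ) ≤ s := by exact_mod_cast hs
  have hkR : (s : ℝ) ≤ k := by exact_mod_cast hks.le
  have hmR : (s : ℝ) ≤ m := by exact_mod_cast hsm
  have hmR8 : (s : ℝ) ^ 8 ≤ m := by exact_mod_cast hm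
  have hTR : (k + m : ℝ) ≤ 3 * T.card + 2 := by
    have : k + m ≤ 3 * T.card + 2 := by omega
    exact_mod_cast this
  obtain ⟨n, hnn⟩ : ∃ n : ℝ, n = k + m := ⟨_, rfl⟩
  rw [← hnn] at hn' hn2' hTR ⊢
  have hn0 : (100 : ℝ) ≤ n := by linarith
  have hnpos : 0 < n := by linarith
  have hs0 : (0 : ℝ) < s := by linarith
  have hT4 : n / 4 ≤ T.card := by linarith
  have p1 : (1 - (k : ℝ) * m / (2 * n ^ 2)) ^ T.card ≤ Real.exp (-(1 / 16 * s)) := by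
    have hkmn : (s : ℝ) * n / 2 ≤ k * m := by
      rw [hnn]
      nlinarith [mul_nonneg (sub_nonneg.2 hkR) (sub_nonneg.2 hmR)]
    apply one_sub_pow_le_exp
    · rw [div_le_one (by positivity), hnn]
      nlinarith [mul_pos (hs0.trans_le hkR) (hs0.trans_le hmR)]
    · calc 1 / 16 * (s : ℝ) = (s * n / 2) / (2 * n ^ 2) * (n / 4) := by field_simp; norm_num
        _ ≤ _ := by gcongr
  have p2 : (1 - (m : ℝ) ^ 2 / (2 * n ^ 2)) ^ T.card ≤ Real.exp (-(1 / 16 * s)) := by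
    apply one_sub_pow_le_exp
    · rw [div_le_one (by positivity), hnn]
      nlinarith [mul_pos (hs0.trans_le hkR) (hs0.trans_le hmR)]
    · calc 1 / 16 * (s : ℝ) ≤ 1 / 16 * s ^ 6 := by
            gcongr
            exact le_self_pow₀ (by linarith) (by norm_num)
        _ = (s ^ 8) ^ 2 / (2 * (2 * s ^ 10)) * (1 / 4) := by field_simp; norm_num
        _ ≤ (m : ℝ) ^ 2 / (2 * n) * (1 / 4) := by gcongr
        _ = (m : ℝ) ^ 2 / (2 * n ^ 2) * (n / 4) := by field_simp
        _ ≤ _ := by gcongr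
  have p3 : 2 / ((m : ℝ) * (m - 1)) ≤ 1 / (4 * s ^ 10) := by
    have h1 : (m : ℝ) / 2 ≤ m - 1 := by linarith
    have h2 : (s : ℝ) ^ 8 * (s ^ 8 / 2) ≤ (m : ℝ) * (m - 1) := by
      apply mul_le_mul hmR8 _ (by positivity) (by linarith)
      linarith
    have h3 : 16 * (s : ℝ) ^ 10 ≤ s ^ 8 * s ^ 8 := by
      calc 16 * (s : ℝ) ^ 10 ≤ s ^ 6 * s ^ 10 := by
            gcongr
            have := le_self_pow₀ (a := (s : ℝ)) (by linarith) (show 6 ≠ 0 by norm_num)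
            linarith
        _ = _ := by ring
    rw [div_le_div_iff₀ (by nlinarith [pow_pos hs0 8]) (by positivity)]
    linarith
  have p4 : 6 * (n + 1) * Real.exp (-(1 / 16 * s)) ≤ 1 / (4 * s ^ 10) := by
    rw [le_div_iff₀ (by positivity)]
    have he := Real.exp_pos (-(1 / 16 * (s : ℝ)))
    calc 6 * (n + 1) * Real.exp (-(1 / 16 * s)) * (4 * s ^ 10)
        ≤ 6 * (3 * s ^ 10) * Real.exp (-(1 / 16 * s)) * (4 * s ^ 10) := by
          gcongr
          have : (1 : ℝ) ≤ s ^ 10 := one_le_pow₀ (by linarith)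
          linarith
      _ = 72 * (s : ℝ) ^ 20 * Real.exp (-(1 / 16 * s)) := by ring
      _ ≤ 1 := hexp
  have p5 : 1 / (2 * (s : ℝ) ^ 10) ≤ n⁻¹ := by
    rw [one_div]
    exact inv_anti₀ hnpos hn2'
  have p6 : 1 / (2 * (s : ℝ) ^ 10) = 1 / (4 * s ^ 10) + 1 / (4 * s ^ 10) := by
    field_simp; norm_num
  have q1 := mul_le_mul_of_nonneg_left p1 (show 0 ≤ 4 * (n + 1) by linarith)
  have q2 := mul_le_mul_of_nonneg_left p2 (show 0 ≤ 2 * (n + 1) by linarith)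
  linarith

lemma exists_exitAverage_le_inv : ∃ s₀ : ℕ, 100 ≤ s₀ ∧ ∀ s, s₀ ≤ s → ∀ (α : Type) [Fintype α]
    [DecidableEq α] (σ : Perm α), s ^ 10 ≤ Fintype.card α → Fintype.card α ≤ 2 * s ^ 10 →
    (Finset.univ.filter fun x => σ x = x).card ≤ 2 → ∀ k m : ℕ, k + m = Fintype.card α → 3 ≤ k →
    s ^ 8 ≤ m → exitAverage σ k ≤ ((k : ℝ) + m)⁻¹ := by
  obtain ⟨s₁, h₁⟩ := eventually_atTop.1
    (eventually_pow_mul_exp_le 72 20 (show (0 : ℝ) < 1 / 16 by norm_num))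
  refine ⟨max 100 s₁, le_max_left _ _, ?_⟩
  intro s hs α _ _ σ hn hn2 hf k m hkm hk hm
  have hs100 : 100 ≤ s := (le_max_left _ _).trans hs
  rcases Nat.lt_or_ge s k with h | h
  · exact exitAverage_le_inv_of_lt hs100 (h₁ s ((le_max_right _ _).trans hs)) hn hn2 σ hf hkm h hm
  · exact exitAverage_le_inv_of_le hs100 hn σ hf hkm hk h

end Asymptotics

lemma trace_eq_conj_of_isometry {E : Type} [NormedAddCommGroup E] [InnerProductSpace ℂ E]
    [FiniteDimensional ℂ E] (U U' : E →ₗ[ℂ] E) (hU : ∀ v, ‖U v‖ = ‖v‖) (hUU : ∀ v, U (U' v) = v) :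
    LinearMap.trace ℂ E U' = starRingEnd ℂ (LinearMap.trace ℂ E U) := by
  let L : E →ₗᵢ[ℂ] E := ⟨U, hU⟩
  have hinner : ∀ v w, inner ℂ (U v) (U w) = inner ℂ v w := L.inner_map_map
  let b := stdOrthonormalBasis ℂ E
  rw [LinearMap.trace_eq_sum_inner _ b, LinearMap.trace_eq_sum_inner _ b, map_sum]
  refine Finset.sum_congr rfl fun i _ => ?_
  rw [inner_conj_symm, ← hinner, hUU]

section Orthogonality

variable {H : Type} [Group H] [Fintype H] {V : Type} [AddCommGroup V] [Module ℂ V]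
  [FiniteDimensional ℂ V]

lemma trace_inv_eq_conj (τ : Representation ℂ H V) (x : H) :
    LinearMap.trace ℂ V (τ x⁻¹) = starRingEnd ℂ (LinearMap.trace ℂ V (τ x)) := by
  classical
  obtain ⟨d, _, F, hF, hnorm⟩ := exists_invariant_embedding τ
  obtain ⟨E, _, _, _, e, he⟩ : ∃ (E : Type) (_ : NormedAddCommGroup E)
      (_ : InnerProductSpace ℂ E) (_ : FiniteDimensional ℂ E) (e : V ≃ₗ[ℂ] E),
      ∀ v, ‖e v‖ = ‖F v‖ :=
    ⟨LinearMap.range F, inferInstance, inferInstance, inferInstance,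
      LinearEquiv.ofInjective F hF, fun v => rfl⟩
  let U : H → Module.End ℂ E := fun h => e.conj (τ h)
  have hU : ∀ h, LinearMap.trace ℂ _ (U h) = LinearMap.trace ℂ V (τ h) := fun h =>
    LinearMap.trace_conj' _ _
  have hUmul : ∀ h k v, U h (U k v) = U (h * k) v := by
    intro h k v
    simp [U, LinearEquiv.conj_apply]
  have hUone : ∀ v, U 1 v = v := by
    intro v
    simp [U, LinearEquiv.conj_apply]
  have hUn : ∀ h v, ‖U h v‖ = ‖v‖ := by
    intro h v
    obtain ⟨w, rfl⟩ := e.surjective v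
    have h1 : U h (e w) = e (τ h w) := by simp [U, LinearEquiv.conj_apply]
    rw [h1, he, he, hnorm]
  rw [← hU, ← hU]
  refine trace_eq_conj_of_isometry (U x) (U x⁻¹) (hUn x) fun v => ?_
  rw [hUmul, mul_inv_cancel, hUone]

lemma IsIrr.isIrreducible {τ : Representation ℂ H V} (hτ : IsIrr τ) : τ.IsIrreducible := by
  have := hτ.1
  have hbot : ∀ W : Subrepresentation τ, W.toSubmodule = ⊥ → W = ⊥ := by
    intro W hW
    apply le_antisymm _ bot_le
    intro v hv
    have : v ∈ W.toSubmodule := hv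
    rw [hW, Submodule.mem_bot] at this
    rw [this]
    exact (⊥ : Subrepresentation τ).toSubmodule.zero_mem
  have htop : ∀ W : Subrepresentation τ, W.toSubmodule = ⊤ → W = ⊤ := by
    intro W hW
    apply le_antisymm le_top
    intro v hv
    change v ∈ W.toSubmodule
    rw [hW]
    trivial
  have hnt : Nontrivial (Subrepresentation τ) := by
    refine ⟨⟨⊥, fun g v hv => by simp_all⟩, ⟨⊤, fun g v hv => trivial⟩, fun h => ?_⟩
    have := congrArg Subrepresentation.toSubmodule h
    exact bot_ne_top this
  refine { eq_bot_or_eq_top := fun W => ?_ }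
  rcases hτ.2 W.toSubmodule fun h v hv => W.apply_mem_toSubmodule h hv with h | h
  · exact Or.inl (hbot W h)
  · exact Or.inr (htop W h)

lemma IsIrr.sum_norm_sq_trace {τ : Representation ℂ H V} (hτ : IsIrr τ) :
    ∑ h, ‖LinearMap.trace ℂ V (τ h)‖ ^ 2 = Fintype.card H := by
  classical
  have := hτ.isIrreducible
  have hcard : (Nat.card H : ℂ) ≠ 0 := by simp
  let : Invertible (Nat.card H : ℂ) := invertibleOfNonzero hcard
  have key := Representation.char_orthonormal τ τ
  rw [if_pos ⟨Representation.Equiv.refl τ⟩] at key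
  have h2 : ∑ g, τ.character g * τ.character g⁻¹
      = ((∑ h, ‖LinearMap.trace ℂ V (τ h)‖ ^ 2 : ℝ) : ℂ) := by
    push_cast
    refine Finset.sum_congr rfl fun g _ => ?_
    have h3 : τ.character g⁻¹ = starRingEnd ℂ (τ.character g) := trace_inv_eq_conj τ g
    rw [h3, Complex.mul_conj, Complex.normSq_eq_norm_sq]
    push_cast
    rfl
  rw [h2, inv_mul_eq_one₀ hcard, Nat.card_eq_fintype_card] at key
  exact_mod_cast key.symm

/-- An irreducible character value is bounded by the order of the centralizer. -/
lemma IsIrr.norm_trace_sq_le {τ : Representation ℂ H V} (hτ : IsIrr τ) (x : H) (c : ℕ)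
    (hc : ∀ y, {h : H | h * x * h⁻¹ = y}.ncard ≤ c) :
    ‖LinearMap.trace ℂ V (τ x)‖ ^ 2 ≤ c := by
  classical
  have hconj : ∀ h, LinearMap.trace ℂ V (τ (h * x * h⁻¹)) = LinearMap.trace ℂ V (τ x) := by
    intro h
    rw [map_mul, LinearMap.trace_mul_comm, ← map_mul]
    simp
  have h1 : (Fintype.card H : ℝ) * ‖LinearMap.trace ℂ V (τ x)‖ ^ 2
      = ∑ h, ‖LinearMap.trace ℂ V (τ (h * x * h⁻¹))‖ ^ 2 := by
    simp only [hconj, Finset.sum_const, Finset.card_univ, nsmul_eq_mul]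
  have h2 : ∑ h, ‖LinearMap.trace ℂ V (τ (h * x * h⁻¹))‖ ^ 2
      = ∑ y, ((Finset.univ.filter fun h => h * x * h⁻¹ = y).card : ℝ) *
        ‖LinearMap.trace ℂ V (τ y)‖ ^ 2 := by
    rw [← Finset.sum_fiberwise_of_maps_to (s := Finset.univ) (t := Finset.univ)
      (g := fun h => h * x * h⁻¹) (fun _ _ => Finset.mem_univ _)]
    refine Finset.sum_congr rfl fun y _ => ?_
    rw [Finset.sum_congr rfl (g := fun _ => ‖LinearMap.trace ℂ V (τ y)‖ ^ 2), Finset.sum_const,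
      nsmul_eq_mul]
    intro h hh
    rw [(Finset.mem_filter.1 hh).2]
  have h3 : ∑ y, ((Finset.univ.filter fun h => h * x * h⁻¹ = y).card : ℝ) *
        ‖LinearMap.trace ℂ V (τ y)‖ ^ 2 ≤ ∑ y, (c : ℝ) * ‖LinearMap.trace ℂ V (τ y)‖ ^ 2 := by
    refine Finset.sum_le_sum fun y _ => mul_le_mul_of_nonneg_right ?_ (by positivity)
    have := hc y
    rw [Set.ncard_eq_toFinset_card'] at this
    simp only [Set.toFinset_ofPred] at this
    exact_mod_cast this
  rw [← Finset.mul_sum, hτ.sum_norm_sq_trace] at h3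
  have hpos : (0 : ℝ) < Fintype.card H := by exact_mod_cast Fintype.card_pos
  rw [← h2, ← h1, mul_comm] at h3
  exact le_of_mul_le_mul_right h3 hpos

end Orthogonality

section Generic

open Equiv

variable {α : Type} [Fintype α] [DecidableEq α] {V : Type} [AddCommGroup V] [Module ℂ V]
  [FiniteDimensional ℂ V]

/-- Neither the representation nor its twist by the sign has a nonzero vector invariant under the
permutations supported in some set of size `m`. -/
def IsGeneric (ρ : Representation ℂ (Perm α) V) (m : ℕ) : Prop :=
  ¬ HasInv ρ m ∧ ¬ HasInv (signTwist ρ) m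

lemma IsGeneric.mono {ρ : Representation ℂ (Perm α) V} {m m' : ℕ} (h : IsGeneric ρ m)
    (hm : m ≤ m') : IsGeneric ρ m' :=
  ⟨fun h' => h.1 (h'.mono hm), fun h' => h.2 (h'.mono hm)⟩

lemma mul_comm_of_disjoint {B C : Finset α} (hBC : Disjoint B C) {g h : Perm α}
    (hg : g ∈ symOn B) (hh : h ∈ symOn C) : g * h = h * g := by
  have : Perm.Disjoint g h := by
    intro x
    by_cases hx : x ∈ B
    · exact Or.inr (hh x (Finset.disjoint_left.1 hBC hx))
    · exact Or.inl (hg x hx)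
  exact this.commute

lemma ofSubtype_mem_symOn (B : Finset α) (f : Perm B) : Perm.ofSubtype f ∈ symOn B :=
  fun _ hx => Perm.ofSubtype_apply_of_not_mem f hx

lemma isInvOn_of_swaps {ρ : Representation ℂ (Perm α) V} {B : Finset α} {v : V}
    (h : ∀ a ∈ B, ∀ b ∈ B, ρ (swap a b) v = v) : IsInvOn ρ B v := by
  have key : ∀ f : Perm B, ρ (Perm.ofSubtype f) v = v := by
    intro f
    induction f using Perm.swap_induction_on with
    | one => simp
    | swap_mul f x y _ ih =>
      rw [map_mul, map_mul, Module.End.mul_apply, ih, Perm.ofSubtype_swap_eq]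
      exact h _ x.2 _ y.2
  intro g hg
  have := key (g.subtypePerm fun x => apply_mem_of_mem_symOn hg)
  rwa [Perm.ofSubtype_subtypePerm] at this
  intro x hx
  by_contra hxB
  exact hx (hg x hxB)

lemma exists_swap_ne {ρ : Representation ℂ (Perm α) V} {B : Finset α}
    (hB : ¬ HasInv ρ B.card) {a b : α} (ha : a ∈ B) (hb : b ∈ B) (hab : a ≠ b)
    {W : Submodule ℂ V} (hW : W ≠ ⊥) (hWs : ∀ h ∈ symOn B, ∀ v ∈ W, ρ h v ∈ W) :
    ∃ v ∈ W, ρ (swap a b) v ≠ v := by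
  by_contra hcon
  push Not at hcon
  obtain ⟨v, hv, hv0⟩ := Submodule.exists_mem_ne_zero_of_ne_bot hW
  refine hB ⟨B, rfl, v, hv0, isInvOn_of_swaps fun p hp q hq => ?_⟩
  by_cases hpq : p = q
  · rw [hpq, swap_self]
    exact LinearMap.congr_fun (map_one ρ) v
  obtain ⟨h, h1, h2⟩ := exists_perm_pair (α := B) (a := ⟨a, ha⟩) (b := ⟨b, hb⟩) (p := ⟨p, hp⟩)
    (q := ⟨q, hq⟩) (fun h => hab (congrArg Subtype.val h)) (fun h => hpq (congrArg Subtype.val h))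
  set k : Perm α := Perm.ofSubtype h
  have hk : k ∈ symOn B := ofSubtype_mem_symOn B h
  have hka : k a = p := by
    rw [Perm.ofSubtype_apply_of_mem h ha, h1]
  have hkb : k b = q := by
    rw [Perm.ofSubtype_apply_of_mem h hb, h2]
  have heq : swap p q = k * swap a b * k⁻¹ := by
    rw [← hka, ← hkb, swap_apply_apply]
  rw [heq, map_mul, map_mul, Module.End.mul_apply, Module.End.mul_apply,
    hcon _ (hWs _ (inv_mem hk) v hv), ← Module.End.mul_apply, ← map_mul, mul_inv_cancel, map_one]
  rfl

lemma IsGeneric.two_pow_le_finrank {ρ : Representation ℂ (Perm α) V} {m : ℕ} (hm : 2 ≤ m)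
    (hg : IsGeneric ρ m) : ∀ (K : ℕ) (D : Finset α) (W : Submodule ℂ V),
    (∀ h ∈ symOn D, ∀ v ∈ W, ρ h v ∈ W) → W ≠ ⊥ → K * m ≤ D.card →
      2 ^ K ≤ Module.finrank ℂ W := by
  intro K
  induction K with
  | zero =>
    intro D W _ hW _
    rw [pow_zero]
    exact Nat.one_le_iff_ne_zero.2 fun h => hW (Submodule.finrank_eq_zero.1 h)
  | succ K ih =>
    intro D W hWs hW hD
    obtain ⟨B, hBD, hBm⟩ := Finset.exists_subset_card_eq (s := D) (n := m) (by nlinarith)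
    obtain ⟨a, ha, b, hb, hab⟩ := Finset.one_lt_card.1 (by omega : 1 < B.card)
    have hWB : ∀ h ∈ symOn B, ∀ v ∈ W, ρ h v ∈ W := fun h hh => hWs h (symOn_mono hBD hh)
    have ht : swap a b ∈ symOn B := swap_mem_symOn ha hb
    have htt : ∀ v, ρ (swap a b) (ρ (swap a b) v) = v := by
      intro v
      rw [← Module.End.mul_apply, ← map_mul, swap_mul_self, map_one]
      rfl
    have part : ∀ ε : ℂ, (∃ w ∈ W, w ≠ 0 ∧ ρ (swap a b) w = ε • w) →
        2 ^ K ≤ Module.finrank ℂ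
          (W ⊓ LinearMap.ker (ρ (swap a b) - ε • (1 : Module.End ℂ V)) : Submodule ℂ V) := by
      rintro ε ⟨w, hw, hw0, hwε⟩
      refine ih (D \ B) _ ?_ ?_ ?_
      · intro h hh v hv
        have hv2 : ρ (swap a b) v = ε • v := by
          have := hv.2
          rw [SetLike.mem_coe, LinearMap.mem_ker] at this
          simpa [sub_eq_zero] using this
        refine ⟨hWs h (symOn_mono Finset.sdiff_subset hh) v hv.1, ?_⟩
        have hc := mul_comm_of_disjoint Finset.disjoint_sdiff ht hh
        rw [SetLike.mem_coe, LinearMap.mem_ker]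
        have : ρ (swap a b) (ρ h v) = ε • ρ h v := by
          rw [← Module.End.mul_apply, ← map_mul, hc, map_mul, Module.End.mul_apply, hv2, map_smul]
        simp [this]
      · intro h
        have : w ∈ (W ⊓ LinearMap.ker (ρ (swap a b) - ε • (1 : Module.End ℂ V)) :
            Submodule ℂ V) := ⟨hw, by rw [SetLike.mem_coe, LinearMap.mem_ker]; simp [hwε]⟩
        rw [h] at this
        exact hw0 (by simpa using this)
      · rw [Finset.card_sdiff_of_subset hBD, hBm]
        have : (K + 1) * m = K * m + m := by ring
        omega
    have h1 := part 1 (by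
      obtain ⟨v, hv, hne⟩ := exists_swap_ne (ρ := _root_.signTwist ρ) (hBm ▸ hg.2) ha hb hab hW (by
        intro h hh v hv
        exact W.smul_mem _ (hWB h hh v hv))
      refine ⟨v + ρ (swap a b) v, W.add_mem hv (hWB _ ht v hv), fun h0 => hne ?_, ?_⟩
      · rw [signTwist_apply, Perm.sign_swap hab]
        simpa using (eq_neg_of_add_eq_zero_left h0).symm
      · rw [map_add, htt, one_smul, add_comm])
    have h2 := part (-1) (by
      obtain ⟨v, hv, hne⟩ := exists_swap_ne (ρ := ρ) (hBm ▸ hg.1) ha hb hab hW hWB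
      refine ⟨v - ρ (swap a b) v, W.sub_mem hv (hWB _ ht v hv), fun h0 => hne ?_, ?_⟩
      · exact (sub_eq_zero.1 h0).symm
      · rw [map_sub, htt]
        simp)
    set W1 : Submodule ℂ V := W ⊓ LinearMap.ker (ρ (swap a b) - (1 : ℂ) • (1 : Module.End ℂ V))
    set W2 : Submodule ℂ V := W ⊓ LinearMap.ker (ρ (swap a b) - (-1 : ℂ) • (1 : Module.End ℂ V))
    have hinf : W1 ⊓ W2 = ⊥ := by
      rw [Submodule.eq_bot_iff]
      rintro v ⟨⟨_, h3⟩, ⟨_, h4⟩⟩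
      have h3' : ρ (swap a b) v = v := by
        rw [SetLike.mem_coe, LinearMap.mem_ker] at h3
        simpa [sub_eq_zero] using h3
      have h4' : ρ (swap a b) v = -v := by
        rw [SetLike.mem_coe, LinearMap.mem_ker] at h4
        simpa [sub_eq_zero, add_eq_zero_iff_eq_neg] using h4
      rw [h3'] at h4'
      have h5 : (2 : ℂ) • v = 0 := by
        rw [two_smul]
        exact eq_neg_iff_add_eq_zero.1 h4'
      exact (smul_eq_zero.1 h5).resolve_left two_ne_zero
    have hsum := Submodule.finrank_sup_add_finrank_inf_eq W1 W2
    rw [hinf, finrank_bot, add_zero] at hsum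
    have hle : Module.finrank ℂ (W1 ⊔ W2 : Submodule ℂ V) ≤ Module.finrank ℂ W :=
      Submodule.finrank_mono (sup_le inf_le_left inf_le_left)
    rw [pow_succ]
    omega

/-- The conjugation average over the permutations of `B` of the restriction of `σ` to `B` has
spectral radius at most `c`. -/
def BlockBound (ρ : Representation ℂ (Perm α) V) (σ : Perm α) (B : Finset α) (c : ℝ) : Prop :=
  ∀ y : symOn B, (∀ z ∈ B, (y : Perm α) z = σ z) →
    EigenBound (classAvg (ρ.comp (symOn B).subtype) y) c

lemma ncard_conj_le {O : Finset α} (y : symOn O) {x₀ : α} (hx₀ : x₀ ∈ O)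
    (hO : ∀ x ∈ O, ∃ i : ℕ, ((y : Perm α) ^ i) x₀ = x) (z : symOn O) :
    {h : symOn O | h * y * h⁻¹ = z}.ncard ≤ O.card := by
  rw [← Set.ncard_coe_finset O]
  refine Set.ncard_le_ncard_of_injOn (fun h => (h : Perm α) x₀) ?_ ?_ O.finite_toSet
  · intro h _
    exact (apply_mem_of_mem_symOn h.2).2 hx₀
  · intro h hh k hk hhk
    have aux : ∀ h : symOn O, h * y * h⁻¹ = z → ∀ i : ℕ,
        (h : Perm α) (((y : Perm α) ^ i) x₀) = ((z : Perm α) ^ i) ((h : Perm α) x₀) := by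
      intro h hh i
      have : (h * y ^ i : symOn O) = z ^ i * h := by
        rw [← hh, conj_pow, inv_mul_cancel_right]
      have := congrArg (fun g : symOn O => (g : Perm α) x₀) this
      simpa using this
    ext x
    by_cases hx : x ∈ O
    · obtain ⟨i, rfl⟩ := hO x hx
      rw [aux h hh, aux k hk]
      exact congrArg _ hhk
    · rw [h.2 x hx, k.2 x hx]

/-- A long cycle is a block with small spectral radius. -/
lemma IsGeneric.blockBound_of_cycle {ρ : Representation ℂ (Perm α) V} {m : ℕ} (hm : 2 ≤ m)
    (hg : IsGeneric ρ m) {σ : Perm α} {O : Finset α} (hne : O.Nonempty)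
    (hO : ∀ x ∈ O, ∀ y ∈ O, ∃ i : ℕ, (σ ^ i) x = y) {K : ℕ} (hK : K * m ≤ O.card) :
    BlockBound ρ σ O (√O.card / 2 ^ K) := by
  intro y hy
  obtain ⟨x₀, hx₀⟩ := hne
  have hpow : ∀ i : ℕ, ((y : Perm α) ^ i) x₀ = (σ ^ i) x₀ ∧ (σ ^ i) x₀ ∈ O := by
    intro i
    induction i with
    | zero => exact ⟨rfl, hx₀⟩
    | succ i ih =>
      rw [pow_succ', pow_succ', Perm.mul_apply, Perm.mul_apply, ih.1, hy _ ih.2]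
      refine ⟨rfl, ?_⟩
      rw [← hy _ ih.2]
      exact (apply_mem_of_mem_symOn y.2).2 ih.2
  apply eigenBound_classAvg
  intro W hW hirr
  have h1 := hirr.norm_trace_sq_le y O.card (ncard_conj_le y hx₀ fun x hx => by
    obtain ⟨i, hi⟩ := hO x₀ hx₀ x hx
    exact ⟨i, by rw [(hpow i).1, hi]⟩)
  have h2 : 2 ^ K ≤ Module.finrank ℂ W :=
    hg.two_pow_le_finrank hm K O W (fun h hh v hv => hW ⟨h, hh⟩ v hv)
      (Submodule.nontrivial_iff_ne_bot.1 hirr.1) hK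
  have h3 : (2 : ℝ) ^ K ≤ Module.finrank ℂ W := by exact_mod_cast h2
  refine (Real.le_sqrt_of_sq_le h1).trans ?_
  rw [div_mul_eq_mul_div, le_div_iff₀ (by positivity)]
  exact mul_le_mul_of_nonneg_left h3 (Real.sqrt_nonneg _)

/-- A representation of the permutations supported in `B` as a representation of the symmetric
group of `B`. -/
noncomputable def ofSym (B : Finset α) : Perm B →* symOn B :=
  (Perm.ofSubtype (p := (· ∈ B))).codRestrict (symOn B) (ofSubtype_mem_symOn B)

lemma ofSym_coe (B : Finset α) (f : Perm B) : (ofSym B f : Perm α) = Perm.ofSubtype f := rfl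

lemma ofSym_surjective (B : Finset α) : Function.Surjective (ofSym B) := by
  intro g
  refine ⟨(g : Perm α).subtypePerm fun x => apply_mem_of_mem_symOn g.2, Subtype.ext ?_⟩
  rw [ofSym_coe, Perm.ofSubtype_subtypePerm]
  intro x hx
  by_contra hxB
  exact hx (g.2 x hxB)

lemma hasInv_of_subtype {ρ : Representation ℂ (Perm α) V} {B : Finset α} {W : Submodule ℂ V}
    {π : Representation ℂ (Perm B) W} {m : ℕ}
    (hπ : ∀ f (w : W), (π f w : V) = ρ (Perm.ofSubtype f) w) (h : HasInv π m) : HasInv ρ m := by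
  obtain ⟨C, hC, w, hw, hinv⟩ := h
  refine ⟨C.map (Function.Embedding.subtype _), by simpa using hC, w, by simpa using hw, ?_⟩
  refine isInvOn_of_swaps fun a ha b hb => ?_
  obtain ⟨a', ha', rfl⟩ := Finset.mem_map.1 ha
  obtain ⟨b', hb', rfl⟩ := Finset.mem_map.1 hb
  have h1 := congrArg Subtype.val (hinv _ (swap_mem_symOn ha' hb'))
  rw [hπ, Perm.ofSubtype_swap_eq] at h1
  exact h1

lemma IsGeneric.blockBound_of_forall_irr {ρ : Representation ℂ (Perm α) V} {m : ℕ}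
    (hg : IsGeneric ρ m) {σ : Perm α} {B : Finset α} (hinv : ∀ x, σ x ∈ B ↔ x ∈ B) {c : ℝ}
    (h : ∀ (W : Type) [AddCommGroup W] [Module ℂ W] [FiniteDimensional ℂ W]
      (π : Representation ℂ (Perm B) W), IsIrr π → IsGeneric π m →
      ‖LinearMap.trace ℂ W (π (σ.subtypePerm hinv))‖ ≤ c * Module.finrank ℂ W) :
    BlockBound ρ σ B c := by
  intro y hy
  apply eigenBound_classAvg
  intro W hW hirr
  have hirr' : IsIrr ((subRep (ρ.comp (symOn B).subtype) W hW).comp (ofSym B)) := by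
    refine ⟨hirr.1, fun U hU => hirr.2 U fun k v hv => ?_⟩
    obtain ⟨f, rfl⟩ := ofSym_surjective B k
    exact hU f v hv
  have key := h W _ hirr' ⟨fun h' => hg.1 (hasInv_of_subtype (fun f w => rfl) h'), fun h' =>
    hg.2 (hasInv_of_subtype (fun f w => by
      rw [signTwist_apply, signTwist_apply, Perm.sign_ofSubtype]
      rfl) h')⟩
  have hy' : ofSym B (σ.subtypePerm hinv) = y := by
    ext x
    rw [ofSym_coe]
    by_cases hx : x ∈ B
    · rw [Perm.ofSubtype_apply_of_mem _ hx, hy x hx]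
      rfl
    · rw [Perm.ofSubtype_apply_of_not_mem _ hx, y.2 x hx]
  rw [← hy']
  exact key

lemma norm_trace_mul_le_of_blocks (ρ : Representation ℂ (Perm α) V) (σ : Perm α) {c : ℝ}
    (hc : 0 ≤ c) : ∀ (L : List (Finset α)) (D : Finset α) (g : Perm α), g ∈ symOn D →
    (∀ z ∈ D, g z = σ z) → L.Pairwise Disjoint →
    (∀ B ∈ L, B ⊆ D ∧ (∀ x, σ x ∈ B ↔ x ∈ B) ∧ BlockBound ρ σ B c) →
    ∀ (Y : Module.End ℂ V) (a : ℝ), (∀ h ∈ symOn D, ρ h * Y = Y * ρ h) → EigenBound Y a →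
    ‖LinearMap.trace ℂ V (ρ g * Y)‖ ≤ c ^ L.length * a * Module.finrank ℂ V := by
  intro L
  induction L with
  | nil =>
    intro D g hg _ _ _ Y a hY hYa
    have := (hYa.mul (eigenBound_rep ρ g) zero_le_one (hY g hg).symm).norm_trace_le
    simpa using this
  | cons B L ih =>
    intro D g hg hgσ hL hB Y a hY hYa
    rw [List.pairwise_cons] at hL
    obtain ⟨hBD, hBσ, hBb⟩ := hB B List.mem_cons_self
    let y : symOn B := ofSym B (σ.subtypePerm hBσ)
    have hyσ : ∀ z ∈ B, (y : Perm α) z = σ z := by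
      intro z hz
      change Perm.ofSubtype _ z = _
      rw [Perm.ofSubtype_apply_of_mem _ hz]
      rfl
    set T := classAvg (ρ.comp (symOn B).subtype) y with hT
    have hTb : EigenBound T c := hBb y hyσ
    set g' : Perm α := g * (y : Perm α)⁻¹ with hg'
    have hyinv : ∀ z, z ∉ B → (y : Perm α)⁻¹ z = z := (inv_mem y.2)
    have hg'D : g' ∈ symOn (D \ B) := by
      intro z hz
      rw [hg', Perm.mul_apply]
      by_cases hzB : z ∈ B
      · have h1 : (y : Perm α)⁻¹ z ∈ B := (apply_mem_of_mem_symOn (inv_mem y.2)).2 hzB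
        rw [hgσ _ (hBD h1), ← hyσ _ h1, ← Perm.mul_apply, mul_inv_cancel, Perm.one_apply]
      · rw [hyinv z hzB]
        exact hg z fun h => hz (Finset.mem_sdiff.2 ⟨h, hzB⟩)
    have hg'σ : ∀ z ∈ D \ B, g' z = σ z := by
      intro z hz
      rw [Finset.mem_sdiff] at hz
      rw [hg', Perm.mul_apply, hyinv z hz.2, hgσ z hz.1]
    have hYB : ∀ k : symOn B, (ρ.comp (symOn B).subtype) k * Y
        = Y * (ρ.comp (symOn B).subtype) k := fun k => hY k (symOn_mono hBD k.2)
    have hdis : ∀ h ∈ symOn (D \ B), ∀ k : symOn B, (ρ.comp (symOn B).subtype) k * ρ h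
        = ρ h * (ρ.comp (symOn B).subtype) k := by
      intro h hh k
      change ρ k * ρ h = ρ h * ρ k
      rw [← map_mul, ← map_mul, mul_comm_of_disjoint Finset.disjoint_sdiff k.2 hh]
    have hYT : Y * T = T * Y := classAvg_commute_of_commute _ y Y hYB
    have htr : LinearMap.trace ℂ V (ρ g * Y) = LinearMap.trace ℂ V (ρ g' * (T * Y)) := by
      have h1 : ρ g * Y = ρ g' * (ρ.comp (symOn B).subtype) y * Y := by
        change _ = ρ g' * ρ y * Y
        rw [← map_mul, hg', inv_mul_cancel_right]
      rw [h1, mul_assoc, LinearMap.trace_mul_comm, mul_assoc,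
        trace_mul_eq_trace_classAvg_mul _ y (Y * ρ g'), ← mul_assoc, LinearMap.trace_mul_comm]
      intro k
      rw [← mul_assoc, hYB, mul_assoc, hdis g' hg'D, mul_assoc]
    rw [htr]
    have := ih (D \ B) g' hg'D hg'σ hL.2 (fun C hC => by
      obtain ⟨h1, h2, h3⟩ := hB C (List.mem_cons_of_mem _ hC)
      refine ⟨?_, h2, h3⟩
      exact Finset.subset_sdiff.2 ⟨h1, (hL.1 C hC).symm⟩) (T * Y) (c * a) (by
      intro h hh
      have h1 : ρ h * T = T * ρ h := classAvg_commute_of_commute _ y (ρ h) (hdis h hh)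
      rw [← mul_assoc, h1, mul_assoc, hY h (symOn_mono Finset.sdiff_subset hh), mul_assoc])
      (hYa.mul hTb hc hYT)
    rw [List.length_cons]
    refine this.trans (le_of_eq ?_)
    ring

/-- Disjoint invariant blocks contribute multiplicatively to the bound on a normalized
character. -/
lemma norm_trace_le_pow_of_blocks (ρ : Representation ℂ (Perm α) V) (σ : Perm α) {c : ℝ}
    (hc : 0 ≤ c) (L : List (Finset α)) (hL : L.Pairwise Disjoint)
    (hB : ∀ B ∈ L, (∀ x, σ x ∈ B ↔ x ∈ B) ∧ BlockBound ρ σ B c) :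
    ‖LinearMap.trace ℂ V (ρ σ)‖ ≤ c ^ L.length * Module.finrank ℂ V := by
  have := norm_trace_mul_le_of_blocks ρ σ hc L Finset.univ σ
    (fun x hx => absurd (Finset.mem_univ x) hx) (fun _ _ => rfl) hL
    (fun B hBL => ⟨Finset.subset_univ _, hB B hBL⟩) 1 1 (by simp) EigenBound.one
  simpa using this

end Generic

lemma norm_one_add_lt_two {ω : ℂ} (h : ‖ω‖ = 1) (hω : ω ≠ 1) : ‖1 + ω‖ < 2 := by
  have h1 := parallelogram_law_with_norm ℝ (1 : ℂ) ω
  have h2 : 0 < ‖1 - ω‖ := norm_pos_iff.2 (sub_ne_zero.2 hω.symm)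
  rw [h, norm_one] at h1
  nlinarith [norm_nonneg (1 + ω)]

lemma exists_root_of_unity_bound (N : ℕ) (hN : 0 < N) :
    ∃ c < (1 : ℝ), 0 ≤ c ∧ ∀ ω : ℂ, ω ^ N = 1 → ω ≠ 1 → (N - 2 + ‖1 + ω‖) / N ≤ c := by
  classical
  have hN' : (0 : ℝ) < N := by exact_mod_cast hN
  set S := ((Polynomial.nthRoots N (1 : ℂ)).toFinset).erase 1 with hS
  have memS : ∀ ω : ℂ, ω ∈ S ↔ ω ≠ 1 ∧ ω ^ N = 1 := by
    intro ω
    rw [hS, Finset.mem_erase, Multiset.mem_toFinset, Polynomial.mem_nthRoots hN]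
  rcases S.eq_empty_or_nonempty with h | h
  · refine ⟨0, one_pos, le_rfl, fun ω h1 h2 => absurd ((memS ω).2 ⟨h2, h1⟩) (by simp [h])⟩
  · obtain ⟨ω₀, hω₀, hmax⟩ := S.exists_max_image (fun ω => (N - 2 + ‖1 + ω‖) / N) h
    refine ⟨max 0 ((N - 2 + ‖1 + ω₀‖) / N), max_lt one_pos ?_, le_max_left _ _, fun ω h1 h2 =>
      (hmax ω ((memS ω).2 ⟨h2, h1⟩)).trans (le_max_right _ _)⟩
    rw [div_lt_one hN']
    have := norm_one_add_lt_two (Complex.norm_eq_one_of_pow_eq_one ((memS ω₀).1 hω₀).2 hN.ne')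
      ((memS ω₀).1 hω₀).1
    linarith

section FiniteGroup

variable {H : Type} [Group H] [Fintype H] {V : Type} [AddCommGroup V] [Module ℂ V]
  [FiniteDimensional ℂ V]

lemma exists_eigenvector_ne_one (τ : Representation ℂ H V) {g : H} (hg : τ g ≠ 1) :
    ∃ (ω : ℂ) (v : V), v ≠ 0 ∧ τ g v = ω • v ∧ ω ≠ 1 ∧ ω ^ Fintype.card H = 1 := by
  have hpow : ∀ (j : ℕ) (w : V), τ g ((τ (g ^ j)) w) = τ (g ^ (j + 1)) w := by
    intro j w
    rw [pow_succ', map_mul, Module.End.mul_apply]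
  obtain ⟨ω, v, hvR, hv0, hv⟩ := exists_eigenvector_of_stable (τ g)
    (LinearMap.range (τ g - 1)) (by
      rw [Ne, LinearMap.range_eq_bot, sub_eq_zero]
      exact hg) (by
      rintro _ ⟨u, rfl⟩
      exact ⟨τ g u, by simp⟩)
  refine ⟨ω, v, hv0, hv, ?_, ?_⟩
  · rintro rfl
    obtain ⟨u, hu⟩ := hvR
    rw [one_smul] at hv
    have hu' : τ g u = u + v := by
      rw [← hu]
      simp
    have hj : ∀ j : ℕ, τ (g ^ j) u = u + (j : ℂ) • v := by
      intro j
      induction j with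
      | zero => simp
      | succ j ih =>
        rw [← hpow, ih, map_add, map_smul, hu', hv]
        push_cast
        module
    have h1 := hj (Fintype.card H)
    rw [pow_card_eq_one, map_one, Module.End.one_apply, left_eq_add, smul_eq_zero] at h1
    exact h1.elim card_ne_zero_complex hv0
  · have hj : ∀ j : ℕ, τ (g ^ j) v = ω ^ j • v := by
      intro j
      induction j with
      | zero => simp
      | succ j ih => rw [← hpow, ih, map_smul, hv, smul_smul, pow_succ]
    have h1 := hj (Fintype.card H)
    rw [pow_card_eq_one, map_one, Module.End.one_apply] at h1
    have h2 : (ω ^ Fintype.card H - 1) • v = 0 := by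
      rw [sub_smul, ← h1, one_smul, sub_self]
    exact sub_eq_zero.1 ((smul_eq_zero.1 h2).resolve_right hv0)

lemma IsIrr.norm_trace_le_of_conj_ne {τ : Representation ℂ H V} (hτ : IsIrr τ) {x h : H}
    (hh : τ (h * x * h⁻¹) ≠ τ x) {c : ℝ}
    (hc : ∀ ω : ℂ, ω ^ Fintype.card H = 1 → ω ≠ 1 →
      (Fintype.card H - 2 + ‖1 + ω‖) / Fintype.card H ≤ c) :
    ‖LinearMap.trace ℂ V (τ x)‖ ≤ c * Module.finrank ℂ V := by
  classical
  obtain ⟨z, hz, htr⟩ := hτ.classAvg_eq x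
  rw [htr, norm_mul, Complex.norm_natCast]
  refine mul_le_mul_of_nonneg_right ?_ (by positivity)
  have hg : τ (x⁻¹ * (h * x * h⁻¹)) ≠ 1 := by
    intro h1
    apply hh
    have : h * x * h⁻¹ = x * (x⁻¹ * (h * x * h⁻¹)) := by group
    rw [this, map_mul, h1, mul_one]
  obtain ⟨ω, v, hv0, hv, hω1, hωN⟩ := exists_eigenvector_ne_one τ hg
  refine le_trans ?_ (hc ω hωN hω1)
  have hh1 : h ≠ 1 := by
    rintro rfl
    exact hh (by simp)
  obtain ⟨d, _, F, hF, hnorm⟩ := exists_invariant_embedding τ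
  have hFv : 0 < ‖F v‖ := norm_pos_iff.2 fun h0 => hv0 (hF (by rw [h0, map_zero]))
  have hNpos : (0 : ℝ) < Fintype.card H := by exact_mod_cast Fintype.card_pos
  have hsum : (Fintype.card H : ℂ) • z • v = ∑ k, τ (k * x * k⁻¹) v := by
    have h1 : classAvg τ x v = z • v := by rw [hz]; rfl
    rw [← h1, classAvg_apply, smul_smul, mul_inv_cancel₀ card_ne_zero_complex, one_smul]
  have hpair : τ (1 * x * 1⁻¹) v + τ (h * x * h⁻¹) v = (1 + ω) • τ x v := by
    have h2 : h * x * h⁻¹ = x * (x⁻¹ * (h * x * h⁻¹)) := by group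
    rw [h2, map_mul τ x, Module.End.mul_apply, hv, map_smul, add_smul, one_smul, one_mul, inv_one,
      mul_one]
  have hsplit : ∑ k, τ (k * x * k⁻¹) v = (1 + ω) • τ x v +
      ∑ k ∈ Finset.univ \ {1, h}, τ (k * x * k⁻¹) v := by
    rw [← hpair, ← Finset.sum_pair (f := fun k => τ (k * x * k⁻¹) v) hh1.symm, add_comm,
      Finset.sum_sdiff (Finset.subset_univ _)]
  have hcard : ((Finset.univ \ {1, h} : Finset H).card : ℝ) = Fintype.card H - 2 := by
    rw [Finset.cast_card_sdiff (Finset.subset_univ _), Finset.card_pair hh1.symm]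
    simp
  have hle : ‖F (∑ k, τ (k * x * k⁻¹) v)‖ ≤
      ‖1 + ω‖ * ‖F v‖ + (Fintype.card H - 2) * ‖F v‖ := by
    rw [hsplit, map_add, map_smul, map_sum]
    refine (norm_add_le _ _).trans (add_le_add ?_ ?_)
    · rw [norm_smul, hnorm]
    · refine (norm_sum_le _ _).trans ?_
      rw [Finset.sum_congr rfl fun k _ => hnorm _ _, Finset.sum_const, nsmul_eq_mul, hcard]
  rw [← hsum, map_smul, map_smul, norm_smul, norm_smul, Complex.norm_natCast] at hle
  rw [le_div_iff₀ hNpos]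
  have : (Fintype.card H * ‖z‖) * ‖F v‖ ≤ (Fintype.card H - 2 + ‖1 + ω‖) * ‖F v‖ := by
    linarith
  have := le_of_mul_le_mul_right this hFv
  linarith

end FiniteGroup

section SymmetricGroup

open Equiv

variable {α : Type} [Fintype α] [DecidableEq α] {V : Type} [AddCommGroup V] [Module ℂ V]
  [FiniteDimensional ℂ V]

lemma eq_one_of_central (hα : 3 ≤ Fintype.card α) {σ : Perm α} (h : ∀ g, g * σ * g⁻¹ = σ) :
    σ = 1 := by
  ext x
  by_contra hne
  rw [Perm.one_apply] at hne
  obtain ⟨z, hz⟩ : ∃ z, z ∉ ({x, σ x} : Finset α) := by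
    by_contra hcon
    push Not at hcon
    have : Fintype.card α ≤ ({x, σ x} : Finset α).card :=
      Finset.card_le_card fun y _ => hcon y
    have := Finset.card_le_two (a := x) (b := σ x)
    omega
  simp only [Finset.mem_insert, Finset.mem_singleton, not_or] at hz
  have h1 := Perm.congr_fun (h (swap (σ x) z)) x
  rw [Perm.mul_apply, Perm.mul_apply, swap_inv,
    swap_apply_of_ne_of_ne (Ne.symm hne) (Ne.symm hz.1), swap_apply_left] at h1
  exact hz.2 h1

lemma IsGeneric.exists_conj_ne {ρ : Representation ℂ (Perm α) V} (hV : Nontrivial V)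
    (hα : 5 ≤ Fintype.card α) (hg : IsGeneric ρ (Fintype.card α)) {σ : Perm α} (hσ : σ ≠ 1) :
    ∃ h, ρ (h * σ * h⁻¹) ≠ ρ σ := by
  by_contra hcon
  push Not at hcon
  have hker : MonoidHom.ker ρ ≠ ⊥ := by
    intro hbot
    refine hσ (eq_one_of_central (by omega) fun g => ?_)
    have h1 : g * σ * g⁻¹ * σ⁻¹ ∈ MonoidHom.ker ρ := by
      rw [MonoidHom.mem_ker, map_mul, hcon, ← map_mul, mul_inv_cancel, map_one]
    rw [hbot, Subgroup.mem_bot] at h1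
    exact mul_inv_eq_one.1 h1
  have hnt : Nontrivial (MonoidHom.ker ρ) := (Subgroup.nontrivial_iff_ne_bot _).2 hker
  have hle : alternatingGroup α ≤ MonoidHom.ker ρ :=
    Equiv.Perm.alternatingGroup_le_of_normal (by rwa [Nat.card_eq_fintype_card]) inferInstance
  have : Nontrivial α := Fintype.one_lt_card_iff_nontrivial.1 (by omega)
  obtain ⟨a, b, hab⟩ := exists_pair_ne α
  have hswap : ∀ p q, p ≠ q → ρ (swap p q) = ρ (swap a b) := by
    intro p q hpq
    have h1 : swap p q * swap a b ∈ MonoidHom.ker ρ := hle (by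
      rw [Equiv.Perm.mem_alternatingGroup, Perm.sign_mul, Perm.sign_swap hab, Perm.sign_swap hpq]
      rfl)
    rw [MonoidHom.mem_ker] at h1
    have h2 : swap p q = swap p q * swap a b * swap a b := by
      rw [mul_assoc, swap_mul_self, mul_one]
    rw [h2, map_mul, h1, one_mul]
  have key : ∀ (π : Representation ℂ (Perm α) V) (w : V), w ≠ 0 → (∀ p q, p ≠ q →
      π (swap p q) w = w) → HasInv π (Fintype.card α) := by
    intro π w hw0 hw
    refine ⟨Finset.univ, rfl, w, hw0, isInvOn_of_swaps fun p _ q _ => ?_⟩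
    by_cases hpq : p = q
    · rw [hpq, swap_self]
      exact LinearMap.congr_fun (map_one π) w
    · exact hw p q hpq
  obtain ⟨v, hv⟩ := exists_ne (0 : V)
  by_cases h0 : v + ρ (swap a b) v = 0
  · refine hg.2 (key _ v hv fun p q hpq => ?_)
    rw [signTwist_apply, Perm.sign_swap hpq, hswap p q hpq, (eq_neg_of_add_eq_zero_right h0)]
    simp
  · refine hg.1 (key _ _ h0 fun p q hpq => ?_)
    rw [hswap p q hpq, map_add, ← Module.End.mul_apply, ← map_mul, swap_mul_self, map_one,
      Module.End.one_apply, add_comm]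

/-- For a fixed degree, nontrivial normalized characters at nonidentity permutations are bounded
away from `1`. -/
lemma exists_norm_trace_bound (n : ℕ) (hn : 5 ≤ n) : ∃ c < (1 : ℝ), 0 ≤ c ∧
    ∀ (α : Type) [Fintype α] [DecidableEq α] (V : Type) [AddCommGroup V] [Module ℂ V]
      [FiniteDimensional ℂ V] (ρ : Representation ℂ (Perm α) V) (σ : Perm α),
      Fintype.card α = n → IsIrr ρ → IsGeneric ρ n → σ ≠ 1 →
      ‖LinearMap.trace ℂ V (ρ σ)‖ ≤ c * Module.finrank ℂ V := by
  obtain ⟨c, hc1, hc0, hc⟩ := exists_root_of_unity_bound n.factorial n.factorial_pos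
  refine ⟨c, hc1, hc0, ?_⟩
  intro α _ _ V _ _ _ ρ σ hα hρ hg hσ
  subst hα
  obtain ⟨h, hh⟩ := hg.exists_conj_ne hρ.1 hn hσ
  refine hρ.norm_trace_le_of_conj_ne hh ?_
  rw [Fintype.card_perm]
  exact hc

end SymmetricGroup

section Orbits

open Equiv

variable {α : Type} [Fintype α] [DecidableEq α]

open Classical in
/-- The orbit of `x` under the permutation `σ`. -/
noncomputable def orbitOf (σ : Perm α) (x : α) : Finset α :=
  Finset.univ.filter fun y => ∃ i : ℕ, (σ ^ i) x = y

lemma mem_orbitOf {σ : Perm α} {x y : α} : y ∈ orbitOf σ x ↔ ∃ i : ℕ, (σ ^ i) x = y := by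
  simp [orbitOf]

lemma self_mem_orbitOf (σ : Perm α) (x : α) : x ∈ orbitOf σ x := mem_orbitOf.2 ⟨0, rfl⟩

lemma mem_orbitOf_iff_sameCycle {σ : Perm α} {x y : α} : y ∈ orbitOf σ x ↔ σ.SameCycle x y := by
  rw [mem_orbitOf]
  constructor
  · rintro ⟨i, hi⟩
    exact ⟨i, by simpa using hi⟩
  · intro h
    obtain ⟨i, _, hi⟩ := h.exists_pow_eq'
    exact ⟨i, hi⟩

lemma orbitOf_invariant (σ : Perm α) (x y : α) : σ y ∈ orbitOf σ x ↔ y ∈ orbitOf σ x := by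
  rw [mem_orbitOf_iff_sameCycle, mem_orbitOf_iff_sameCycle, Perm.sameCycle_apply_right]

lemma exists_pow_of_mem_orbitOf {σ : Perm α} {x : α} :
    ∀ y ∈ orbitOf σ x, ∀ z ∈ orbitOf σ x, ∃ i : ℕ, (σ ^ i) y = z := by
  intro y hy z hz
  rw [mem_orbitOf_iff_sameCycle] at hy hz
  exact mem_orbitOf.1 (mem_orbitOf_iff_sameCycle.2 (hy.symm.trans hz))

lemma orbitOf_subset {σ : Perm α} {D : Finset α} (hD : ∀ x, σ x ∈ D ↔ x ∈ D) {x : α}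
    (hx : x ∈ D) : orbitOf σ x ⊆ D := by
  intro y hy
  obtain ⟨i, rfl⟩ := mem_orbitOf.1 hy
  clear hy
  induction i with
  | zero => exact hx
  | succ i ih =>
    rw [pow_succ', Perm.mul_apply]
    exact (hD _).2 ih

lemma exists_block {σ : Perm α} {D : Finset α} {L : ℕ} (hL : 0 < L)
    (hD : ∀ x, σ x ∈ D ↔ x ∈ D) (horb : ∀ x, (orbitOf σ x).card < L) (hLD : L ≤ D.card) :
    ∃ B ⊆ D, (∀ x, σ x ∈ B ↔ x ∈ B) ∧ L ≤ B.card ∧ B.card < 2 * L := by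
  obtain ⟨B, hB, hmin⟩ := Finset.exists_min_image
    (D.powerset.filter fun B => (∀ x, σ x ∈ B ↔ x ∈ B) ∧ L ≤ B.card) Finset.card
    ⟨D, Finset.mem_filter.2 ⟨Finset.mem_powerset_self D, hD, hLD⟩⟩
  rw [Finset.mem_filter, Finset.mem_powerset] at hB
  obtain ⟨hBD, hBσ, hLB⟩ := hB
  refine ⟨B, hBD, hBσ, hLB, ?_⟩
  by_contra hcon
  obtain ⟨x, hx⟩ := Finset.card_pos.1 (hL.trans_le hLB)
  have hsub := orbitOf_subset hBσ hx
  have hcard := Finset.card_sdiff_of_subset hsub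
  have hpos : 0 < (orbitOf σ x).card := Finset.card_pos.2 ⟨x, self_mem_orbitOf σ x⟩
  have horbx := horb x
  have := hmin (B \ orbitOf σ x) (Finset.mem_filter.2
    ⟨Finset.mem_powerset.2 (Finset.sdiff_subset.trans hBD), fun y => by
      rw [Finset.mem_sdiff, Finset.mem_sdiff, hBσ, orbitOf_invariant], by omega⟩)
  omega

lemma exists_blocks {σ : Perm α} {L : ℕ} (hL : 0 < L) (horb : ∀ x, (orbitOf σ x).card < L) :
    ∀ (r : ℕ) (D : Finset α), (∀ x, σ x ∈ D ↔ x ∈ D) → r * (2 * L) ≤ D.card →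
      ∃ l : List (Finset α), l.length = r ∧ l.Pairwise Disjoint ∧
        ∀ B ∈ l, B ⊆ D ∧ (∀ x, σ x ∈ B ↔ x ∈ B) ∧ L ≤ B.card ∧ B.card < 2 * L := by
  intro r
  induction r with
  | zero => exact fun D _ _ => ⟨[], rfl, List.Pairwise.nil, by simp⟩
  | succ r ih =>
    intro D hD hr
    have hr' : r * (2 * L) + 2 * L ≤ D.card := by linarith
    obtain ⟨B, hBD, hBσ, hLB, hB2⟩ := exists_block hL hD horb (by omega)
    obtain ⟨l, hl, hdis, hB⟩ := ih (D \ B) (fun x => by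
      rw [Finset.mem_sdiff, Finset.mem_sdiff, hBσ, hD]) (by
      rw [Finset.card_sdiff_of_subset hBD]
      omega)
    refine ⟨B :: l, by simp [hl], List.pairwise_cons.2 ⟨fun C hC => ?_, hdis⟩, ?_⟩
    · exact (Finset.subset_sdiff.1 (hB C hC).1).2.symm
    · intro C hC
      rcases List.mem_cons.1 hC with rfl | hC
      · exact ⟨hBD, hBσ, hLB, hB2⟩
      · exact ⟨(Finset.subset_sdiff.1 (hB C hC).1).1, (hB C hC).2⟩

end Orbits

section Parameters

lemma succ_pow_ten_le {s : ℕ} (hs : 100 ≤ s) : (s + 1) ^ 10 ≤ 2 * s ^ 10 := by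
  have h1 : (100 * (s + 1)) ^ 10 ≤ (101 * s) ^ 10 := Nat.pow_le_pow_left (by omega) 10
  rw [mul_pow, mul_pow] at h1
  have h2 : 101 ^ 10 * s ^ 10 ≤ 100 ^ 10 * (2 * s ^ 10) := by
    have : 101 ^ 10 ≤ 100 ^ 10 * 2 := by norm_num
    nlinarith [pow_pos (by omega : 0 < s) 10]
  exact Nat.le_of_mul_le_mul_left (h1.trans h2) (by norm_num)

lemma exists_pow_ten_le {s₀ n : ℕ} (hs₀ : 100 ≤ s₀) (hn : s₀ ^ 10 ≤ n) :
    ∃ s ≥ s₀, s ^ 10 ≤ n ∧ n ≤ 2 * s ^ 10 := by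
  have hex : ∃ t, n < (t + 1) ^ 10 :=
    ⟨n, (Nat.lt_succ_self n).trans_le (Nat.le_self_pow (by norm_num) _)⟩
  have hle : s₀ ≤ Nat.find hex := by
    by_contra hlt
    have h1 := Nat.find_spec hex
    have h2 : (Nat.find hex + 1) ^ 10 ≤ s₀ ^ 10 := Nat.pow_le_pow_left (by omega) 10
    omega
  refine ⟨Nat.find hex, hle, ?_, ?_⟩
  · have h1 := Nat.find_min hex (m := Nat.find hex - 1) (by omega)
    rw [Nat.sub_add_cancel (by omega)] at h1
    omega
  · exact (Nat.find_spec hex).le.trans (succ_pow_ten_le (hs₀.trans hle))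

lemma eventually_cycle_bound : ∀ᶠ s : ℕ in Filter.atTop, ∀ n O : ℕ, n ≤ 2 * s ^ 10 → 0 < n →
    O ≤ n → √(O : ℝ) / 2 ^ s ≤ (n : ℝ)⁻¹ := by
  filter_upwards [eventually_pow_mul_exp_le 4 15 (Real.log_pos one_lt_two)] with s hs n O hn hn0 hO
  have hexp : Real.exp (-(Real.log 2 * s)) = (2 ^ s)⁻¹ := by
    rw [Real.exp_neg, mul_comm, Real.exp_nat_mul, Real.exp_log two_pos]
  rw [hexp] at hs
  have hn' : (n : ℝ) ≤ 2 * (s : ℝ) ^ 10 := by exact_mod_cast hn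
  have hO' : (O : ℝ) ≤ 2 * (s : ℝ) ^ 10 := by exact_mod_cast hO.trans hn
  have hsq : √(O : ℝ) ≤ 2 * (s : ℝ) ^ 5 := by
    apply Real.sqrt_le_iff.2
    refine ⟨by positivity, hO'.trans ?_⟩
    have : (0 : ℝ) ≤ (s : ℝ) ^ 10 := by positivity
    calc 2 * (s : ℝ) ^ 10 ≤ 4 * (s : ℝ) ^ 10 := by linarith
      _ = _ := by ring
  have hnpos : (0 : ℝ) < n := by exact_mod_cast hn0
  rw [← one_div, le_div_iff₀ hnpos]
  calc √(O : ℝ) / 2 ^ s * n ≤ (2 * (s : ℝ) ^ 5) / 2 ^ s * (2 * (s : ℝ) ^ 10) := by gcongr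
    _ = 4 * (s : ℝ) ^ 15 * (2 ^ s)⁻¹ := by ring
    _ ≤ 1 := hs

lemma eventually_block_bound {c : ℝ} (hc0 : 0 < c) (hc1 : c < 1) : ∀ᶠ s : ℕ in Filter.atTop,
    ∀ n : ℕ, n ≤ 2 * s ^ 10 → 0 < n → c ^ (s / 3) ≤ (n : ℝ)⁻¹ := by
  have hlog : 0 < -Real.log c / 4 := by
    have := Real.log_neg hc0 hc1
    linarith
  filter_upwards [eventually_pow_mul_exp_le 2 10 hlog, Filter.eventually_ge_atTop 12]
    with s hs hs12 n hn hn0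
  have hn' : (n : ℝ) ≤ 2 * (s : ℝ) ^ 10 := by exact_mod_cast hn
  have hnpos : (0 : ℝ) < n := by exact_mod_cast hn0
  have hfloor : (s : ℝ) / 4 ≤ ((s / 3 : ℕ) : ℝ) := by
    have : s ≤ 4 * (s / 3) := by omega
    have : (s : ℝ) ≤ 4 * ((s / 3 : ℕ) : ℝ) := by exact_mod_cast this
    linarith
  have hpow : c ^ (s / 3) ≤ Real.exp (-(-Real.log c / 4 * s)) := by
    have h1 : c ^ (s / 3) = Real.exp ((s / 3 : ℕ) * Real.log c) := by
      rw [Real.exp_nat_mul, Real.exp_log hc0]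
    rw [h1]
    apply Real.exp_le_exp.2
    have := Real.log_neg hc0 hc1
    nlinarith
  rw [← one_div, le_div_iff₀ hnpos]
  calc c ^ (s / 3) * n ≤ Real.exp (-(-Real.log c / 4 * s)) * (2 * (s : ℝ) ^ 10) := by gcongr
    _ = 2 * (s : ℝ) ^ 10 * Real.exp (-(-Real.log c / 4 * s)) := by ring
    _ ≤ 1 := hs

end Parameters

section Bounds

open Equiv

variable {α : Type} [Fintype α] [DecidableEq α] {V : Type} [AddCommGroup V] [Module ℂ V]
  [FiniteDimensional ℂ V]

lemma exists_maximal_hasInv {ρ : Representation ℂ (Perm α) V} {M n : ℕ} (hM : HasInv ρ M)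
    (hn : ¬ HasInv ρ n) : ∃ m, M ≤ m ∧ m < n ∧ HasInv ρ m ∧ ¬ HasInv ρ (m + 1) := by
  classical
  have hex : ∃ t, ¬ HasInv ρ t := ⟨n, hn⟩
  have h1 : M < Nat.find hex := by
    by_contra hcon
    exact Nat.find_spec hex (hM.mono (not_lt.1 hcon))
  have h2 : Nat.find hex ≤ n := Nat.find_min' hex hn
  refine ⟨Nat.find hex - 1, by omega, by omega, ?_, ?_⟩
  · exact not_not.1 (Nat.find_min hex (by omega))
  · rw [Nat.sub_add_cancel (by omega)]
    exact Nat.find_spec hex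

/-- A uniform bound for the normalized characters of degree `n` at derangements. -/
def DerangementBound (n : ℕ) (c : ℝ) : Prop :=
  ∀ (α : Type) [Fintype α] [DecidableEq α] (V : Type) [AddCommGroup V] [Module ℂ V]
    [FiniteDimensional ℂ V] (ρ : Representation ℂ (Perm α) V) (σ : Perm α),
    Fintype.card α = n → IsIrr ρ → IsGeneric ρ n → (∀ x, σ x ≠ x) →
    ‖LinearMap.trace ℂ V (ρ σ)‖ ≤ c * Module.finrank ℂ V

lemma DerangementBound.mono {n : ℕ} {c c' : ℝ} (h : DerangementBound n c) (hc : c ≤ c') :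
    DerangementBound n c' := by
  intro α _ _ V _ _ _ ρ σ hα hρ hg hσ
  exact (h α V ρ σ hα hρ hg hσ).trans (mul_le_mul_of_nonneg_right hc (by positivity))

lemma IsGeneric.blockBound_of_derangementBound {ρ : Representation ℂ (Perm α) V} {m : ℕ}
    (hg : IsGeneric ρ m) {σ : Perm α} {B : Finset α} (hinv : ∀ x, σ x ∈ B ↔ x ∈ B) {c : ℝ}
    (hm : m ≤ B.card) (hc : DerangementBound B.card c) (hσ : ∀ x ∈ B, σ x ≠ x) :
    BlockBound ρ σ B c := by
  refine hg.blockBound_of_forall_irr hinv ?_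
  intro W _ _ _ π hπ hπg
  refine hc B W π _ (Fintype.card_coe B) hπ (hπg.mono hm) fun x hx => ?_
  exact hσ x x.2 (congrArg Subtype.val hx)

lemma IsGeneric.norm_trace_le_of_orbit {ρ : Representation ℂ (Perm α) V} {s : ℕ} (hs : 2 ≤ s)
    (hbound : ∀ n O : ℕ, n ≤ 2 * s ^ 10 → 0 < n → O ≤ n → √(O : ℝ) / 2 ^ s ≤ (n : ℝ)⁻¹)
    (hg : IsGeneric ρ (s ^ 8)) (hn : Fintype.card α ≤ 2 * s ^ 10) {σ : Perm α} {x : α}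
    (hx : s ^ 9 ≤ (orbitOf σ x).card) :
    ‖LinearMap.trace ℂ V (ρ σ)‖ ≤ (Fintype.card α : ℝ)⁻¹ * Module.finrank ℂ V := by
  have h2 : 2 ≤ s ^ 8 := hs.trans (Nat.le_self_pow (by norm_num) s)
  have hb := hg.blockBound_of_cycle h2 ⟨x, self_mem_orbitOf σ x⟩ exists_pow_of_mem_orbitOf
    (K := s) (by rwa [← pow_succ'])
  have key := norm_trace_le_pow_of_blocks ρ σ (c := √((orbitOf σ x).card : ℝ) / 2 ^ s)
    (by positivity) [orbitOf σ x] (by simp)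
    (fun B hB => by
      rw [List.mem_singleton.1 hB]
      exact ⟨orbitOf_invariant σ x, hb⟩)
  rw [List.length_singleton, pow_one] at key
  refine key.trans (mul_le_mul_of_nonneg_right ?_ (by positivity))
  exact hbound _ _ hn (Fintype.card_pos_iff.2 ⟨x⟩) (Finset.card_le_univ _)

lemma exists_derangement_step : ∃ s₀, 100 ≤ s₀ ∧ ∀ s ≥ s₀, ∀ (n : ℕ) (c : ℝ), s ^ 10 ≤ n →
    n ≤ 2 * s ^ 10 → 1 / 2 ≤ c → (∀ k, 5 ≤ k → k < n → DerangementBound k c) →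
    DerangementBound n c := by
  obtain ⟨s₁, hs₁, hexit⟩ := exists_exitAverage_le_inv
  obtain ⟨s₂, hcyc⟩ := Filter.eventually_atTop.1 eventually_cycle_bound
  refine ⟨max s₁ s₂, hs₁.trans (le_max_left _ _), ?_⟩
  intro s hs n c hsn hns hc ih α _ _ V _ _ _ ρ σ hα hρ hg hσ
  subst hα
  have hs₁' : s₁ ≤ s := (le_max_left _ _).trans hs
  have hs100 : 100 ≤ s := hs₁.trans hs₁'
  have hcyc' := hcyc s ((le_max_right _ _).trans hs)
  have hpow : s ^ 10 = s * (s * s ^ 8) := by ring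
  have hpow9 : s ^ 9 = s * s ^ 8 := by ring
  have h8 : 100 ≤ s ^ 8 := hs100.trans (Nat.le_self_pow (by norm_num) s)
  have h10 : 100 * (100 * s ^ 8) ≤ s ^ 10 := by
    rw [hpow]
    gcongr
  have h1000 : 100 * s ^ 9 ≤ s ^ 10 := by
    rw [hpow, hpow9]
    gcongr
  have hn0 : (10000 : ℝ) ≤ Fintype.card α := by
    have : 10000 ≤ Fintype.card α := by omega
    exact_mod_cast this
  have hninv : (Fintype.card α : ℝ)⁻¹ ≤ c := by
    refine le_trans ?_ hc
    rw [inv_le_comm₀ (by linarith) (by norm_num)]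
    linarith
  have hfix : (Finset.univ.filter fun x => σ x = x).card ≤ 2 := by
    rw [Finset.filter_false_of_mem fun x _ => hσ x]
    simp
  have case : ∀ π : Representation ℂ (Perm α) V, IsIrr π → HasInv π (s ^ 8) →
      ¬ HasInv π (Fintype.card α) →
      ‖LinearMap.trace ℂ V (π σ)‖ ≤ c * Module.finrank ℂ V := by
    intro π hπ h1 h2
    obtain ⟨m, hm1, hm2, hm3, hm4⟩ := exists_maximal_hasInv h1 h2
    refine (hπ.norm_trace_le_exitAverage hm3 hm4 σ).trans
      (mul_le_mul_of_nonneg_right ?_ (by positivity))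
    obtain ⟨k, hk⟩ : ∃ k, k + m = Fintype.card α := ⟨Fintype.card α - m, by omega⟩
    rw [← hk, Nat.add_sub_cancel]
    by_cases hk3 : 3 ≤ k
    · refine (hexit s hs₁' α σ hsn hns hfix k m hk hk3 hm1).trans ?_
      rw [← hk] at hninv
      push_cast at hninv
      exact hninv
    · refine (exitAverage_le_of_derangement σ hσ (by omega) (by omega) hk).trans ?_
      have hkR : (k : ℝ) ≤ 2 := by
        have : k ≤ 2 := by omega
        exact_mod_cast this
      have hmR : (1000 : ℝ) ≤ m := by
        have : 1000 ≤ m := by omega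
        exact_mod_cast this
      have hk0 : (0 : ℝ) ≤ k := by positivity
      have e1 : ((k : ℝ) + m) * ((k : ℝ) / (k + m)) ^ 2 = k ^ 2 / (k + m) := by
        field_simp
      have e2 : (k : ℝ) ^ 2 / (k + m) ≤ 1 / 4 := by
        rw [div_le_iff₀ (by linarith)]
        nlinarith
      have e3 : (m : ℝ)⁻¹ ≤ 1 / 4 := by
        rw [inv_le_comm₀ (by linarith) (by norm_num)]
        linarith
      rw [e1]
      linarith
  by_cases hA : HasInv ρ (s ^ 8)
  · exact case ρ hρ hA hg.1
  by_cases hA' : HasInv (signTwist ρ) (s ^ 8)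
  · rw [← norm_trace_signTwist]
    exact case _ hρ.signTwist hA' hg.2
  have hgen : IsGeneric ρ (s ^ 8) := ⟨hA, hA'⟩
  by_cases hlong : ∃ x, s ^ 9 ≤ (orbitOf σ x).card
  · obtain ⟨x, hx⟩ := hlong
    exact (hgen.norm_trace_le_of_orbit (by omega) hcyc' hns hx).trans
      (mul_le_mul_of_nonneg_right hninv (by positivity))
  push Not at hlong
  have h89 : s ^ 8 ≤ s ^ 9 := Nat.pow_le_pow_right (by omega) (by norm_num)
  obtain ⟨B, _, hBσ, hLB, hB2⟩ := exists_block (σ := σ) (D := Finset.univ) (L := s ^ 9) (by omega)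
    (fun x => by simp) hlong (by rw [Finset.card_univ]; omega)
  have hb := hgen.blockBound_of_derangementBound hBσ (by omega)
    (ih B.card (by omega) (by omega)) (fun x _ => hσ x)
  have := norm_trace_le_pow_of_blocks ρ σ (c := c) (by linarith) [B] (by simp) (fun C hC => by
    rw [List.mem_singleton.1 hC]
    exact ⟨hBσ, hb⟩)
  simpa using this

lemma exists_derangementBound_lt (n₀ : ℕ) : ∃ c < (1 : ℝ), 1 / 2 ≤ c ∧
    ∀ k, 5 ≤ k → k < n₀ → DerangementBound k c := by
  induction n₀ with
  | zero => exact ⟨1 / 2, by norm_num, le_rfl, fun k _ hk => absurd hk (by omega)⟩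
  | succ n ih =>
    obtain ⟨c, hc1, hc2, hc⟩ := ih
    by_cases hn : 5 ≤ n
    · obtain ⟨c', hc'1, _, hc'⟩ := exists_norm_trace_bound n hn
      refine ⟨max c c', max_lt hc1 hc'1, hc2.trans (le_max_left _ _), fun k hk hkn => ?_⟩
      rcases Nat.lt_succ_iff_lt_or_eq.1 hkn with h | rfl
      · exact (hc k hk h).mono (le_max_left _ _)
      · refine DerangementBound.mono ?_ (le_max_right c c')
        intro α _ _ V _ _ _ ρ σ hα hρ hg hσ
        refine hc' α V ρ σ hα hρ hg ?_
        rintro rfl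
        have : Nonempty α := Fintype.card_pos_iff.1 (by omega)
        exact hσ (Classical.arbitrary α) rfl
    · exact ⟨c, hc1, hc2, fun k hk hkn => hc k hk (by omega)⟩

/-- Nontrivial normalized characters at derangements are uniformly bounded away from `1`. -/
lemma exists_derangementBound : ∃ c < (1 : ℝ), 0 < c ∧ ∀ n, 5 ≤ n → DerangementBound n c := by
  obtain ⟨s₀, hs₀, hstep⟩ := exists_derangement_step
  obtain ⟨c, hc1, hc2, hc⟩ := exists_derangementBound_lt (s₀ ^ 10)
  refine ⟨c, hc1, by linarith, fun n => ?_⟩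
  induction n using Nat.strong_induction_on with
  | _ n ih =>
    intro hn
    by_cases hlt : n < s₀ ^ 10
    · exact hc n hn hlt
    · obtain ⟨s, hs, h1, h2⟩ := exists_pow_ten_le hs₀ (not_lt.1 hlt)
      exact hstep s hs n c h1 h2 hc2 fun k hk hkn => ih k hkn hk

lemma exists_two_fixed_bound : ∃ N₀, 100 ≤ N₀ ∧ ∀ (α : Type) [Fintype α] [DecidableEq α] (V : Type)
    [AddCommGroup V] [Module ℂ V] [FiniteDimensional ℂ V] (ρ : Representation ℂ (Perm α) V)
    (σ : Perm α), N₀ ≤ Fintype.card α → (Finset.univ.filter fun x => σ x = x).card = 2 →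
    IsIrr ρ → IsGeneric ρ (Fintype.card α) →
    ‖LinearMap.trace ℂ V (ρ σ)‖ ≤ 1 / ((Fintype.card α : ℝ) - 1) * Module.finrank ℂ V := by
  obtain ⟨c, hc1, hc0, hder⟩ := exists_derangementBound
  obtain ⟨s₁, hs₁, hexit⟩ := exists_exitAverage_le_inv
  obtain ⟨s₂, hcyc⟩ := Filter.eventually_atTop.1
    (eventually_cycle_bound.and (eventually_block_bound hc0 hc1))
  refine ⟨(max s₁ s₂) ^ 10, (hs₁.trans (le_max_left _ _)).trans
    (Nat.le_self_pow (by norm_num) _), ?_⟩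
  intro α _ _ V _ _ _ ρ σ hα hfix hρ hg
  obtain ⟨s, hs, hsn, hns⟩ := exists_pow_ten_le (hs₁.trans (le_max_left _ _)) hα
  have hs₁' : s₁ ≤ s := (le_max_left _ _).trans hs
  have hs100 : 100 ≤ s := hs₁.trans hs₁'
  obtain ⟨hcyc', hblk⟩ := hcyc s ((le_max_right _ _).trans hs)
  have hpow : s ^ 10 = s * s ^ 9 := by ring
  have h9 : 100 ≤ s ^ 9 := hs100.trans (Nat.le_self_pow (by norm_num) s)
  have h10 : 100 * s ^ 9 ≤ s ^ 10 := by
    rw [hpow]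
    gcongr
  have hn0 : (100 : ℝ) ≤ Fintype.card α := by
    have : 100 ≤ Fintype.card α := by omega
    exact_mod_cast this
  have hninv : (Fintype.card α : ℝ)⁻¹ ≤ 1 / ((Fintype.card α : ℝ) - 1) := by
    rw [inv_eq_one_div]
    apply one_div_le_one_div_of_le <;> linarith
  have case : ∀ π : Representation ℂ (Perm α) V, IsIrr π → HasInv π (s ^ 8) →
      ¬ HasInv π (Fintype.card α) →
      ‖LinearMap.trace ℂ V (π σ)‖ ≤ 1 / ((Fintype.card α : ℝ) - 1) * Module.finrank ℂ V := by
    intro π hπ h1 h2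
    obtain ⟨m, hm1, hm2, hm3, hm4⟩ := exists_maximal_hasInv h1 h2
    obtain ⟨k, hk⟩ : ∃ k, k + m = Fintype.card α := ⟨Fintype.card α - m, by omega⟩
    by_cases hk3 : 3 ≤ k
    · refine (hπ.norm_trace_le_exitAverage hm3 hm4 σ).trans
        (mul_le_mul_of_nonneg_right (le_trans ?_ hninv) (by positivity))
      have h3 := hexit s hs₁' α σ hsn hns hfix.le k m hk hk3 hm1
      rw [← hk, Nat.add_sub_cancel]
      push_cast
      exact h3
    · obtain rfl | rfl : k = 1 ∨ k = 2 := by omega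
      · have hm : m = Fintype.card α - 1 := by omega
        rw [hπ.trace_of_hasInv_pred (by omega) (hm ▸ hm3) h2, hfix, norm_mul, norm_div,
          Complex.norm_natCast]
        have e1 : ‖((2 : ℕ) : ℂ) - 1‖ = 1 := by norm_num
        have e2 : ‖(Fintype.card α : ℂ) - 1‖ = (Fintype.card α : ℝ) - 1 := by
          have : (Fintype.card α : ℂ) - 1 = (((Fintype.card α : ℝ) - 1 : ℝ) : ℂ) := by
            push_cast
            rfl
          rw [this, Complex.norm_real, Real.norm_of_nonneg (by linarith)]
        rw [e1, e2]
      · have hm : m = Fintype.card α - 2 := by omega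
        have hm' : m + 1 = Fintype.card α - 1 := by omega
        exact hπ.norm_trace_of_hasInv_sub_two (by omega) (hm ▸ hm3) (hm' ▸ hm4) σ hfix
  by_cases hA : HasInv ρ (s ^ 8)
  · exact case ρ hρ hA hg.1
  by_cases hA' : HasInv (signTwist ρ) (s ^ 8)
  · rw [← norm_trace_signTwist]
    exact case _ hρ.signTwist hA' hg.2
  have hgen : IsGeneric ρ (s ^ 8) := ⟨hA, hA'⟩
  by_cases hlong : ∃ x, s ^ 9 ≤ (orbitOf σ x).card
  · obtain ⟨x, hx⟩ := hlong
    exact (hgen.norm_trace_le_of_orbit (by omega) hcyc' hns hx).trans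
      (mul_le_mul_of_nonneg_right hninv (by positivity))
  push Not at hlong
  have hcard := Finset.card_filter_add_card_filter_not (s := (Finset.univ : Finset α))
    (fun x => σ x = x)
  rw [hfix, Finset.card_univ] at hcard
  obtain ⟨l, hl, hdis, hB⟩ := exists_blocks (σ := σ) (L := s ^ 9) (by omega) hlong (s / 3)
    (Finset.univ.filter fun x => ¬ σ x = x) (fun x => by simp) (by
      have h1 : s / 3 * (2 * s ^ 9) ≤ s ^ 10 - 2 := by
        have h2 : 3 * (s / 3) ≤ s := Nat.mul_div_le s 3
        have h3 : 3 * (s / 3) * s ^ 9 ≤ s * s ^ 9 := Nat.mul_le_mul_right _ h2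
        have h4 : 3 * (s / 3) * s ^ 9 = 3 * (s / 3 * s ^ 9) := by ring
        have h5 : s / 3 * (2 * s ^ 9) = 2 * (s / 3 * s ^ 9) := by ring
        omega
      omega)
  have h89 : s ^ 8 ≤ s ^ 9 := Nat.pow_le_pow_right (by omega) (by norm_num)
  have key := norm_trace_le_pow_of_blocks ρ σ hc0.le l hdis fun B hBl => by
    obtain ⟨h1, h2, h3, h4⟩ := hB B hBl
    refine ⟨h2, hgen.blockBound_of_derangementBound h2 (by omega) (hder _ (by omega)) ?_⟩
    intro x hx
    exact (Finset.mem_filter.1 (h1 hx)).2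
  rw [hl] at key
  refine key.trans (mul_le_mul_of_nonneg_right ?_ (by positivity))
  exact (hblk _ hns (by omega)).trans hninv

end Bounds

section MoreFixedPoints

open Equiv

variable {α : Type} [Fintype α] [DecidableEq α] {V : Type} [AddCommGroup V] [Module ℂ V]
  [FiniteDimensional ℂ V]

lemma IsIrr.norm_trace_of_hasInv_pred {ρ : Representation ℂ (Perm α) V} (hρ : IsIrr ρ)
    (hn : 2 ≤ Fintype.card α) (hm : HasInv ρ (Fintype.card α - 1))
    (hmax : ¬ HasInv ρ (Fintype.card α)) {σ : Perm α}
    (hf : 1 ≤ (Finset.univ.filter fun x => σ x = x).card) :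
    ‖LinearMap.trace ℂ V (ρ σ)‖ = (((Finset.univ.filter fun x => σ x = x).card : ℝ) - 1) /
      ((Fintype.card α : ℝ) - 1) * Module.finrank ℂ V := by
  have norm_sub_one : ∀ a : ℕ, 1 ≤ a → ‖(a : ℂ) - 1‖ = (a : ℝ) - 1 := by
    intro a ha
    rw [← Nat.cast_one, ← Nat.cast_sub ha, Complex.norm_natCast, Nat.cast_sub ha, Nat.cast_one]
  rw [hρ.trace_of_hasInv_pred hn hm hmax, norm_mul, norm_div, Complex.norm_natCast,
    norm_sub_one _ hf, norm_sub_one _ (by omega)]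

lemma card_filter_subtypePerm (σ : Perm α) {x : α} (hx : σ x = x)
    (hinv : ∀ y, σ y ∈ ({x}ᶜ : Finset α) ↔ y ∈ ({x}ᶜ : Finset α)) :
    (Finset.univ.filter fun y => σ.subtypePerm hinv y = y).card + 1 =
      (Finset.univ.filter fun y => σ y = y).card := by
  have hxm : x ∈ Finset.univ.filter fun y => σ y = y := by simpa using hx
  rw [← Finset.card_erase_add_one hxm, Nat.add_right_cancel_iff]
  rw [← Finset.card_map (Function.Embedding.subtype _)]
  congr 1
  ext y
  simp only [Finset.mem_map, Finset.mem_filter, Finset.mem_univ, true_and, Finset.mem_erase,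
    Function.Embedding.coe_subtype]
  constructor
  · rintro ⟨z, hz, rfl⟩
    exact ⟨by simpa only [Finset.mem_compl, Finset.mem_singleton] using z.2,
      congrArg Subtype.val hz⟩
  · rintro ⟨h1, h2⟩
    exact ⟨⟨y, by simpa only [Finset.mem_compl, Finset.mem_singleton] using h1⟩,
      Subtype.ext h2, rfl⟩

end MoreFixedPoints

open Equiv in
/-- Generic irreducible characters at permutations with at least two fixed points and large support
are dominated by the standard character. -/
lemma exists_generic_bound : ∃ N₀, 100 ≤ N₀ ∧ ∀ (f : ℕ) (α : Type) [Fintype α] [DecidableEq α]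
    (V : Type) [AddCommGroup V] [Module ℂ V] [FiniteDimensional ℂ V]
    (ρ : Representation ℂ (Perm α) V) (σ : Perm α), N₀ + f ≤ Fintype.card α →
    (Finset.univ.filter fun x => σ x = x).card = f + 2 →
    IsIrr ρ → IsGeneric ρ (Fintype.card α) →
    ‖LinearMap.trace ℂ V (ρ σ)‖ ≤
      ((f : ℝ) + 1) / ((Fintype.card α : ℝ) - 1) * Module.finrank ℂ V := by
  obtain ⟨N₀, hN₀, h⟩ := exists_two_fixed_bound
  refine ⟨N₀, hN₀, fun f => ?_⟩
  induction f with
  | zero =>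
    intro α _ _ V _ _ _ ρ σ hα hf hρ hg
    simpa using h α V ρ σ hα hf hρ hg
  | succ f ih =>
    intro α _ _ V _ _ _ ρ σ hα hf hρ hg
    have pred_case : ∀ π : Representation ℂ (Perm α) V, IsIrr π →
        HasInv π (Fintype.card α - 1) → ¬ HasInv π (Fintype.card α) →
        ‖LinearMap.trace ℂ V (π σ)‖ ≤
          (((f + 1 : ℕ) : ℝ) + 1) / ((Fintype.card α : ℝ) - 1) * Module.finrank ℂ V := by
      intro π hπ h1 h2
      rw [hπ.norm_trace_of_hasInv_pred (by omega) h1 h2 (by omega), hf]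
      push_cast
      apply le_of_eq
      ring
    by_cases hA : HasInv ρ (Fintype.card α - 1)
    · exact pred_case ρ hρ hA hg.1
    by_cases hA' : HasInv (signTwist ρ) (Fintype.card α - 1)
    · rw [← norm_trace_signTwist]
      exact pred_case _ hρ.signTwist hA' hg.2
    obtain ⟨x, hx⟩ := Finset.card_pos.1
      (show 0 < (Finset.univ.filter fun x => σ x = x).card by omega)
    have hx : σ x = x := (Finset.mem_filter.1 hx).2
    have hinv : ∀ y, σ y ∈ ({x}ᶜ : Finset α) ↔ y ∈ ({x}ᶜ : Finset α) := by
      intro y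
      simp only [Finset.mem_compl, Finset.mem_singleton]
      rw [not_iff_not]
      exact ⟨fun hy => σ.injective (hy.trans hx.symm), fun hy => hy ▸ hx⟩
    have hB : ({x}ᶜ : Finset α).card = Fintype.card α - 1 := by
      rw [Finset.card_compl, Finset.card_singleton]
    have hBcard : Fintype.card ({x}ᶜ : Finset α) = Fintype.card α - 1 := by
      rw [Fintype.card_coe, hB]
    have hfix := card_filter_subtypePerm σ hx hinv
    have hαR : (100 : ℝ) + f ≤ Fintype.card α := by
      have : 100 + f ≤ Fintype.card α := by omega
      exact_mod_cast this
    have hf0 : (0 : ℝ) ≤ f := by positivity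
    have hblock : BlockBound ρ σ ({x}ᶜ : Finset α)
        (((f : ℝ) + 1) / ((Fintype.card α : ℝ) - 2)) := by
      refine IsGeneric.blockBound_of_forall_irr ⟨hA, hA'⟩ hinv ?_
      intro W _ _ _ π hπ hπg
      have key := ih ({x}ᶜ : Finset α) W π (σ.subtypePerm hinv) (by omega) (by omega) hπ
        (by rwa [hBcard])
      rw [hBcard, Nat.cast_sub (by omega), Nat.cast_one] at key
      convert key using 3
      ring
    have key := norm_trace_le_pow_of_blocks ρ σ
      (c := ((f : ℝ) + 1) / ((Fintype.card α : ℝ) - 2))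
      (div_nonneg (by linarith) (by linarith)) [{x}ᶜ] (by simp) (fun C hC => by
        rw [List.mem_singleton.1 hC]
        exact ⟨hinv, hblock⟩)
    rw [List.length_singleton, pow_one] at key
    refine key.trans (mul_le_mul_of_nonneg_right ?_ (by positivity))
    rw [div_le_div_iff₀ (by linarith) (by linarith)]
    push_cast
    nlinarith

section Categorical

open CategoryTheory

lemma isIrr_of_simple {G : Type} [Group G] (V : FDRep ℂ G) [Simple V] : IsIrr V.ρ := by
  refine ⟨?_, fun W hW => ?_⟩
  · by_contra hV
    have hsub : Subsingleton V := not_nontrivial_iff_subsingleton.1 hV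
    apply id_nonzero V
    ext v
    exact Subsingleton.elim _ _
  · let f : FDRep.of (subRep V.ρ W hW) ⟶ V :=
      ⟨InducedCategory.homMk (ModuleCat.ofHom W.subtype), fun g => rfl⟩
    have hf : ∀ w : W, f.hom.hom.hom w = w := fun w => rfl
    have hmono : Mono f := ConcreteCategory.mono_of_injective f Subtype.val_injective
    by_cases hzero : f = 0
    · left
      rw [Submodule.eq_bot_iff]
      intro w hw
      have := hf ⟨w, hw⟩
      rw [hzero] at this
      exact this.symm
    · right
      have hiso : IsIso f := isIso_of_mono_of_nonzero hzero
      rw [Submodule.eq_top_iff']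
      intro v
      obtain ⟨w, hw⟩ := (FDRep.isoToLinearEquiv (asIso f)).surjective v
      rw [← hw]
      exact w.2

end Categorical

section Invariants

open Equiv

variable {α : Type} [Fintype α] [DecidableEq α] {V : Type} [AddCommGroup V] [Module ℂ V]
  [FiniteDimensional ℂ V]

lemma IsIrr.trace_eq_one_of_hasInv_card {ρ : Representation ℂ (Perm α) V} (hρ : IsIrr ρ)
    (h : HasInv ρ (Fintype.card α)) (σ : Perm α) : LinearMap.trace ℂ V (ρ σ) = 1 := by
  obtain ⟨B, hB, v, hv, hinv⟩ := h
  obtain rfl : B = Finset.univ := Finset.card_eq_iff_eq_univ B |>.1 hB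
  have hfix : ∀ g, ρ g v = v := fun g => hinv g (by simp [mem_symOn])
  have htop : Submodule.span ℂ {v} = ⊤ := by
    refine (hρ.2 _ fun g w hw => ?_).resolve_left (by simpa using hv)
    obtain ⟨c, rfl⟩ := Submodule.mem_span_singleton.1 hw
    rw [map_smul, hfix]
    exact Submodule.smul_mem _ _ (Submodule.mem_span_singleton_self v)
  have hone : ρ σ = 1 := by
    ext w
    obtain ⟨c, rfl⟩ := Submodule.mem_span_singleton.1
      (htop ▸ Submodule.mem_top : w ∈ Submodule.span ℂ {v})
    rw [map_smul, hfix, Module.End.one_apply]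
  rw [hone, LinearMap.trace_one, ← finrank_top ℂ V, ← htop, finrank_span_singleton hv, Nat.cast_one]

lemma trace_eq_sign_of_hasInv_card {ρ : Representation ℂ (Perm α) V} (hρ : IsIrr ρ)
    (h : HasInv (signTwist ρ) (Fintype.card α)) (σ : Perm α) :
    LinearMap.trace ℂ V (ρ σ) = ((Perm.sign σ : ℤ) : ℂ) := by
  have key := hρ.signTwist.trace_eq_one_of_hasInv_card h σ
  have happ : signTwist ρ σ = ((Perm.sign σ : ℤ) : ℂ) • ρ σ := rfl
  rw [happ, map_smul, smul_eq_mul] at key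
  rcases Int.units_eq_one_or (Perm.sign σ) with hs | hs <;> rw [hs] at key ⊢
  · simpa using key
  · simpa [neg_eq_iff_eq_neg] using key

end Invariants

/-- **Corollary (c₁ ≥ 2 and large support).** There is `N` such that for every `n ≥ N` and
every `σ ∈ S_n` with `c₁(σ) ≥ 2` and `|supp(σ)| ≥ N - 2`, the standard representation
rules for `σ`: `χ̃(σ) ≤ (c₁(σ)-1)/(n-1)` for every irreducible `χ ∉ {triv, sgn}`. -/
theorem std_rules_of_large_support :
    ∃ N : ℕ, ∀ n : ℕ, n ≥ N → ∀ σ : Equiv.Perm (Fin n),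
      2 ≤ fixCount σ → N - 2 ≤ σ.support.card →
      ∀ V : FDRep ℂ (Equiv.Perm (Fin n)), IsNontrivIrr V →
        normChar V σ ≤ ((fixCount σ : ℝ) - 1) / ((n : ℝ) - 1) := by
  obtain ⟨N₀, hN₀, hbound⟩ := exists_generic_bound
  refine ⟨N₀, fun n hn σ hfix hsupp V ⟨hsimple, htriv, hsign⟩ => ?_⟩
  have hirr := isIrr_of_simple V
  have htr : ∀ g, V.character g = LinearMap.trace ℂ V (V.ρ g) := fun g => rfl
  have hgen : IsGeneric V.ρ (Fintype.card (Fin n)) :=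
    ⟨fun h => htriv (funext (hirr.trace_eq_one_of_hasInv_card h)),
      fun h => hsign (funext (trace_eq_sign_of_hasInv_card hirr h))⟩
  have hcard := Finset.card_filter_add_card_filter_not (s := (Finset.univ : Finset (Fin n)))
    (fun x => σ x = x)
  have hsupport : (Finset.univ.filter fun x => ¬ σ x = x) = σ.support := by
    ext x
    simp
  rw [hsupport, Finset.card_univ, Fintype.card_fin] at hcard
  change fixCount σ + _ = n at hcard
  obtain ⟨f, hf⟩ := Nat.exists_eq_add_of_le' hfix
  have key := hbound f (Fin n) V V.ρ σ (by rw [Fintype.card_fin]; omega) hf hirr hgen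
  have hnontriv : Nontrivial V := hirr.1
  have hpos : (0 : ℝ) < Module.finrank ℂ V := by exact_mod_cast Module.finrank_pos
  refine (Complex.re_le_norm _).trans ?_
  rw [norm_div, FDRep.char_one, Complex.norm_natCast, div_le_iff₀ hpos, htr, hf]
  rw [Fintype.card_fin] at key
  have hf2 : ((f + 2 : ℕ) : ℝ) - 1 = f + 1 := by
    push_cast
    ring
  rw [hf2]
  exact key
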